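/- Let (u_{p_n}) be least energy solutions of the Finsler Lane-Emden problem with p_n → ∞, set v_n = u_{p_n}/(∫_Ω u_{p_n}^{p_n} dx)^{1/(N-1)}, and let S be the blow-up set of (v_n). If S consists of a single point, S = {x₀} with x₀ ∈ Ω̄, then x₀ ∈ Ω, i.e. the blow-up point is an interior point of Ω. -/

import Mathlib

open MeasureTheory Filter Real Set
open scoped RealInnerProductSpace Topology NNReal

noncomputable section

abbrev Euc (N : ℕ) := EuclideanSpace ℝ (Fin N)

/-- `H` is a norm on `ℝ^N`: convex, nonnegative, vanishing exactly at `0`,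
and absolutely homogeneous. -/
def IsFinslerNorm (N : ℕ) (H : Euc N → ℝ) : Prop :=
  ConvexOn ℝ Set.univ H ∧
  (∀ ξ, 0 ≤ H ξ) ∧
  (∀ ξ, H ξ = 0 ↔ ξ = 0) ∧
  (∀ (t : ℝ) (ξ : Euc N), H (t • ξ) = |t| * H ξ)

/-- Regularity assumptions: `H ∈ C²(ℝ^N \ {0})`, `H^N ∈ C¹(ℝ^N)`, and the Hessian of
`H^N` is positive definite away from the origin. -/
def FinslerRegular (N : ℕ) (H : Euc N → ℝ) : Prop :=
  ContDiffOn ℝ 2 H {(0 : Euc N)}ᶜ ∧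
  ContDiff ℝ 1 (fun ξ => H ξ ^ N) ∧
  ∀ ξ : Euc N, ξ ≠ 0 → ∀ v : Euc N, v ≠ 0 →
    0 < iteratedFDeriv ℝ 2 (fun ξ => H ξ ^ N) ξ ![v, v]

/-- The dual norm `H⁰(x) = sup_{ξ ≠ 0} ⟪x, ξ⟫ / H(ξ)`. -/
def dualNorm {N : ℕ} (H : Euc N → ℝ) (x : Euc N) : ℝ :=
  sSup {r : ℝ | ∃ ξ : Euc N, ξ ≠ 0 ∧ r = ⟪x, ξ⟫ / H ξ}

/-- `κ_N`, the volume of the Wulff ball `{H⁰ < 1}`. -/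
def wulffVol (N : ℕ) (H : Euc N → ℝ) : ℝ :=
  (volume {x : Euc N | dualNorm H x < 1}).toReal

/-- `β_N = N (N κ_N)^{1/(N-1)}`. -/
def betaN (N : ℕ) (H : Euc N → ℝ) : ℝ :=
  N * (N * wulffVol N H) ^ ((1 : ℝ) / ((N : ℝ) - 1))

/-- `u` is a weak solution of `-Q_N u = g` on the open set `U`:
`∫_U H(∇u)^{N-1} ⟪∇H(∇u), ∇φ⟫ = ∫_U g φ` for all test functions `φ`. -/
def IsWeakSolution (N : ℕ) (H : Euc N → ℝ) (U : Set (Euc N)) (u g : Euc N → ℝ) : Prop :=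
  ∀ φ : Euc N → ℝ, ContDiff ℝ (⊤ : ℕ∞) φ → HasCompactSupport φ → tsupport φ ⊆ U →
    (∫ x in U, H (gradient u x) ^ (N - 1) * ⟪gradient H (gradient u x), gradient φ x⟫)
      = ∫ x in U, g x * φ x

/-- `C_p`, the infimum of `∫_Ω H(∇u)^N` over test functions normalized in `L^{p+1}`. -/
def energyInf (N : ℕ) (H : Euc N → ℝ) (Ω : Set (Euc N)) (p : ℝ) : ℝ :=
  sInf {c : ℝ | ∃ u : Euc N → ℝ, ContDiff ℝ (⊤ : ℕ∞) u ∧ HasCompactSupport u ∧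
    tsupport u ⊆ Ω ∧ (∫ x in Ω, |u x| ^ (p + 1)) = 1 ∧
    c = ∫ x in Ω, H (gradient u x) ^ N}

/-- A least energy solution of the Finsler Lane–Emden problem on `Ω` with exponent `p`. -/
def IsLeastEnergySolution (N : ℕ) (H : Euc N → ℝ) (Ω : Set (Euc N)) (p : ℝ)
    (u : Euc N → ℝ) : Prop :=
  ContDiffOn ℝ 1 u (closure Ω) ∧
  (∀ x ∈ Ω, 0 < u x) ∧
  (∀ x ∈ frontier Ω, u x = 0) ∧
  IsWeakSolution N H Ω u (fun x => u x ^ p) ∧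
  (∫ x in Ω, H (gradient u x) ^ N)
    = energyInf N H Ω p * (∫ x in Ω, u x ^ (p + 1)) ^ ((N : ℝ) / (p + 1))

/-- The blow-up set of a sequence of functions `v n` on `Ω`. -/
def BlowUpSet {N : ℕ} (Ω : Set (Euc N)) (v : ℕ → Euc N → ℝ) : Set (Euc N) :=
  {x | x ∈ closure Ω ∧ ∃ σ : ℕ → ℕ, StrictMono σ ∧ ∃ xs : ℕ → Euc N,
    (∀ n, xs n ∈ Ω) ∧ Tendsto xs atTop (𝓝 x) ∧
    Tendsto (fun n => v (σ n) (xs n)) atTop atTop}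

namespace FinslerLaneEmden

section Norm

variable {N : ℕ} {H : Euc N → ℝ}

lemma norm_add_le' (hH : IsFinslerNorm N H) (x y : Euc N) : H (x + y) ≤ H x + H y := by
  have h := hH.1.2 (mem_univ ((2 : ℝ) • x)) (mem_univ ((2 : ℝ) • y))
    (by norm_num : (0 : ℝ) ≤ 1 / 2) (by norm_num : (0 : ℝ) ≤ 1 / 2) (by norm_num)
  rw [hH.2.2.2, hH.2.2.2] at h
  simp only [smul_smul, smul_eq_mul] at h
  norm_num at h
  linarith

lemma norm_smul' (hH : IsFinslerNorm N H) (c : ℝ) (x : Euc N) : H (c • x) = |c| * H x :=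
  hH.2.2.2 c x

lemma norm_nonneg' (hH : IsFinslerNorm N H) (x : Euc N) : 0 ≤ H x := hH.2.1 x

lemma norm_zero' (hH : IsFinslerNorm N H) : H 0 = 0 := (hH.2.2.1 0).2 rfl

lemma norm_neg' (hH : IsFinslerNorm N H) (x : Euc N) : H (-x) = H x := by
  simpa using norm_smul' hH (-1) x

lemma continuous_norm' (hH : IsFinslerNorm N H) : Continuous H := by
  rw [← continuousOn_univ]
  exact hH.1.continuousOn isOpen_univ

lemma exists_le_norm (hN : 2 ≤ N) (hH : IsFinslerNorm N H) :
    ∃ a : ℝ, 0 < a ∧ ∀ x, a * ‖x‖ ≤ H x := by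
  have : Nonempty (Fin N) := ⟨⟨0, by omega⟩⟩
  obtain ⟨z, hz, hmin⟩ := (isCompact_sphere (0 : Euc N) 1).exists_isMinOn
    (NormedSpace.sphere_nonempty.2 zero_le_one) (continuous_norm' hH).continuousOn
  have hz1 : ‖z‖ = 1 := by simpa using hz
  have hz0 : z ≠ 0 := by
    rintro rfl
    simp at hz1
  refine ⟨H z, lt_of_le_of_ne (norm_nonneg' hH z) fun h => hz0 ((hH.2.2.1 z).1 h.symm), ?_⟩
  intro x
  rcases eq_or_ne x 0 with rfl | hx
  · simp [norm_zero' hH]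
  have hx' : 0 < ‖x‖ := norm_pos_iff.2 hx
  have h1 : H z ≤ H (‖x‖⁻¹ • x) := hmin (by simp [norm_smul, hx'.ne'])
  rw [norm_smul' hH, abs_of_pos (inv_pos.2 hx')] at h1
  calc H z * ‖x‖ ≤ ‖x‖⁻¹ * H x * ‖x‖ := by gcongr
    _ = H x := by field_simp

lemma exists_norm_le (hH : IsFinslerNorm N H) :
    ∃ b : ℝ, 0 < b ∧ ∀ x, H x ≤ b * ‖x‖ := by
  obtain ⟨B, hB⟩ := ((isCompact_sphere (0 : Euc N) 1).image (continuous_norm' hH)).bddAbove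
  refine ⟨max B 1, by positivity, fun x => ?_⟩
  rcases eq_or_ne x 0 with rfl | hx
  · simp [norm_zero' hH]
  have hx' : 0 < ‖x‖ := norm_pos_iff.2 hx
  have h1 : H (‖x‖⁻¹ • x) ≤ max B 1 :=
    (hB ⟨_, by simp [norm_smul, hx'.ne'], rfl⟩).trans (le_max_left _ _)
  rw [norm_smul' hH, abs_of_pos (inv_pos.2 hx')] at h1
  calc H x = ‖x‖⁻¹ * H x * ‖x‖ := by field_simp
    _ ≤ max B 1 * ‖x‖ := by gcongr

lemma hasGradientAt_norm (hreg : FinslerRegular N H) {ξ : Euc N} (hξ : ξ ≠ 0) :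
    HasGradientAt H (gradient H ξ) ξ := by
  have h : ContDiffAt ℝ 2 H ξ := hreg.1.contDiffAt (isOpen_compl_singleton.mem_nhds hξ)
  exact (h.differentiableAt (by norm_num)).hasGradientAt

lemma inner_gradient_norm_le (hH : IsFinslerNorm N H) (hreg : FinslerRegular N H) {ξ : Euc N}
    (hξ : ξ ≠ 0) (η : Euc N) : ⟪gradient H ξ, η⟫ ≤ H η := by
  have h := (hasGradientAt_norm hreg hξ).hasFDerivAt.hasLineDerivAt η
  have h' : HasDerivAt (fun t : ℝ => H (ξ + t • η)) ⟪gradient H ξ, η⟫ 0 := by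
    simpa [HasLineDerivAt] using h
  have h2 := h'.tendsto_slope_zero_right
  refine le_of_tendsto h2 ?_
  filter_upwards [self_mem_nhdsWithin] with t ht
  have ht : 0 < t := ht
  have := norm_add_le' hH ξ (t • η)
  rw [norm_smul' hH, abs_of_pos ht] at this
  simp only [zero_add, zero_smul, add_zero, smul_eq_mul]
  rw [inv_mul_le_iff₀ ht]
  linarith

lemma inner_gradient_norm_self (hH : IsFinslerNorm N H) (hreg : FinslerRegular N H) {ξ : Euc N}
    (hξ : ξ ≠ 0) : ⟪gradient H ξ, ξ⟫ = H ξ := by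
  have h := (hasGradientAt_norm hreg hξ).hasFDerivAt.hasLineDerivAt ξ
  have h' : HasDerivAt (fun t : ℝ => H (ξ + t • ξ)) ⟪gradient H ξ, ξ⟫ 0 := by
    simpa [HasLineDerivAt] using h
  have h2 : HasDerivAt (fun t : ℝ => (1 + t) * H ξ) (H ξ) 0 := by
    simpa using ((hasDerivAt_id (0 : ℝ)).const_add 1).mul_const (H ξ)
  refine h'.unique (h2.congr_of_eventuallyEq ?_)
  filter_upwards [Ioi_mem_nhds (show (-1 : ℝ) < 0 by norm_num)] with t ht
  have ht : -1 < t := ht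
  have : ξ + t • ξ = (1 + t) • ξ := by rw [add_smul, one_smul]
  rw [this, norm_smul' hH, abs_of_pos (by linarith)]

/-- The pairing `H(ξ)^{N-1} ⟪∇H(ξ), η⟫` of the Finsler flux of `ξ` with `η`. -/
def flux (N : ℕ) (H : Euc N → ℝ) (ξ η : Euc N) : ℝ := H ξ ^ (N - 1) * ⟪gradient H ξ, η⟫

lemma abs_flux_le (hN : 2 ≤ N) (hH : IsFinslerNorm N H) (hreg : FinslerRegular N H)
    (ξ η : Euc N) : |flux N H ξ η| ≤ H ξ ^ (N - 1) * H η := by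
  unfold flux
  rcases eq_or_ne ξ 0 with rfl | hξ
  · rw [norm_zero' hH, zero_pow (by omega)]
    simp
  rw [abs_mul, abs_of_nonneg (pow_nonneg (norm_nonneg' hH ξ) _)]
  gcongr
  · exact pow_nonneg (norm_nonneg' hH ξ) _
  rw [abs_le]
  refine ⟨?_, inner_gradient_norm_le hH hreg hξ η⟩
  have := inner_gradient_norm_le hH hreg hξ (-η)
  rw [norm_neg' hH, inner_neg_right] at this
  linarith

lemma flux_self (hN : 2 ≤ N) (hH : IsFinslerNorm N H) (hreg : FinslerRegular N H)
    (ξ : Euc N) : flux N H ξ ξ = H ξ ^ N := by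
  unfold flux
  rcases eq_or_ne ξ 0 with rfl | hξ
  · rw [norm_zero' hH, zero_pow (by omega), zero_pow (by omega)]
    simp
  rw [inner_gradient_norm_self hH hreg hξ, ← pow_succ]
  congr 1
  omega

lemma flux_add (ξ η η' : Euc N) : flux N H ξ (η + η') = flux N H ξ η + flux N H ξ η' := by
  simp [flux, inner_add_right, mul_add]

lemma flux_smul (ξ η : Euc N) (c : ℝ) : flux N H ξ (c • η) = c * flux N H ξ η := by
  simp [flux, inner_smul_right]
  ring

lemma flux_zero (ξ : Euc N) : flux N H ξ 0 = 0 := by simp [flux]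

end Norm

section Gradient

variable {N : ℕ} {H : Euc N → ℝ}

lemma norm_gradient_eq (f : Euc N → ℝ) (x : Euc N) : ‖gradient f x‖ = ‖fderiv ℝ f x‖ := by
  simp [gradient]

lemma measurable_gradient (f : Euc N → ℝ) : Measurable (gradient f) :=
  (InnerProductSpace.toDual ℝ (Euc N)).symm.continuous.measurable.comp (measurable_fderiv ℝ f)

lemma norm_gradient_le {f : Euc N → ℝ} {C : ℝ≥0} (hf : LipschitzWith C f) (x : Euc N) :
    ‖gradient f x‖ ≤ C := by
  rw [norm_gradient_eq]
  exact norm_fderiv_le_of_lipschitz ℝ hf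

lemma gradient_eq_zero_of_nonneg {f : Euc N → ℝ} (hf : ∀ y, 0 ≤ f y) {x : Euc N} (hx : f x = 0) :
    gradient f x = 0 := by
  have h : IsLocalMin f x := Eventually.of_forall fun y => by rw [hx]; exact hf y
  simp [gradient, h.fderiv_eq_zero]

lemma gradient_eq_zero_of_le {f : Euc N → ℝ} {c : ℝ} (hf : ∀ y, f y ≤ c) {x : Euc N}
    (hx : f x = c) : gradient f x = 0 := by
  have h : IsLocalMax f x := Eventually.of_forall fun y => by rw [hx]; exact hf y
  simp [gradient, h.fderiv_eq_zero]

lemma hasGradientAt_comp {f : Euc N → ℝ} {g : ℝ → ℝ} {g' : ℝ} {x : Euc N}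
    (hf : DifferentiableAt ℝ f x) (hg : HasDerivAt g g' (f x)) :
    HasGradientAt (fun y => g (f y)) (g' • gradient f x) x := by
  have := hg.comp_hasFDerivAt x hf.hasGradientAt.hasFDerivAt
  rw [hasGradientAt_iff_hasFDerivAt, map_smul]
  exact this

lemma hasGradientAt_mul {f g : Euc N → ℝ} {x : Euc N}
    (hf : DifferentiableAt ℝ f x) (hg : DifferentiableAt ℝ g x) :
    HasGradientAt (fun y => f y * g y) (f x • gradient g x + g x • gradient f x) x := by
  have := hf.hasGradientAt.hasFDerivAt.mul hg.hasGradientAt.hasFDerivAt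
  rw [hasGradientAt_iff_hasFDerivAt, map_add, map_smul, map_smul]
  exact this

lemma gradient_comp {f : Euc N → ℝ} {g : ℝ → ℝ} {g' : ℝ} {x : Euc N}
    (hf : DifferentiableAt ℝ f x) (hg : HasDerivAt g g' (f x)) :
    gradient (fun y => g (f y)) x = g' • gradient f x :=
  (hasGradientAt_comp hf hg).gradient

lemma gradient_mul {f g : Euc N → ℝ} {x : Euc N}
    (hf : DifferentiableAt ℝ f x) (hg : DifferentiableAt ℝ g x) :
    gradient (fun y => f y * g y) x = f x • gradient g x + g x • gradient f x :=
  (hasGradientAt_mul hf hg).gradient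

lemma gradient_sub_const {f : Euc N → ℝ} (c : ℝ) (x : Euc N) :
    gradient (fun y => f y - c) x = gradient f x := by
  simp [gradient, fderiv_sub_const]

lemma gradient_const_mul {f : Euc N → ℝ} {x : Euc N} (hf : DifferentiableAt ℝ f x) (c : ℝ) :
    gradient (fun y => c * f y) x = c • gradient f x := by
  have := gradient_comp (g := fun t => c * t) (g' := c) hf (by
    simpa using (hasDerivAt_id (f x)).const_mul c)
  exact this

lemma gradient_pow {f : Euc N → ℝ} {x : Euc N} (hf : DifferentiableAt ℝ f x) (n : ℕ) :
    gradient (fun y => f y ^ n) x = (n * f x ^ (n - 1)) • gradient f x :=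
  gradient_comp (g := fun t => t ^ n) hf (by simpa using hasDerivAt_pow n (f x))

/-- The gradient of the positive part of `f - c` is that of `f` on `{f > c}` and `0` elsewhere. -/
lemma gradient_max_sub {f : Euc N → ℝ} (hf : Continuous f) (c : ℝ) (x : Euc N) :
    gradient (fun y => max (f y - c) 0) x = if c < f x then gradient f x else 0 := by
  split_ifs with h
  · rw [← gradient_sub_const (f := f) c]
    apply Filter.EventuallyEq.gradient_eq
    filter_upwards [hf.continuousAt.eventually (Ioi_mem_nhds h)] with y hy
    exact max_eq_left (by have : c < f y := hy; linarith)
  · apply gradient_eq_zero_of_nonneg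
    · intro y; exact le_max_right _ _
    · exact max_eq_right (by linarith)

/-- The truncation of a real number to the unit interval. -/
def clip (t : ℝ) : ℝ := max 0 (min 1 t)

lemma clip_nonneg (t : ℝ) : 0 ≤ clip t := le_max_left _ _
lemma clip_le_one (t : ℝ) : clip t ≤ 1 := max_le zero_le_one (min_le_left _ _)
lemma clip_of_nonpos {t : ℝ} (h : t ≤ 0) : clip t = 0 :=
  max_eq_left ((min_le_right _ _).trans h)
lemma clip_of_one_le {t : ℝ} (h : 1 ≤ t) : clip t = 1 := by
  simp [clip, min_eq_left h]
lemma clip_of_mem {t : ℝ} (h : 0 ≤ t) (h' : t ≤ 1) : clip t = t := by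
  simp [clip, min_eq_right h', h]

lemma lipschitzWith_clip : LipschitzWith 1 clip := by
  have := (LipschitzWith.id (α := ℝ)).const_min 1 |>.const_max 0
  exact this

lemma gradient_clip {f : Euc N → ℝ} {x : Euc N} (hf : ContinuousAt f x) :
    gradient (fun y => clip (f y)) x = if 0 < f x ∧ f x < 1 then gradient f x else 0 := by
  split_ifs with h
  · apply Filter.EventuallyEq.gradient_eq
    filter_upwards [hf.eventually (Ioo_mem_nhds h.1 h.2)] with y hy
    exact clip_of_mem hy.1.le hy.2.le
  · rcases not_and_or.1 h with h | h
    · exact gradient_eq_zero_of_nonneg (fun y => clip_nonneg _) (clip_of_nonpos (not_lt.1 h))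
    · exact gradient_eq_zero_of_le (fun y => clip_le_one _) (clip_of_one_le (not_lt.1 h))

lemma measurable_norm_gradient (hH : IsFinslerNorm N H) (f : Euc N → ℝ) :
    Measurable fun x => H (gradient f x) :=
  (continuous_norm' hH).measurable.comp (measurable_gradient f)

lemma measurable_flux (hH : IsFinslerNorm N H) (f g : Euc N → ℝ) :
    Measurable fun x => flux N H (gradient f x) (gradient g x) := by
  unfold flux
  exact ((measurable_norm_gradient hH f).pow_const _).mul
    (((measurable_gradient H).comp (measurable_gradient f)).inner (measurable_gradient g))

end Gradient

section Lip

variable {N : ℕ}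

/-- Bounded Lipschitz functions. -/
def BddLip (f : Euc N → ℝ) : Prop := (∃ C : ℝ≥0, LipschitzWith C f) ∧ ∃ M : ℝ, ∀ x, |f x| ≤ M

lemma BddLip.continuous {f : Euc N → ℝ} (hf : BddLip f) : Continuous f :=
  hf.1.choose_spec.continuous

lemma BddLip.ae_differentiableAt {f : Euc N → ℝ} (hf : BddLip f) :
    ∀ᵐ x, DifferentiableAt ℝ f x := hf.1.choose_spec.ae_differentiableAt

lemma BddLip.const (c : ℝ) : BddLip (fun _ : Euc N => c) :=
  ⟨⟨0, LipschitzWith.const c⟩, |c|, fun _ => le_rfl⟩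

lemma BddLip.mul {f g : Euc N → ℝ} (hf : BddLip f) (hg : BddLip g) :
    BddLip (fun x => f x * g x) := by
  obtain ⟨⟨C, hC⟩, M, hM⟩ := hf
  obtain ⟨⟨D, hD⟩, K, hK⟩ := hg
  have hM0 : 0 ≤ M := (abs_nonneg _).trans (hM 0)
  have hK0 : 0 ≤ K := (abs_nonneg _).trans (hK 0)
  refine ⟨⟨Real.toNNReal M * D + Real.toNNReal K * C, LipschitzWith.of_dist_le_mul fun x y => ?_⟩, M * K,
    fun x => ?_⟩
  · have h1 := hC.dist_le_mul x y
    have h2 := hD.dist_le_mul x y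
    rw [Real.dist_eq] at h1 h2 ⊢
    have : f x * g x - f y * g y = f x * (g x - g y) + g y * (f x - f y) := by ring
    rw [this]
    refine (abs_add_le _ _).trans ?_
    rw [abs_mul, abs_mul]
    have e1 : |f x| * |g x - g y| ≤ M * (D * dist x y) := by gcongr; exact hM x
    have e2 : |g y| * |f x - f y| ≤ K * (C * dist x y) := by gcongr; exact hK y
    rw [NNReal.coe_add, NNReal.coe_mul, NNReal.coe_mul, Real.coe_toNNReal _ hM0,
      Real.coe_toNNReal _ hK0]
    linarith
  · rw [abs_mul]
    gcongr
    · exact hM x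
    · exact hK x

lemma BddLip.add {f g : Euc N → ℝ} (hf : BddLip f) (hg : BddLip g) :
    BddLip (fun x => f x + g x) := by
  obtain ⟨⟨C, hC⟩, M, hM⟩ := hf
  obtain ⟨⟨D, hD⟩, K, hK⟩ := hg
  exact ⟨⟨C + D, hC.add hD⟩, M + K, fun x => (abs_add_le _ _).trans (add_le_add (hM x) (hK x))⟩

lemma BddLip.pow {f : Euc N → ℝ} (hf : BddLip f) (n : ℕ) : BddLip (fun x => f x ^ n) := by
  induction n with
  | zero => simpa using BddLip.const 1
  | succ n ih => simpa only [pow_succ] using ih.mul hf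

lemma BddLip.comp {f : Euc N → ℝ} (hf : BddLip f) {M : ℝ} (h0 : ∀ x, 0 ≤ f x)
    (hM : ∀ x, f x ≤ M) {g : ℝ → ℝ} (hg : ∀ t, 0 ≤ t → ContDiffAt ℝ 1 g t) :
    BddLip (fun x => g (f x)) := by
  obtain ⟨⟨C, hC⟩, -⟩ := hf
  have hcd : ContDiffOn ℝ 1 g (Icc 0 M) := fun t ht => (hg t ht.1).contDiffWithinAt
  have hmem : ∀ x, f x ∈ Icc 0 M := fun x => ⟨h0 x, hM x⟩
  obtain ⟨B, hB⟩ := isCompact_Icc.exists_bound_of_continuousOn hcd.continuousOn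
  have hder : ContinuousOn (deriv g) (Icc 0 M) := fun t ht =>
    ((hg t ht.1).derivWithin (m := 0) (by norm_num)).continuousAt.continuousWithinAt
  obtain ⟨D, hD⟩ := isCompact_Icc.exists_bound_of_continuousOn hder
  have hlip : LipschitzOnWith (Real.toNNReal D) g (Icc 0 M) := by
    refine (convex_Icc 0 M).lipschitzOnWith_of_nnnorm_deriv_le
      (fun t ht => (hg t ht.1).differentiableAt (by norm_num)) fun t ht => ?_
    rw [← NNReal.coe_le_coe, coe_nnnorm]
    exact (hD t ht).trans (Real.le_coe_toNNReal D)
  refine ⟨⟨Real.toNNReal D * C, LipschitzWith.of_dist_le_mul fun x y => ?_⟩, B,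
    fun x => hB _ (hmem x)⟩
  refine (hlip.dist_le_mul _ (hmem x) _ (hmem y)).trans ?_
  push_cast
  rw [mul_assoc]
  gcongr
  exact hC.dist_le_mul x y

/-- Nonnegative Lipschitz functions on the whole space vanishing off `Ω`. -/
def Adm (Ω : Set (Euc N)) (f : Euc N → ℝ) : Prop :=
  BddLip f ∧ (∀ x, 0 ≤ f x) ∧ ∀ x ∉ Ω, f x = 0

variable {Ω : Set (Euc N)} {f : Euc N → ℝ}

lemma Adm.bddLip (hf : Adm Ω f) : BddLip f := hf.1
lemma Adm.nonneg (hf : Adm Ω f) (x : Euc N) : 0 ≤ f x := hf.2.1 x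
lemma Adm.eq_zero (hf : Adm Ω f) {x : Euc N} (hx : x ∉ Ω) : f x = 0 := hf.2.2 x hx
lemma Adm.continuous (hf : Adm Ω f) : Continuous f := hf.1.continuous
lemma Adm.exists_bound (hf : Adm Ω f) : ∃ M, 0 ≤ M ∧ ∀ x, f x ≤ M := by
  obtain ⟨M, hM⟩ := hf.1.2
  exact ⟨M, (abs_nonneg _).trans (hM 0), fun x => (le_abs_self _).trans (hM x)⟩

lemma Adm.gradient_eq_zero (hf : Adm Ω f) {x : Euc N} (hx : f x = 0) : gradient f x = 0 :=
  gradient_eq_zero_of_nonneg hf.2.1 hx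

lemma Adm.gradient_eq_zero' (hf : Adm Ω f) {x : Euc N} (hx : x ∉ Ω) : gradient f x = 0 :=
  hf.gradient_eq_zero (hf.2.2 x hx)

lemma Adm.mono (hf : Adm Ω f) {Ω' : Set (Euc N)} (h : Ω ⊆ Ω') : Adm Ω' f :=
  ⟨hf.1, hf.2.1, fun x hx => hf.2.2 x fun h' => hx (h h')⟩

lemma Adm.mul_of_nonneg (hf : Adm Ω f) {g : Euc N → ℝ} (hg : BddLip g) (h0 : ∀ x, 0 ≤ g x) :
    Adm Ω (fun x => f x * g x) :=
  ⟨hf.1.mul hg, fun x => mul_nonneg (hf.2.1 x) (h0 x), fun x hx => by simp [hf.2.2 x hx]⟩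

lemma Adm.pow (hf : Adm Ω f) {n : ℕ} (hn : n ≠ 0) : Adm Ω (fun x => f x ^ n) :=
  ⟨hf.1.pow n, fun x => pow_nonneg (hf.2.1 x) _, fun x hx => by simp [hf.2.2 x hx, hn]⟩

lemma Adm.comp (hf : Adm Ω f) {g : ℝ → ℝ} (hg : ∀ t, 0 ≤ t → ContDiffAt ℝ 1 g t)
    (h0 : g 0 = 0) (hpos : ∀ t, 0 ≤ t → 0 ≤ g t) : Adm Ω (fun x => g (f x)) := by
  obtain ⟨M, -, hM⟩ := hf.exists_bound
  exact ⟨hf.1.comp hf.2.1 hM hg, fun x => hpos _ (hf.2.1 x), fun x hx => by simp [hf.2.2 x hx, h0]⟩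

lemma BddLip.of_lipschitz {f : Euc N → ℝ} {C : ℝ≥0} (hf : LipschitzWith C f)
    (hb : Bornology.IsBounded Ω) (h0 : ∀ x ∉ Ω, f x = 0) : BddLip f := by
  refine ⟨⟨C, hf⟩, ?_⟩
  obtain ⟨B, hB⟩ := hb.isCompact_closure.exists_bound_of_continuousOn hf.continuous.continuousOn
  refine ⟨max B 0, fun x => ?_⟩
  by_cases hx : x ∈ Ω
  · exact (hB x (subset_closure hx)).trans (le_max_left _ _)
  · simp [h0 x hx]

lemma integrable_of_bounded (hb : Bornology.IsBounded Ω) {g : Euc N → ℝ}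
    (hg : Measurable g) {M : ℝ} (hM : ∀ x, |g x| ≤ M) (h0 : ∀ x ∉ Ω, g x = 0) :
    Integrable g := by
  have hi : IntegrableOn g (closure Ω) := by
    refine Measure.integrableOn_of_bounded (M := M) ?_ hg.aestronglyMeasurable ?_
    · exact hb.isCompact_closure.measure_lt_top.ne
    · exact Eventually.of_forall fun x => hM x
  rw [← integrableOn_univ]
  exact hi.of_forall_sdiff_eq_zero MeasurableSet.univ
    fun x hx => h0 x fun h => hx.2 (subset_closure h)

end Lip

section Mollify

variable {N : ℕ}

open scoped Convolution in
lemma exists_mollification {f : Euc N → ℝ} {L : ℝ≥0} (hf : LipschitzWith L f) :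
    ∃ ψ : ℕ → Euc N → ℝ, (∀ k, ContDiff ℝ (⊤ : ℕ∞) (ψ k)) ∧
      (∀ k x, ψ k x ≠ 0 → ∃ y, dist y x < 1 / ((k : ℝ) + 1) ∧ f y ≠ 0) ∧
      (∀ k x, |ψ k x - f x| ≤ L / ((k : ℝ) + 1)) ∧
      (∀ k x, ‖gradient (ψ k) x‖ ≤ L) ∧
      ∀ᵐ x, Tendsto (fun k => gradient (ψ k) x) atTop (𝓝 (gradient f x)) := by
  let ρ : ℕ → ContDiffBump (0 : Euc N) := fun k =>
    ⟨1 / (2 * ((k : ℝ) + 1)), 1 / ((k : ℝ) + 1), by positivity, by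
      apply one_div_lt_one_div_of_lt <;> linarith [(Nat.cast_nonneg k : (0 : ℝ) ≤ k)]⟩
  have hfm : AEStronglyMeasurable f volume := hf.continuous.aestronglyMeasurable
  let ψ : ℕ → Euc N → ℝ := fun k =>
    ((ρ k).normed volume ⋆[ContinuousLinearMap.lsmul ℝ ℝ, volume] f : Euc N → ℝ)
  have hsm : ∀ k, ContDiff ℝ (⊤ : ℕ∞) (ψ k) := fun k =>
    (ρ k).hasCompactSupport_normed.contDiff_convolution_left _ (ρ k).contDiff_normed
      hf.continuous.locallyIntegrable
  have hint : ∀ k, Integrable ((ρ k).normed volume) := fun k => (ρ k).integrable_normed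
  have hfd : ∀ k x, fderiv ℝ (ψ k) x =
      ((ρ k).normed volume ⋆[ContinuousLinearMap.lsmul ℝ ℝ, volume] (fderiv ℝ f)
        : Euc N → (Euc N →L[ℝ] ℝ)) x := by
    intro k x
    have key := hasFDerivAt_integral_of_dominated_loc_of_lip (𝕜 := ℝ) (μ := volume)
      (F := fun (x : Euc N) (t : Euc N) => (ρ k).normed volume t • f (x - t))
      (F' := fun t => (ρ k).normed volume t • fderiv ℝ f (x - t)) (x₀ := x) (s := univ)
      (bound := fun t => (ρ k).normed volume t * L) univ_mem ?_ ?_ ?_ ?_ ?_ ?_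
    · exact key.2.fderiv
    · refine Eventually.of_forall fun y => ?_
      exact ((ρ k).continuous_normed.smul
        (hf.continuous.comp (continuous_const.sub continuous_id))).aestronglyMeasurable
    · refine Continuous.integrable_of_hasCompactSupport ((ρ k).continuous_normed.smul
        (hf.continuous.comp (continuous_const.sub continuous_id))) ?_
      exact (ρ k).hasCompactSupport_normed.smul_right
    · refine (ρ k).continuous_normed.aestronglyMeasurable.smul ?_
      exact ((measurable_fderiv ℝ f).comp
        (measurable_const.sub measurable_id)).aestronglyMeasurable
    · refine Eventually.of_forall fun t => ?_
      rw [lipschitzOnWith_univ]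
      refine LipschitzWith.of_dist_le_mul fun y z => ?_
      have h1 := hf.dist_le_mul (y - t) (z - t)
      rw [dist_sub_right] at h1
      rw [dist_smul₀]
      have h0 := (ρ k).nonneg_normed (μ := volume) t
      simp only [Real.coe_nnabs, abs_mul, abs_of_nonneg h0, Real.norm_eq_abs, NNReal.abs_eq]
      rw [mul_assoc]
      gcongr
    · exact (hint k).mul_const _
    · have h1 : ∀ᵐ t, DifferentiableAt ℝ f (x - t) :=
        (Measure.measurePreserving_sub_left volume x).quasiMeasurePreserving.ae hf.ae_differentiableAt
      filter_upwards [h1] with t ht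
      exact ((hasFDerivAt_comp_sub t).2 ht.hasFDerivAt).const_smul ((ρ k).normed volume t)
  refine ⟨ψ, hsm, ?_, ?_, ?_, ?_⟩
  · intro k x hx
    have h2 := support_convolution_subset (ContinuousLinearMap.lsmul ℝ ℝ) (μ := volume)
      (f := (ρ k).normed volume) (g := f) (show x ∈ Function.support _ from hx)
    obtain ⟨a, ha, y, hy, rfl⟩ := h2
    rw [(ρ k).support_normed_eq] at ha
    refine ⟨y, ?_, hy⟩
    simpa [dist_comm, dist_eq_norm, ρ] using ha
  · intro k x
    have := (ρ k).dist_normed_convolution_le (μ := volume) (x₀ := x) (ε := L / ((k : ℝ) + 1)) hfm ?_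
    · exact this
    · intro y hy
      refine (hf.dist_le_mul y x).trans ?_
      rw [div_eq_mul_one_div]
      gcongr
      exact (Metric.mem_ball.1 hy).le
  · intro k x
    rw [norm_gradient_eq, hfd]
    rw [convolution_lsmul]
    calc ‖∫ t, (ρ k).normed volume t • fderiv ℝ f (x - t)‖
        ≤ ∫ t, (ρ k).normed volume t * L := by
          refine norm_integral_le_of_norm_le ((hint k).mul_const _) (Eventually.of_forall fun t => ?_)
          rw [norm_smul, Real.norm_eq_abs, abs_of_nonneg ((ρ k).nonneg_normed t)]
          gcongr
          · exact (ρ k).nonneg_normed t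
          · exact norm_fderiv_le_of_lipschitz ℝ hf
      _ = L := by rw [integral_mul_const, (ρ k).integral_normed, one_mul]
  · have hloc : LocallyIntegrable (fderiv ℝ f) volume := by
      refine (locallyIntegrable_const (L : ℝ)).mono
        (measurable_fderiv ℝ f).aestronglyMeasurable (Eventually.of_forall fun x => ?_)
      simpa using norm_fderiv_le_of_lipschitz ℝ hf
    have := ContDiffBump.ae_convolution_tendsto_right_of_locallyIntegrable (μ := volume)
      (φ := ρ) (l := atTop) (K := 2) tendsto_one_div_add_atTop_nhds_zero_nat
      (Eventually.of_forall fun k => le_of_eq (by simp [ρ]; field_simp)) hloc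
    filter_upwards [this] with x hx
    have h3 := ((InnerProductSpace.toDual ℝ (Euc N)).symm.continuous.tendsto _).comp hx
    refine h3.congr fun k => ?_
    simp only [Function.comp_apply, gradient, hfd]

end Mollify

section Approx

variable {N : ℕ} {H : Euc N → ℝ} {Ω : Set (Euc N)}

/-- Bounded convergence of functions and of their gradients, inside a fixed set. -/
structure BddConv (Ω : Set (Euc N)) (F : ℕ → Euc N → ℝ) (f : Euc N → ℝ) : Prop where
  bdd : ∃ M : ℝ, ∀ k x, |F k x| ≤ M
  grad_bdd : ∃ L : ℝ, 0 ≤ L ∧ ∀ k x, ‖gradient (F k) x‖ ≤ L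
  zero : ∀ k, ∀ x ∉ Ω, F k x = 0
  grad_zero : ∀ k, ∀ x ∉ Ω, gradient (F k) x = 0
  meas : ∀ k, Measurable (F k)
  lim : ∀ x, Tendsto (fun k => F k x) atTop (𝓝 (f x))
  grad_lim : ∀ᵐ x, Tendsto (fun k => gradient (F k) x) atTop (𝓝 (gradient f x))

lemma tendsto_integral_of_bounded (hb : Bornology.IsBounded Ω) {F : ℕ → Euc N → ℝ}
    {g : Euc N → ℝ} (hm : ∀ k, Measurable (F k)) {M : ℝ} (hM : ∀ k x, |F k x| ≤ M)
    (h0 : ∀ k, ∀ x ∉ Ω, F k x = 0)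
    (hlim : ∀ᵐ x, Tendsto (fun k => F k x) atTop (𝓝 (g x))) :
    Tendsto (fun k => ∫ x, F k x) atTop (𝓝 (∫ x, g x)) := by
  refine tendsto_integral_of_dominated_convergence ((closure Ω).indicator fun _ => M)
    (fun k => (hm k).aestronglyMeasurable) ?_ (fun k => Eventually.of_forall fun x => ?_) hlim
  · rw [integrable_indicator_iff isClosed_closure.measurableSet]
    exact integrableOn_const hb.isCompact_closure.measure_lt_top.ne
  · by_cases hx : x ∈ Ω
    · rw [indicator_of_mem (subset_closure hx)]
      exact hM k x
    · rw [h0 k x hx, norm_zero]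
      exact indicator_nonneg (fun y _ => (abs_nonneg _).trans (hM k y)) x

/-- The Finsler energy of a function on the whole space. -/
def energy (N : ℕ) (H : Euc N → ℝ) (f : Euc N → ℝ) : ℝ := ∫ x, H (gradient f x) ^ N

lemma tendsto_energy (hN : 2 ≤ N) (hH : IsFinslerNorm N H) (hb : Bornology.IsBounded Ω)
    {F : ℕ → Euc N → ℝ} {f : Euc N → ℝ} (h : BddConv Ω F f) :
    Tendsto (fun k => energy N H (F k)) atTop (𝓝 (energy N H f)) := by
  obtain ⟨b, hb0, hbH⟩ := exists_norm_le hH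
  obtain ⟨L, hL0, hL⟩ := h.grad_bdd
  refine tendsto_integral_of_bounded hb (M := (b * L) ^ N)
    (fun k => (measurable_norm_gradient hH _).pow_const _) (fun k x => ?_) (fun k x hx => ?_) ?_
  · rw [abs_of_nonneg (pow_nonneg (norm_nonneg' hH _) _)]
    gcongr
    · exact norm_nonneg' hH _
    · exact (hbH _).trans (by gcongr; exact hL k x)
  · rw [h.grad_zero k x hx, norm_zero' hH, zero_pow (by omega)]
  · filter_upwards [h.grad_lim] with x hx
    exact (((continuous_norm' hH).tendsto _).comp hx).pow N

lemma tendsto_integral_flux (hN : 2 ≤ N) (hH : IsFinslerNorm N H) (hreg : FinslerRegular N H)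
    (hb : Bornology.IsBounded Ω) {U : Euc N → ℝ} (hU : Adm Ω U)
    {F : ℕ → Euc N → ℝ} {f : Euc N → ℝ} (h : BddConv Ω F f) :
    Tendsto (fun k => ∫ x, flux N H (gradient U x) (gradient (F k) x)) atTop
      (𝓝 (∫ x, flux N H (gradient U x) (gradient f x))) := by
  obtain ⟨b, hb0, hbH⟩ := exists_norm_le hH
  obtain ⟨L, hL0, hL⟩ := h.grad_bdd
  obtain ⟨C, hC⟩ := hU.1.1
  refine tendsto_integral_of_bounded hb (M := (b * C) ^ (N - 1) * (b * L))
    (fun k => measurable_flux hH _ _) (fun k x => ?_) (fun k x hx => ?_) ?_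
  · refine (abs_flux_le hN hH hreg _ _).trans ?_
    gcongr
    · exact norm_nonneg' hH _
    · exact norm_nonneg' hH _
    · exact (hbH _).trans (by gcongr; exact norm_gradient_le hC x)
    · exact (hbH _).trans (by gcongr; exact hL k x)
  · rw [h.grad_zero k x hx, flux_zero]
  · filter_upwards [h.grad_lim] with x hx
    unfold flux
    exact (((continuous_const.inner continuous_id).tendsto _).comp hx).const_mul _

lemma tendsto_integral_comp (hb : Bornology.IsBounded Ω) {G : Euc N → ℝ → ℝ}
    (hG : Measurable (Function.uncurry G)) (hGc : ∀ x, Continuous (G x)) (h0 : ∀ x, G x 0 = 0)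
    (hbd : ∀ M, ∃ K, ∀ x t, |t| ≤ M → |G x t| ≤ K)
    {F : ℕ → Euc N → ℝ} {f : Euc N → ℝ} (h : BddConv Ω F f) :
    Tendsto (fun k => ∫ x, G x (F k x)) atTop (𝓝 (∫ x, G x (f x))) := by
  obtain ⟨M, hM⟩ := h.bdd
  obtain ⟨K, hK⟩ := hbd M
  refine tendsto_integral_of_bounded hb (M := K) (fun k => hG.comp (measurable_id.prodMk (h.meas k)))
    (fun k x => hK _ _ (hM k x)) (fun k x hx => by rw [h.zero k x hx, h0])
    (Eventually.of_forall fun x => ((hGc x).tendsto _).comp (h.lim x))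

lemma gradient_eq_zero_of_notMem_tsupport {ψ : Euc N → ℝ} {x : Euc N} (hx : x ∉ tsupport ψ) :
    gradient ψ x = 0 := by
  have : x ∉ Function.support (fderiv ℝ ψ) := fun h => hx (support_fderiv_subset ℝ h)
  simp [gradient, Function.notMem_support.1 this]

/-- A property of functions that holds for test functions in `Ω` and is stable under bounded
convergence holds for all admissible functions. -/
lemma Adm.induction (hΩo : IsOpen Ω) (hb : Bornology.IsBounded Ω) {P : (Euc N → ℝ) → Prop}
    (smooth : ∀ ψ : Euc N → ℝ, ContDiff ℝ (⊤ : ℕ∞) ψ → HasCompactSupport ψ → tsupport ψ ⊆ Ω → P ψ)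
    (lim : ∀ (F : ℕ → Euc N → ℝ) (f : Euc N → ℝ), BddConv Ω F f → (∀ k, P (F k)) → P f)
    {f : Euc N → ℝ} (hf : Adm Ω f) : P f := by
  obtain ⟨C, hC⟩ := hf.1.1
  obtain ⟨M, hM0, hM⟩ := hf.exists_bound
  have htr : ∀ δ > 0, P (fun x => max (f x - δ) 0) := by
    intro δ hδ
    have hlip : LipschitzWith C (fun x => max (f x - δ) 0) := by
      have := (hC.sub (LipschitzWith.const δ)).max_const 0
      simpa using this
    obtain ⟨ψ, hsm, hsupp, hclose, hgr, hglim⟩ := exists_mollification hlip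
    let K : Set (Euc N) := {x | δ ≤ f x}
    have hKc : IsClosed K := isClosed_le continuous_const hC.continuous
    have hKΩ : K ⊆ Ω := by
      intro x hx
      by_contra h
      have hx : δ ≤ f x := hx
      rw [hf.2.2 x h] at hx
      linarith
    have hKcpt : IsCompact K := Metric.isCompact_of_isClosed_isBounded hKc (hb.subset hKΩ)
    obtain ⟨r, hr, hrΩ⟩ := hKcpt.exists_cthickening_subset_open hΩo hKΩ
    obtain ⟨k₀, hk₀⟩ := exists_nat_one_div_lt hr
    have hle : ∀ k : ℕ, 1 / (((k + k₀ : ℕ) : ℝ) + 1) ≤ r := fun k => by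
      refine le_trans ?_ hk₀.le
      push_cast
      gcongr
      linarith [(Nat.cast_nonneg k : (0 : ℝ) ≤ k)]
    have hts : ∀ k, tsupport (ψ (k + k₀)) ⊆ Metric.cthickening r K := by
      intro k
      refine closure_minimal (fun x hx => ?_) Metric.isClosed_cthickening
      obtain ⟨y, hy, hy0⟩ := hsupp _ x hx
      refine Metric.mem_cthickening_of_dist_le x y r K ?_ ?_
      · by_contra h
        exact hy0 (max_eq_right (by have : f y < δ := not_le.1 h; linarith))
      · rw [dist_comm]
        exact hy.le.trans (hle k)
    have hcs : ∀ k, HasCompactSupport (ψ (k + k₀)) := fun k =>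
      hKcpt.cthickening.of_isClosed_subset (isClosed_tsupport _) (hts k)
    refine lim (fun k => ψ (k + k₀)) _ ⟨⟨M + C, fun k x => ?_⟩, ⟨C, C.2, fun k x => hgr _ x⟩,
      fun k x hx => ?_, fun k x hx => ?_, fun k => (hsm _).continuous.measurable, fun x => ?_, ?_⟩
      fun k => smooth _ (hsm _) (hcs k) ((hts k).trans hrΩ)
    · have h1 := hclose (k + k₀) x
      have h2 : (C : ℝ) / (((k + k₀ : ℕ) : ℝ) + 1) ≤ C :=
        div_le_self C.2 (by linarith [(Nat.cast_nonneg (k + k₀) : (0 : ℝ) ≤ ((k + k₀ : ℕ) : ℝ))])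
      have h3 : |max (f x - δ) 0| ≤ M := by
        rw [abs_of_nonneg (le_max_right _ _)]
        exact max_le (by linarith [hM x]) hM0
      have := abs_sub_abs_le_abs_sub (ψ (k + k₀) x) (max (f x - δ) 0)
      linarith
    · exact image_eq_zero_of_notMem_tsupport fun h => hx (hrΩ (hts k h))
    · exact gradient_eq_zero_of_notMem_tsupport fun h => hx (hrΩ (hts k h))
    · have h1 : Tendsto (fun k : ℕ => (C : ℝ) / (k + 1)) atTop (𝓝 0) := by
        simpa [div_eq_mul_inv] using
          (tendsto_one_div_add_atTop_nhds_zero_nat (𝕜 := ℝ)).const_mul (C : ℝ)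
      have h2 : Tendsto (fun k => ψ k x) atTop (𝓝 (max (f x - δ) 0)) := by
        rw [tendsto_iff_dist_tendsto_zero]
        exact squeeze_zero (fun _ => dist_nonneg) (fun k => hclose k x) h1
      exact (tendsto_add_atTop_iff_nat k₀).2 h2
    · filter_upwards [hglim] with x hx
      exact (tendsto_add_atTop_iff_nat k₀).2 hx
  have hδ : Tendsto (fun k : ℕ => 1 / ((k : ℝ) + 1)) atTop (𝓝 0) :=
    tendsto_one_div_add_atTop_nhds_zero_nat
  have hfc := hC.continuous
  have hpos : ∀ k : ℕ, 0 < 1 / ((k : ℝ) + 1) := fun k => by positivity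
  refine lim (fun k x => max (f x - 1 / ((k : ℝ) + 1)) 0) f ⟨⟨M, fun k x => ?_⟩,
    ⟨C, C.2, fun k x => ?_⟩, fun k x hx => ?_, fun k x hx => ?_, fun k => ?_, fun x => ?_, ?_⟩
    fun k => htr _ (hpos k)
  · rw [abs_of_nonneg (le_max_right _ _)]
    exact max_le (by linarith [hM x, hpos k]) hM0
  · rw [gradient_max_sub hfc]
    split_ifs
    · exact norm_gradient_le hC x
    · simp
  · exact max_eq_right (by rw [hf.2.2 x hx]; linarith [hpos k])
  · rw [gradient_max_sub hfc, if_neg]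
    rw [hf.2.2 x hx]
    exact not_lt.2 (hpos k).le
  · exact ((hfc.sub continuous_const).max continuous_const).measurable
  · have := ((tendsto_const_nhds (x := f x)).sub hδ).max (tendsto_const_nhds (x := (0 : ℝ)))
    simpa [max_eq_left (hf.2.1 x)] using this
  · refine Eventually.of_forall fun x => ?_
    refine tendsto_const_nhds.congr' ?_
    rcases (hf.2.1 x).eq_or_lt with h | h
    · refine Eventually.of_forall fun k => ?_
      simp only
      rw [gradient_max_sub hfc, if_neg (by rw [← h]; exact not_lt.2 (hpos k).le),
        hf.gradient_eq_zero h.symm]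
    · filter_upwards [hδ.eventually (gt_mem_nhds h)] with k hk
      rw [gradient_max_sub hfc, if_pos hk]

lemma energyInf_nonneg (hH : IsFinslerNorm N H) (p : ℝ) : 0 ≤ energyInf N H Ω p := by
  refine Real.sInf_nonneg ?_
  rintro c ⟨u, -, -, -, -, rfl⟩
  exact integral_nonneg fun _ => pow_nonneg (norm_nonneg' hH _) _

lemma energy_nonneg (hH : IsFinslerNorm N H) (f : Euc N → ℝ) : 0 ≤ energy N H f :=
  integral_nonneg fun _ => pow_nonneg (norm_nonneg' hH _) _

lemma energyInf_mul_le (hN : 2 ≤ N) (hH : IsFinslerNorm N H) (hΩo : IsOpen Ω)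
    (hb : Bornology.IsBounded Ω) {p : ℝ} (hp : 1 < p) {f : Euc N → ℝ} (hf : Adm Ω f) :
    energyInf N H Ω p * (∫ x, f x ^ (p + 1)) ^ ((N : ℝ) / (p + 1)) ≤ energy N H f := by
  have hN0 : (0 : ℝ) < N := by exact_mod_cast (by omega : 0 < N)
  have hexp : 0 < (N : ℝ) / (p + 1) := by positivity
  suffices h : energyInf N H Ω p * (∫ x, |f x| ^ (p + 1)) ^ ((N : ℝ) / (p + 1)) ≤ energy N H f by
    simpa only [abs_of_nonneg (hf.2.1 _)] using h
  refine Adm.induction (P := fun f => energyInf N H Ω p *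
    (∫ x, |f x| ^ (p + 1)) ^ ((N : ℝ) / (p + 1)) ≤ energy N H f) hΩo hb ?_ ?_ hf
  · intro ψ hψ hcs hts
    have hz : ∀ x ∉ Ω, ψ x = 0 := fun x hx => image_eq_zero_of_notMem_tsupport fun h => hx (hts h)
    have hI0 : 0 ≤ ∫ x, |ψ x| ^ (p + 1) := integral_nonneg fun x => by positivity
    rcases hI0.eq_or_lt with h | hI
    · rw [← h, Real.zero_rpow hexp.ne', mul_zero]
      exact energy_nonneg hH ψ
    set I := ∫ x, |ψ x| ^ (p + 1) with hIdef
    set c := I ^ (-(1 / (p + 1))) with hc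
    have hcpos : 0 < c := Real.rpow_pos_of_pos hI _
    have hmem : energyInf N H Ω p ≤ ∫ x in Ω, H (gradient (fun y => c * ψ y) x) ^ N := by
      refine csInf_le ⟨0, ?_⟩ ⟨fun y => c * ψ y, contDiff_const.mul hψ, hcs.mul_left,
        (tsupport_mul_subset_right).trans hts, ?_, rfl⟩
      · rintro e ⟨u, -, -, -, -, rfl⟩
        exact integral_nonneg fun _ => pow_nonneg (norm_nonneg' hH _) _
      · rw [setIntegral_eq_integral_of_forall_compl_eq_zero]
        · simp_rw [abs_mul, Real.mul_rpow (abs_nonneg _) (abs_nonneg _)]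
          rw [integral_const_mul, ← hIdef, abs_of_pos hcpos, hc, ← Real.rpow_mul hI.le]
          rw [show -(1 / (p + 1)) * (p + 1) = -1 by field_simp, Real.rpow_neg_one]
          exact inv_mul_cancel₀ hI.ne'
        · intro x hx
          beta_reduce
          rw [hz x hx, mul_zero, abs_zero, Real.zero_rpow (by linarith)]
    have hen : (∫ x in Ω, H (gradient (fun y => c * ψ y) x) ^ N) = c ^ N * energy N H ψ := by
      have hg : ∀ x, gradient (fun y => c * ψ y) x = c • gradient ψ x := fun x =>
        gradient_const_mul ((hψ.differentiable (by simp)) x) c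
      simp_rw [hg, norm_smul' hH, mul_pow, abs_of_pos hcpos]
      rw [integral_const_mul, energy, setIntegral_eq_integral_of_forall_compl_eq_zero]
      intro x hx
      rw [gradient_eq_zero_of_notMem_tsupport fun h => hx (hts h), norm_zero' hH,
        zero_pow (by omega)]
    rw [hen] at hmem
    have hcN : c ^ N * I ^ ((N : ℝ) / (p + 1)) = 1 := by
      rw [hc, ← Real.rpow_natCast, ← Real.rpow_mul hI.le, ← Real.rpow_add hI]
      rw [show -(1 / (p + 1)) * (N : ℝ) + N / (p + 1) = 0 by ring, Real.rpow_zero]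
    calc energyInf N H Ω p * I ^ ((N : ℝ) / (p + 1))
        ≤ c ^ N * energy N H ψ * I ^ ((N : ℝ) / (p + 1)) := by gcongr
      _ = energy N H ψ * (c ^ N * I ^ ((N : ℝ) / (p + 1))) := by ring
      _ = energy N H ψ := by rw [hcN, mul_one]
  · intro F g hF hP
    have h1 : Tendsto (fun k => ∫ x, |F k x| ^ (p + 1)) atTop (𝓝 (∫ x, |g x| ^ (p + 1))) := by
      refine tendsto_integral_comp hb (G := fun _ t => |t| ^ (p + 1)) ?_ ?_ ?_ ?_ hF
      · exact (measurable_snd.abs).pow_const _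
      · intro _
        exact continuous_abs.rpow_const fun t => Or.inr (by linarith)
      · intro _
        rw [abs_zero, Real.zero_rpow (by linarith)]
      · intro M
        refine ⟨M ^ (p + 1), fun x t ht => ?_⟩
        rw [abs_of_nonneg (by positivity)]
        gcongr
    refine le_of_tendsto_of_tendsto' ((h1.rpow_const (Or.inr hexp.le)).const_mul _)
      (tendsto_energy hN hH hb hF) hP

end Approx

section Solution

variable {N : ℕ} {H : Euc N → ℝ} {Ω : Set (Euc N)}

/-- A function that is `C¹` up to the boundary of a bounded open set and vanishes on the boundary
extends by zero to a Lipschitz function. -/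
lemma exists_lipschitz_indicator (hΩo : IsOpen Ω) (hb : Bornology.IsBounded Ω)
    {u : Euc N → ℝ} (hu : ContDiffOn ℝ 1 u (closure Ω)) (h0 : ∀ x ∈ frontier Ω, u x = 0) :
    ∃ C : ℝ≥0, LipschitzWith C (Ω.indicator u) := by
  have hdiff : ∀ x ∈ Ω, DifferentiableAt ℝ u x := fun x hx =>
    ((hu.contDiffAt (mem_of_superset (hΩo.mem_nhds hx) subset_closure)).differentiableAt
      (by norm_num))
  obtain ⟨C, hC0, hC⟩ : ∃ C : ℝ, 0 ≤ C ∧ ∀ x ∈ Ω, ‖fderiv ℝ u x‖ ≤ C := by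
    have hloc : ∀ x ∈ closure Ω, ∃ V ∈ 𝓝[closure Ω] x, ∃ C : ℝ, ∀ y ∈ V ∩ Ω, ‖fderiv ℝ u y‖ ≤ C := by
      intro x hx
      obtain ⟨V, hV, -, f', hf', hc⟩ :=
        (contDiffWithinAt_succ_iff_hasFDerivWithinAt (n := 0) (by simp)).1
          (show ContDiffWithinAt ℝ (0 + 1) u (closure Ω) x by simpa using hu x hx)
      rw [insert_eq_of_mem hx] at hV
      have hbd : ∀ᶠ y in 𝓝[closure Ω] x, ‖f' y‖ < ‖f' x‖ + 1 :=
        (hc.continuousWithinAt.norm.mono_left (nhdsWithin_le_of_mem hV)).eventually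
          (gt_mem_nhds (lt_add_one ‖f' x‖))
      obtain ⟨O, hO, hOV⟩ := mem_nhdsWithin_iff_exists_mem_nhds_inter.1 hV
      refine ⟨interior O ∩ {y | ‖f' y‖ < ‖f' x‖ + 1}, inter_mem
        (mem_nhdsWithin_of_mem_nhds (interior_mem_nhds.2 hO)) hbd, ‖f' x‖ + 1, ?_⟩
      rintro y ⟨⟨hy1, hy2⟩, hyΩ⟩
      have hVy : V ∈ 𝓝 y := by
        refine mem_of_superset (inter_mem (isOpen_interior.mem_nhds hy1) (hΩo.mem_nhds hyΩ)) ?_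
        rintro z ⟨hz, hzΩ⟩
        exact hOV ⟨interior_subset hz, subset_closure hzΩ⟩
      rw [((hf' y (mem_of_mem_nhds hVy)).hasFDerivAt hVy).fderiv]
      exact hy2.le
    choose! V hV C hC using hloc
    obtain ⟨t, ht, hcov⟩ := hb.isCompact_closure.elim_nhdsWithin_subcover V hV
    refine ⟨∑ x ∈ t, |C x|, by positivity, fun y hy => ?_⟩
    obtain ⟨x, hx, hyx⟩ := mem_iUnion₂.1 (hcov (subset_closure hy))
    refine (hC x (ht x hx) y ⟨hyx, hy⟩).trans ((le_abs_self _).trans ?_)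
    exact Finset.single_le_sum (f := fun x => |C x|) (fun i _ => abs_nonneg _) hx
  have hball : ∀ x ∈ Ω, ∀ y r, Metric.ball x r ⊆ Ω → y ∈ Metric.ball x r →
      |u y - u x| ≤ C * dist y x := by
    intro x hx y r hr hy
    have := (convex_ball x r).norm_image_sub_le_of_norm_fderiv_le (𝕜 := ℝ) (f := u) (C := C)
      (fun z hz => hdiff z (hr hz)) (fun z hz => hC z (hr hz))
      (Metric.mem_ball_self (Metric.pos_of_mem_ball hy)) hy
    rwa [← dist_eq_norm] at this
  have hcpl : (Ωᶜ).Nonempty ∨ N = 0 := by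
    by_contra h
    push Not at h
    have h1 : Ω = univ := by simpa [not_nonempty_iff_eq_empty] using h.1
    have : Nontrivial (Euc N) := by
      have : Nonempty (Fin N) := ⟨⟨0, Nat.pos_of_ne_zero h.2⟩⟩
      infer_instance
    rw [h1] at hb
    exact NormedSpace.unbounded_univ ℝ (Euc N) hb
  rcases hcpl with hne | rfl
  swap
  · exact ⟨0, LipschitzWith.of_dist_le_mul fun x y => by simp [Subsingleton.elim x y]⟩
  have hsub : ∀ x ∈ Ω, Metric.ball x (Metric.infDist x Ωᶜ) ⊆ Ω := by
    intro x _ y hy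
    by_contra h
    have h2 := Metric.infDist_le_dist_of_mem (x := x) (show y ∈ Ωᶜ from h)
    rw [dist_comm] at h2
    exact absurd hy (by simpa using h2)
  have hinf : ∀ x ∈ Ω, |u x| ≤ C * Metric.infDist x Ωᶜ := by
    intro x hx
    obtain ⟨z, hz, hdz⟩ := (hΩo.isClosed_compl).exists_infDist_eq_dist hne x
    have hd : 0 < Metric.infDist x Ωᶜ := by
      rw [hdz]
      exact dist_pos.2 fun h => hz (h ▸ hx)
    have hzcl : z ∈ closure (Metric.ball x (Metric.infDist x Ωᶜ)) := by
      rw [closure_ball _ hd.ne', Metric.mem_closedBall, dist_comm, hdz]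
    have hzc : z ∈ closure Ω := closure_mono (hsub x hx) hzcl
    have hzf : z ∈ frontier Ω := ⟨hzc, by rwa [hΩo.interior_eq]⟩
    have hle : |u z - u x| ≤ C * dist z x := by
      have hcont : ContinuousWithinAt u (Metric.ball x (Metric.infDist x Ωᶜ)) z :=
        (hu.continuousOn z hzc).mono ((hsub x hx).trans subset_closure)
      have : (𝓝[Metric.ball x (Metric.infDist x Ωᶜ)] z).NeBot := mem_closure_iff_nhdsWithin_neBot.1 hzcl
      refine le_of_tendsto_of_tendsto ((hcont.sub_const (u x)).abs)
        (((continuous_id.dist continuous_const).tendsto z).mono_left nhdsWithin_le_nhds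
          |>.const_mul C) ?_
      filter_upwards [self_mem_nhdsWithin] with w hw
      exact hball x hx w _ (hsub x hx) hw
    rw [h0 z hzf, zero_sub, abs_neg, dist_comm, ← hdz] at hle
    exact hle
  have hbdry : ∀ x ∈ Ω, ∀ y ∉ Ω, |u x| ≤ 2 * C * dist x y := by
    intro x hx y hy
    have h1 : Metric.infDist x Ωᶜ ≤ dist x y := Metric.infDist_le_dist_of_mem hy
    have h2 := mul_le_mul_of_nonneg_left h1 hC0
    have h3 : 0 ≤ C * dist x y := by positivity
    linarith [hinf x hx]
  refine ⟨⟨2 * C, by positivity⟩, LipschitzWith.of_dist_le_mul fun x y => ?_⟩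
  rw [Real.dist_eq]
  change _ ≤ 2 * C * dist x y
  have hCd : 0 ≤ C * dist x y := by positivity
  by_cases hx : x ∈ Ω <;> by_cases hy : y ∈ Ω
  · rw [indicator_of_mem hx, indicator_of_mem hy]
    by_cases hxy : x ∈ Metric.ball y (Metric.infDist y Ωᶜ)
    · linarith [hball y hy x _ (hsub y hy) hxy]
    by_cases hyx : y ∈ Metric.ball x (Metric.infDist x Ωᶜ)
    · have h1 := hball x hx y _ (hsub x hx) hyx
      rw [dist_comm] at h1
      rw [abs_sub_comm]
      linarith
    · rw [Metric.mem_ball, not_lt] at hxy hyx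
      rw [dist_comm] at hyx
      have h1 := mul_le_mul_of_nonneg_left hxy hC0
      have h2 := mul_le_mul_of_nonneg_left hyx hC0
      have h3 := abs_sub (u x) (u y)
      linarith [hinf x hx, hinf y hy]
  · rw [indicator_of_mem hx, indicator_of_notMem hy, sub_zero]
    exact hbdry x hx y hy
  · rw [indicator_of_notMem hx, indicator_of_mem hy, zero_sub, abs_neg, dist_comm]
    exact hbdry y hy x hx
  · rw [indicator_of_notMem hx, indicator_of_notMem hy]
    simp only [sub_self, abs_zero]
    positivity

/-- The properties of (the extension by zero of) a least energy solution used below. -/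
structure IsExtSolution (N : ℕ) (H : Euc N → ℝ) (Ω : Set (Euc N)) (p : ℝ) (U : Euc N → ℝ) :
    Prop where
  adm : Adm Ω U
  pos : ∀ x ∈ Ω, 0 < U x
  weak : ∀ φ : Euc N → ℝ, Adm Ω φ →
    ∫ x, flux N H (gradient U x) (gradient φ x) = ∫ x, U x ^ p * φ x
  least : energy N H U = energyInf N H Ω p * (∫ x, U x ^ (p + 1)) ^ ((N : ℝ) / (p + 1))

lemma isExtSolution_of_leastEnergy (hN : 2 ≤ N) (hH : IsFinslerNorm N H)
    (hreg : FinslerRegular N H) (hΩo : IsOpen Ω) (hb : Bornology.IsBounded Ω) {p : ℝ} (hp : 1 < p)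
    {u : Euc N → ℝ} (hu : IsLeastEnergySolution N H Ω p u) :
    IsExtSolution N H Ω p (Ω.indicator u) := by
  obtain ⟨hc1, hpos, hbd, hweak, hleast⟩ := hu
  obtain ⟨C, hC⟩ := exists_lipschitz_indicator hΩo hb hc1 hbd
  have hz : ∀ x ∉ Ω, Ω.indicator u x = 0 := fun x hx => indicator_of_notMem hx u
  have hadm : Adm Ω (Ω.indicator u) := ⟨BddLip.of_lipschitz hC hb hz,
    fun x => indicator_nonneg (fun y hy => (hpos y hy).le) x, hz⟩
  have hgrad : ∀ x ∈ Ω, gradient (Ω.indicator u) x = gradient u x := by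
    intro x hx
    apply Filter.EventuallyEq.gradient_eq
    filter_upwards [hΩo.mem_nhds hx] with y hy
    exact indicator_of_mem hy u
  have hmeas := hΩo.measurableSet
  refine ⟨hadm, fun x hx => by rw [indicator_of_mem hx]; exact hpos x hx, ?_, ?_⟩
  · intro φ hφ
    refine Adm.induction (P := fun φ => ∫ x, flux N H (gradient (Ω.indicator u) x) (gradient φ x) =
      ∫ x, Ω.indicator u x ^ p * φ x) hΩo hb ?_ ?_ hφ
    · intro ψ hψ hcs hts
      have h := hweak ψ hψ hcs hts
      rw [← setIntegral_eq_integral_of_forall_compl_eq_zero (s := Ω),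
        ← setIntegral_eq_integral_of_forall_compl_eq_zero (s := Ω)
          (f := fun x => Ω.indicator u x ^ p * ψ x)]
      · rw [setIntegral_congr_fun hmeas (g := fun x => H (gradient u x) ^ (N - 1) *
          ⟪gradient H (gradient u x), gradient ψ x⟫), h]
        · refine setIntegral_congr_fun hmeas fun x hx => ?_
          simp only [indicator_of_mem hx]
        · intro x hx
          simp only [flux, hgrad x hx]
      · intro x hx
        rw [image_eq_zero_of_notMem_tsupport fun h => hx (hts h), mul_zero]
      · intro x hx
        rw [gradient_eq_zero_of_notMem_tsupport fun h => hx (hts h), flux_zero]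
    · intro F f hF hP
      obtain ⟨M, hM0, hM⟩ := hadm.exists_bound
      have h1 := tendsto_integral_flux hN hH hreg hb hadm hF
      have h2 := tendsto_integral_comp hb (G := fun x t => Ω.indicator u x ^ p * t)
        (((hadm.continuous.measurable.comp measurable_fst).pow_const p).mul measurable_snd)
        (fun x => continuous_const.mul continuous_id) (fun x => mul_zero _)
        (fun K => ⟨M ^ p * K, fun x t ht => by
          rw [abs_mul, abs_of_nonneg (Real.rpow_nonneg (hadm.nonneg x) _)]
          have := hadm.nonneg x
          gcongr
          exact hM x⟩) hF
      exact tendsto_nhds_unique (h1.congr hP) h2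
  · have e1 : energy N H (Ω.indicator u) = ∫ x in Ω, H (gradient u x) ^ N := by
      rw [energy, ← setIntegral_eq_integral_of_forall_compl_eq_zero (s := Ω)]
      · exact setIntegral_congr_fun hmeas fun x hx => by simp only [hgrad x hx]
      · intro x hx
        rw [hadm.gradient_eq_zero' hx, norm_zero' hH, zero_pow (by omega)]
    have e2 : ∫ x, Ω.indicator u x ^ (p + 1) = ∫ x in Ω, u x ^ (p + 1) := by
      rw [← setIntegral_eq_integral_of_forall_compl_eq_zero (s := Ω)]
      · exact setIntegral_congr_fun hmeas fun x hx => by simp only [indicator_of_mem hx]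
      · intro x hx
        rw [hz x hx, Real.zero_rpow (by linarith)]
    rw [e1, e2, hleast]

lemma integral_indicator_rpow (hΩo : IsOpen Ω) {p : ℝ} (hp : 0 < p) (u : Euc N → ℝ) :
    ∫ x, Ω.indicator u x ^ p = ∫ x in Ω, u x ^ p := by
  rw [← setIntegral_eq_integral_of_forall_compl_eq_zero (s := Ω)]
  · exact setIntegral_congr_fun hΩo.measurableSet fun x hx => by simp only [indicator_of_mem hx]
  · intro x hx
    rw [indicator_of_notMem hx, Real.zero_rpow hp.ne']

end Solution

section Scaling

variable {N : ℕ} {H : Euc N → ℝ} {Ω : Set (Euc N)}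

lemma integral_comp_affine (g : Euc N → ℝ) (x₀ y₀ : Euc N) {c : ℝ} (hc : 0 < c) :
    ∫ y, g (x₀ + c • (y - y₀)) = c⁻¹ ^ N * ∫ x, g x := by
  rw [integral_sub_right_eq_self (fun y => g (x₀ + c • y)) y₀,
    Measure.integral_comp_smul volume (fun y => g (x₀ + y)) c, integral_add_left_eq_self]
  simp [abs_of_pos hc]

lemma gradient_comp_affine (f : Euc N → ℝ) (x₀ y₀ : Euc N) (c : ℝ) (y : Euc N) :
    gradient (fun y => f (x₀ + c • (y - y₀))) y = c • gradient f (x₀ + c • (y - y₀)) := by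
  have h : fderiv ℝ (fun y => f (x₀ + c • (y - y₀))) y = c • fderiv ℝ f (x₀ + c • (y - y₀)) := by
    rw [fderiv_comp_sub (f := fun y => f (x₀ + c • y)), fderiv_comp_smul (f := fun y => f (x₀ + y)),
      fderiv_comp_add_left]
  simp [gradient, h]

lemma energyInf_mul_le_of_ball (hN : 2 ≤ N) (hH : IsFinslerNorm N H) (hΩo : IsOpen Ω)
    (hb : Bornology.IsBounded Ω) {p : ℝ} (hp : 1 < p) {y₀ : Euc N} {ρ : ℝ} (hρ : 0 < ρ)
    (hball : Metric.ball y₀ ρ ⊆ Ω) {x₀ : Euc N} {s : ℝ} (hs : 0 < s) {f : Euc N → ℝ}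
    (hf : Adm (Metric.ball x₀ s) f) :
    energyInf N H Ω p * ((ρ / s) ^ N * ∫ x, f x ^ (p + 1)) ^ ((N : ℝ) / (p + 1)) ≤
      energy N H f := by
  have hc : 0 < s / ρ := by positivity
  have hadm : Adm Ω (fun y => f (x₀ + (s / ρ) • (y - y₀))) := by
    refine ⟨⟨?_, ?_⟩, fun x => hf.nonneg _, fun x hx => hf.eq_zero fun h => hx (hball ?_)⟩
    · obtain ⟨C, hC⟩ := hf.bddLip.1
      refine ⟨C * Real.toNNReal (s / ρ), LipschitzWith.of_dist_le_mul fun x y => ?_⟩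
      refine (hC.dist_le_mul _ _).trans ?_
      rw [dist_add_left, dist_smul₀, dist_sub_right, Real.norm_of_nonneg hc.le, NNReal.coe_mul,
        Real.coe_toNNReal _ hc.le, mul_assoc]
    · obtain ⟨M, hM⟩ := hf.bddLip.2
      exact ⟨M, fun x => hM _⟩
    · rw [Metric.mem_ball, dist_eq_norm, add_sub_cancel_left, norm_smul,
        Real.norm_of_nonneg hc.le, div_mul_eq_mul_div, div_lt_iff₀ hρ] at h
      rw [Metric.mem_ball, dist_eq_norm]
      exact lt_of_mul_lt_mul_left h hs.le
  have h := energyInf_mul_le hN hH hΩo hb hp hadm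
  rw [integral_comp_affine (fun z => f z ^ (p + 1)) x₀ y₀ hc, inv_div] at h
  refine h.trans (le_of_eq ?_)
  unfold energy
  simp_rw [gradient_comp_affine, norm_smul' hH, mul_pow, abs_of_pos hc]
  rw [integral_const_mul, integral_comp_affine (fun z => H (gradient f z) ^ N) x₀ y₀ hc,
    ← mul_assoc, ← mul_pow, mul_inv_cancel₀ hc.ne', one_pow, one_mul]

end Scaling

section Poincare

variable {N : ℕ} {Ω : Set (Euc N)}

open scoped ENNReal

lemma lintegral_comp_add_smul_le {G : Euc N → ℝ≥0∞} (hG : Measurable G) (z : Euc N) {c : ℝ}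
    (hc : 1 / 2 ≤ c) : ∫⁻ y, G (z + c • y) ≤ 2 ^ N * ∫⁻ y, G y := by
  have hc0 : 0 < c := by linarith
  have h1 : ∫⁻ y, G (z + c • y) = ∫⁻ y, G (z + y) ∂(Measure.map (c • ·) volume) := by
    rw [lintegral_map (f := fun y => G (z + y)) (hG.comp (measurable_const.add measurable_id))
      (measurable_const_smul c)]
  rw [h1, Measure.map_addHaar_smul volume hc0.ne', lintegral_smul_measure,
    lintegral_add_left_eq_self, smul_eq_mul]
  gcongr
  rw [finrank_euclideanSpace_fin, abs_of_pos (by positivity)]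
  calc ENNReal.ofReal (c ^ N)⁻¹ ≤ ENNReal.ofReal (2 ^ N) := by
        apply ENNReal.ofReal_le_ofReal
        rw [inv_le_comm₀ (by positivity) (by positivity), ← inv_pow]
        gcongr
        linarith
    _ = 2 ^ N := by
        rw [ENNReal.ofReal_pow (by norm_num)]
        norm_num

lemma lintegral_segment_le {G : Euc N → ℝ≥0∞} (hG : Measurable G) (B : Set (Euc N)) :
    ∫⁻ x in B, ∫⁻ y in B, ∫⁻ t in Icc (0 : ℝ) 1, G (y + t • (x - y)) ≤
      2 ^ N * volume B * ∫⁻ y, G y := by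
  have hmeas : Measurable fun q : (Euc N × Euc N) × ℝ => G (q.1.2 + q.2 • (q.1.1 - q.1.2)) :=
    hG.comp (measurable_fst.snd.add
      (measurable_snd.smul (measurable_fst.fst.sub measurable_fst.snd)))
  have s1 : ∀ x, ∫⁻ y in B, ∫⁻ t in Icc (0 : ℝ) 1, G (y + t • (x - y)) =
      ∫⁻ t in Icc (0 : ℝ) 1, ∫⁻ y in B, G (y + t • (x - y)) := fun x =>
    lintegral_lintegral_swap
      (hmeas.comp ((measurable_const.prodMk measurable_fst).prodMk measurable_snd)).aemeasurable
  have hm2 : Measurable fun q : Euc N × ℝ => ∫⁻ y in B, G (y + q.2 • (q.1 - y)) := by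
    refine Measurable.lintegral_prod_right' (f := fun r : (Euc N × ℝ) × Euc N =>
      G (r.2 + r.1.2 • (r.1.1 - r.2))) ?_
    exact hmeas.comp ((measurable_fst.fst.prodMk measurable_snd).prodMk measurable_fst.snd)
  simp_rw [s1]
  rw [lintegral_lintegral_swap hm2.aemeasurable]
  have hI : ∀ t ∈ Icc (0 : ℝ) 1, ∫⁻ x in B, ∫⁻ y in B, G (y + t • (x - y)) ≤
      2 ^ N * volume B * ∫⁻ y, G y := by
    intro t ht
    have hconst : ∫⁻ _ in B, 2 ^ N * ∫⁻ y, G y = 2 ^ N * volume B * ∫⁻ y, G y := by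
      rw [setLIntegral_const]
      ring
    rw [← hconst]
    rcases le_total t (1 / 2) with h | h
    · refine lintegral_mono fun x => (setLIntegral_le_lintegral _ _).trans ?_
      refine le_trans (le_of_eq ?_)
        (lintegral_comp_add_smul_le hG (t • x) (show 1 / 2 ≤ 1 - t by linarith))
      refine lintegral_congr fun y => ?_
      congr 1
      module
    · rw [lintegral_lintegral_swap]
      · refine lintegral_mono fun y => (setLIntegral_le_lintegral _ _).trans ?_
        refine le_trans (le_of_eq ?_) (lintegral_comp_add_smul_le hG ((1 - t) • y) h)
        refine lintegral_congr fun x => ?_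
        congr 1
        module
      · exact (hmeas.comp (measurable_id.prodMk measurable_const)).aemeasurable
  calc ∫⁻ t in Icc (0 : ℝ) 1, ∫⁻ x in B, ∫⁻ y in B, G (y + t • (x - y))
      ≤ ∫⁻ _ in Icc (0 : ℝ) 1, 2 ^ N * volume B * ∫⁻ y, G y :=
        setLIntegral_mono' measurableSet_Icc hI
    _ = 2 ^ N * volume B * ∫⁻ y, G y := by
        rw [setLIntegral_const]
        simp

lemma abs_sub_pow_le_integral {f : Euc N → ℝ} (hf : ContDiff ℝ 1 f) {x y : Euc N} {d : ℝ}
    (hd : ‖x - y‖ ≤ d) :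
    ENNReal.ofReal (|f x - f y| ^ N) ≤ ENNReal.ofReal (d ^ N) *
      ∫⁻ t in Icc (0 : ℝ) 1, ENNReal.ofReal (‖gradient f (y + t • (x - y))‖ ^ N) := by
  have hd0 : 0 ≤ d := (norm_nonneg _).trans hd
  have hcg : Continuous (gradient f) :=
    (InnerProductSpace.toDual ℝ (Euc N)).symm.continuous.comp (hf.continuous_fderiv (by norm_num))
  have hcl : Continuous fun t : ℝ => y + t • (x - y) := by fun_prop
  have hcn : Continuous fun t : ℝ => ‖gradient f (y + t • (x - y))‖ := (hcg.comp hcl).norm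
  have hcnN : Continuous fun t : ℝ => ‖gradient f (y + t • (x - y))‖ ^ N := hcn.pow N
  have hder : ∀ t : ℝ, HasDerivAt (fun t : ℝ => f (y + t • (x - y)))
      ⟪gradient f (y + t • (x - y)), x - y⟫ t := by
    intro t
    have h1 : HasDerivAt (fun t : ℝ => y + t • (x - y)) (x - y) t := by
      simpa using ((hasDerivAt_id t).smul_const (x - y)).const_add y
    have h2 := ((hf.differentiable (by norm_num)) (y + t • (x - y))).hasGradientAt.hasFDerivAt
    exact h2.comp_hasDerivAt t h1
  have hci : Continuous fun t : ℝ => ⟪gradient f (y + t • (x - y)), x - y⟫ :=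
    (hcg.comp hcl).inner continuous_const
  have hftc := intervalIntegral.integral_eq_sub_of_hasDerivAt (a := 0) (b := 1)
    (fun t _ => hder t) (hci.intervalIntegrable 0 1)
  simp only [one_smul, add_sub_cancel, zero_smul, add_zero] at hftc
  have hint : ∀ {g : ℝ → ℝ}, Continuous g → IntegrableOn g (Icc 0 1) := fun hg =>
    hg.continuousOn.integrableOn_compact isCompact_Icc
  have hprob : IsProbabilityMeasure (volume.restrict (Icc (0 : ℝ) 1)) := ⟨by simp⟩
  have h1 : |f x - f y| ≤ d * ∫ t in Icc (0 : ℝ) 1, ‖gradient f (y + t • (x - y))‖ := by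
    rw [← hftc, intervalIntegral.integral_of_le zero_le_one, ← integral_Icc_eq_integral_Ioc,
      ← integral_const_mul, ← Real.norm_eq_abs]
    refine (norm_integral_le_integral_norm _).trans ?_
    refine integral_mono (hint hci.norm) (hint (continuous_const.mul hcn)) fun t => ?_
    refine (norm_inner_le_norm _ _).trans ?_
    beta_reduce
    rw [mul_comm]
    gcongr
  have h2 : (∫ t in Icc (0 : ℝ) 1, ‖gradient f (y + t • (x - y))‖) ^ N ≤
      ∫ t in Icc (0 : ℝ) 1, ‖gradient f (y + t • (x - y))‖ ^ N :=
    (convexOn_pow N).map_integral_le (continuous_pow N).continuousOn isClosed_Ici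
      (Eventually.of_forall fun t => norm_nonneg _) (hint hcn) (hint hcnN)
  rw [← ofReal_integral_eq_lintegral_ofReal (hint hcnN)
    (Eventually.of_forall fun t => by positivity), ← ENNReal.ofReal_mul (by positivity)]
  apply ENNReal.ofReal_le_ofReal
  calc |f x - f y| ^ N ≤ (d * ∫ t in Icc (0 : ℝ) 1, ‖gradient f (y + t • (x - y))‖) ^ N := by gcongr
    _ ≤ _ := by
      rw [mul_pow]
      gcongr

lemma poincare_smooth {f : Euc N → ℝ} (hf : ContDiff ℝ 1 f) {x₀ : Euc N} {r : ℝ} (hr : 0 ≤ r)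
    {Z : Set (Euc N)} (hZB : Z ⊆ Metric.ball x₀ r) {ε : ℝ} (hZ : ∀ y ∈ Z, |f y| ≤ ε) :
    volume.real Z * ∫ x in Metric.ball x₀ r, max (|f x| - ε) 0 ^ N ≤
      (4 * r) ^ N * volume.real (Metric.ball x₀ r) *
        ∫ x in Metric.ball x₀ r, ‖gradient f x‖ ^ N := by
  set B := Metric.ball x₀ r with hB
  have hBm : MeasurableSet B := measurableSet_ball
  have hcg : Continuous (gradient f) :=
    (InnerProductSpace.toDual ℝ (Euc N)).symm.continuous.comp (hf.continuous_fderiv (by norm_num))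
  have hcgN : Continuous fun x => ‖gradient f x‖ ^ N := hcg.norm.pow N
  have hfin : volume B ≠ ∞ := measure_ball_lt_top.ne
  have hZfin : volume Z ≠ ∞ := measure_ne_top_of_subset hZB hfin
  have hint : ∀ {g : Euc N → ℝ}, Continuous g → IntegrableOn g B := fun hg =>
    (hg.continuousOn.integrableOn_compact (isCompact_closedBall x₀ r)).mono_set
      Metric.ball_subset_closedBall
  let G : Euc N → ℝ≥0∞ := B.indicator fun z => ENNReal.ofReal (‖gradient f z‖ ^ N)
  have hGm : Measurable G := (hcgN.measurable.ennreal_ofReal).indicator hBm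
  have hc1 : Continuous fun x => max (|f x| - ε) 0 ^ N :=
    (((hf.continuous.abs.sub continuous_const).max continuous_const)).pow N
  have hvanish : volume Z * ∫⁻ x in B, ENNReal.ofReal (max (|f x| - ε) 0 ^ N) ≤
      ∫⁻ x in B, ∫⁻ y in B, ENNReal.ofReal (|f x - f y| ^ N) := by
    rw [← lintegral_const_mul _ hc1.measurable.ennreal_ofReal]
    refine lintegral_mono fun x => ?_
    calc volume Z * ENNReal.ofReal (max (|f x| - ε) 0 ^ N)
        = ∫⁻ _ in Z, ENNReal.ofReal (max (|f x| - ε) 0 ^ N) := by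
          rw [setLIntegral_const, mul_comm]
      _ ≤ ∫⁻ y in Z, ENNReal.ofReal (|f x - f y| ^ N) := by
          refine setLIntegral_mono (by
            exact ((continuous_const.sub hf.continuous).abs.pow N).measurable.ennreal_ofReal)
            fun y hy => ?_
          apply ENNReal.ofReal_le_ofReal
          gcongr
          refine max_le ?_ (abs_nonneg _)
          have := abs_sub_abs_le_abs_sub (f x) (f y)
          linarith [hZ y hy]
      _ ≤ ∫⁻ y in B, ENNReal.ofReal (|f x - f y| ^ N) := lintegral_mono_set hZB
  have hdouble : ∫⁻ x in B, ∫⁻ y in B, ENNReal.ofReal (|f x - f y| ^ N) ≤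
      ENNReal.ofReal ((2 * r) ^ N) * (2 ^ N * volume B * ∫⁻ y, G y) := by
    refine le_trans ?_ (mul_le_mul_right (lintegral_segment_le hGm B) _)
    rw [← lintegral_const_mul' _ _ ENNReal.ofReal_ne_top]
    refine setLIntegral_mono' hBm fun x hx => ?_
    rw [← lintegral_const_mul' _ _ ENNReal.ofReal_ne_top]
    refine setLIntegral_mono' hBm fun y hy => ?_
    have hxy : ‖x - y‖ ≤ 2 * r := by
      rw [← dist_eq_norm]
      have h1 := dist_triangle_right x y x₀
      have h2 := Metric.mem_ball.1 hx
      have h3 := Metric.mem_ball.1 hy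
      linarith
    refine (abs_sub_pow_le_integral hf hxy).trans (mul_le_mul_right ?_ _)
    refine setLIntegral_mono' measurableSet_Icc fun t ht => ?_
    have hmem : y + t • (x - y) ∈ B :=
      (convex_ball x₀ r).add_smul_sub_mem hy hx ht
    simp only [G, indicator_of_mem hmem, le_refl]
  have hGint : ∫⁻ y, G y = ENNReal.ofReal (∫ x in B, ‖gradient f x‖ ^ N) := by
    rw [lintegral_indicator hBm, ofReal_integral_eq_lintegral_ofReal (hint hcgN)
      (Eventually.of_forall fun t => by positivity)]
  rw [← ofReal_integral_eq_lintegral_ofReal (hint hc1)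
    (Eventually.of_forall fun t => by positivity)] at hvanish
  rw [hGint] at hdouble
  have h := ENNReal.toReal_mono (by finiteness) (hvanish.trans hdouble)
  have hi1 : 0 ≤ ∫ x in B, max (|f x| - ε) 0 ^ N := integral_nonneg fun t => by positivity
  have hi2 : 0 ≤ ∫ x in B, ‖gradient f x‖ ^ N := integral_nonneg fun t => by positivity
  simp only [ENNReal.toReal_mul, ENNReal.toReal_ofReal hi1, ENNReal.toReal_ofReal hi2,
    ENNReal.toReal_ofReal (show 0 ≤ (2 * r) ^ N by positivity), ENNReal.toReal_pow,
    ENNReal.toReal_ofNat] at h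
  calc _ ≤ _ := h
    _ = _ := by
      rw [measureReal_def, show 4 * r = 2 * r * 2 by ring, mul_pow (2 * r) 2]
      ring

/-- A Poincaré inequality on a ball for Lipschitz functions vanishing on a subset `Z`. -/
lemma poincare_of_vanishing {f : Euc N → ℝ} (hf : BddLip f) {x₀ : Euc N} {r : ℝ}
    (hr : 0 ≤ r) {Z : Set (Euc N)} (hZB : Z ⊆ Metric.ball x₀ r) (hZ : ∀ y ∈ Z, f y = 0) :
    volume.real Z * ∫ x in Metric.ball x₀ r, |f x| ^ N ≤
      (4 * r) ^ N * volume.real (Metric.ball x₀ r) *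
        ∫ x in Metric.ball x₀ r, ‖gradient f x‖ ^ N := by
  obtain ⟨⟨C, hC⟩, M, hM⟩ := hf
  have hM0 : 0 ≤ M := (abs_nonneg _).trans (hM 0)
  obtain ⟨ψ, hsm, -, hclose, hgr, hglim⟩ := exists_mollification hC
  have hfin : IsFiniteMeasure (volume.restrict (Metric.ball x₀ r)) :=
    ⟨by simpa using measure_ball_lt_top⟩
  have hε : Tendsto (fun k : ℕ => (C : ℝ) / (k + 1)) atTop (𝓝 0) := by
    simpa [div_eq_mul_inv] using
      (tendsto_one_div_add_atTop_nhds_zero_nat (𝕜 := ℝ)).const_mul (C : ℝ)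
  have hεpos : ∀ k : ℕ, 0 ≤ (C : ℝ) / (k + 1) := fun k => by positivity
  have hψ : ∀ x, Tendsto (fun k => ψ k x) atTop (𝓝 (f x)) := fun x => by
    rw [tendsto_iff_dist_tendsto_zero]
    exact squeeze_zero (fun _ => dist_nonneg) (fun k => hclose k x) hε
  have hcg : ∀ k, Continuous (gradient (ψ k)) := fun k =>
    (InnerProductSpace.toDual ℝ (Euc N)).symm.continuous.comp
      ((hsm k).continuous_fderiv (by simp))
  have h1 : Tendsto (fun k : ℕ => ∫ x in Metric.ball x₀ r,
      max (|ψ k x| - (C : ℝ) / (k + 1)) 0 ^ N) atTop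
      (𝓝 (∫ x in Metric.ball x₀ r, |f x| ^ N)) := by
    refine tendsto_integral_of_dominated_convergence (fun _ => M ^ N) (fun k => ?_)
      (integrable_const _) (fun k => Eventually.of_forall fun x => ?_)
      (Eventually.of_forall fun x => ?_)
    · exact ((((hsm k).continuous.abs.sub continuous_const).max continuous_const).pow
        N).aestronglyMeasurable
    · rw [Real.norm_of_nonneg (by positivity)]
      gcongr
      refine max_le ?_ hM0
      have := abs_sub_abs_le_abs_sub (ψ k x) (f x)
      linarith [hclose k x, hM x]
    · have := ((((hψ x).abs.sub hε).max (tendsto_const_nhds (x := (0 : ℝ))))).pow N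
      simpa using this
  have h2 : Tendsto (fun k : ℕ => ∫ x in Metric.ball x₀ r, ‖gradient (ψ k) x‖ ^ N) atTop
      (𝓝 (∫ x in Metric.ball x₀ r, ‖gradient f x‖ ^ N)) := by
    refine tendsto_integral_of_dominated_convergence (fun _ => (C : ℝ) ^ N) (fun k => ?_)
      (integrable_const _) (fun k => Eventually.of_forall fun x => ?_) ?_
    · exact ((hcg k).norm.pow N).aestronglyMeasurable
    · rw [Real.norm_of_nonneg (by positivity)]
      gcongr
      exact hgr k x
    · filter_upwards [ae_restrict_of_ae hglim] with x hx
      exact hx.norm.pow N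
  refine le_of_tendsto_of_tendsto' (h1.const_mul _) (h2.const_mul _) fun k => ?_
  refine poincare_smooth ((hsm k).of_le (by simp)) hr hZB fun y hy => ?_
  have := hclose k y
  rwa [hZ y hy, sub_zero] at this

end Poincare

section Scale

variable {N : ℕ} {H : Euc N → ℝ} {Ω : Set (Euc N)}

lemma Adm.exists_norm_gradient_le (hH : IsFinslerNorm N H) {f : Euc N → ℝ}
    (hf : Adm Ω f) : ∃ L, 0 ≤ L ∧ ∀ x, H (gradient f x) ≤ L := by
  obtain ⟨b, hb0, hbH⟩ := exists_norm_le hH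
  obtain ⟨C, hC⟩ := hf.1.1
  exact ⟨b * C, by positivity, fun x => (hbH _).trans (by gcongr; exact norm_gradient_le hC x)⟩

/-- A bounded measurable weight times the energy density of an admissible function is
integrable. -/
lemma Adm.integrable_weight_mul (hN : 2 ≤ N) (hH : IsFinslerNorm N H)
    (hb : Bornology.IsBounded Ω) {f : Euc N → ℝ} (hf : Adm Ω f) {w : Euc N → ℝ}
    (hw : Measurable w) {M : ℝ} (hM : ∀ x, |w x| ≤ M) :
    Integrable fun x => w x * H (gradient f x) ^ N := by
  obtain ⟨L, hL0, hL⟩ := hf.exists_norm_gradient_le hH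
  have hM0 : 0 ≤ M := (abs_nonneg _).trans (hM 0)
  refine integrable_of_bounded hb (M := M * L ^ N)
    (hw.mul ((measurable_norm_gradient hH f).pow_const N)) (fun x => ?_) fun x hx => ?_
  · have h0 := norm_nonneg' hH (gradient f x)
    rw [abs_mul, abs_pow, abs_of_nonneg h0]
    have := hL x
    have := hM x
    gcongr
  · rw [hf.gradient_eq_zero' hx, norm_zero' hH, zero_pow (by omega), mul_zero]

lemma Adm.integrable_energy (hN : 2 ≤ N) (hH : IsFinslerNorm N H)
    (hb : Bornology.IsBounded Ω) {f : Euc N → ℝ} (hf : Adm Ω f) :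
    Integrable fun x => H (gradient f x) ^ N := by
  simpa using hf.integrable_weight_mul hN hH hb (w := fun _ => 1) measurable_const (M := 1)
    (by simp)

lemma Adm.integrable_flux (hN : 2 ≤ N) (hH : IsFinslerNorm N H) (hreg : FinslerRegular N H)
    (hb : Bornology.IsBounded Ω) {f g : Euc N → ℝ} (hf : Adm Ω f) (hg : Adm Ω g) :
    Integrable fun x => flux N H (gradient f x) (gradient g x) := by
  obtain ⟨L, hL0, hL⟩ := hf.exists_norm_gradient_le hH
  obtain ⟨L', hL0', hL'⟩ := hg.exists_norm_gradient_le hH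
  refine integrable_of_bounded hb (M := L ^ (N - 1) * L') (measurable_flux hH f g)
    (fun x => (abs_flux_le hN hH hreg _ _).trans ?_) fun x hx => ?_
  · have h0 := norm_nonneg' hH (gradient f x)
    have h1 := norm_nonneg' hH (gradient g x)
    have := hL x
    have := hL' x
    gcongr
  · rw [hg.gradient_eq_zero' hx, flux_zero]

lemma Adm.integrable_rpow_mul (hb : Bornology.IsBounded Ω) {f : Euc N → ℝ} (hf : Adm Ω f) {q : ℝ}
    (hq : 0 < q) {w : Euc N → ℝ} (hw : Measurable w) {M : ℝ} (hM : ∀ x, |w x| ≤ M) :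
    Integrable fun x => f x ^ q * w x := by
  obtain ⟨K, hK0, hK⟩ := hf.exists_bound
  refine integrable_of_bounded hb (M := K ^ q * M) ((hf.continuous.measurable.pow_const q).mul hw)
    (fun x => ?_) fun x hx => ?_
  · rw [abs_mul, abs_of_nonneg (rpow_nonneg (hf.nonneg x) q)]
    have := hK x
    have := hM x
    have := hf.nonneg x
    gcongr
  · rw [hf.eq_zero hx, zero_rpow hq.ne', zero_mul]

lemma Adm.integrable_rpow (hb : Bornology.IsBounded Ω) {f : Euc N → ℝ} (hf : Adm Ω f) {q : ℝ}
    (hq : 0 < q) : Integrable fun x => f x ^ q := by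
  simpa using hf.integrable_rpow_mul hb hq (w := fun _ => 1) measurable_const (M := 1) (by simp)

lemma rpow_pos_integral (hΩo : IsOpen Ω) (hΩne : Ω.Nonempty) (hb : Bornology.IsBounded Ω)
    {f : Euc N → ℝ} (hf : Adm Ω f) (hpos : ∀ x ∈ Ω, 0 < f x) {q : ℝ} (hq : 0 < q) :
    0 < ∫ x, f x ^ q := by
  rw [integral_pos_iff_support_of_nonneg (fun x => rpow_nonneg (hf.nonneg x) q)
    (hf.integrable_rpow hb hq)]
  exact (hΩo.measure_pos volume hΩne).trans_le
    (measure_mono fun x hx => (rpow_pos_of_pos (hpos x hx) q).ne')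

variable {p : ℝ} {U : Euc N → ℝ}

lemma IsExtSolution.energy_eq (hN : 2 ≤ N) (hH : IsFinslerNorm N H) (hreg : FinslerRegular N H)
    (hp : 1 < p) (hU : IsExtSolution N H Ω p U) : energy N H U = ∫ x, U x ^ (p + 1) := by
  have h := hU.weak U hU.adm
  simp_rw [flux_self hN hH hreg] at h
  rw [energy, h]
  congr with x
  rw [rpow_add_one' (hU.adm.nonneg x) (by linarith)]

lemma IsExtSolution.energy_pos (hN : 2 ≤ N) (hH : IsFinslerNorm N H) (hreg : FinslerRegular N H)
    (hΩo : IsOpen Ω) (hΩne : Ω.Nonempty) (hb : Bornology.IsBounded Ω)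
    (hp : 1 < p) (hU : IsExtSolution N H Ω p U) : 0 < energy N H U := by
  rw [hU.energy_eq hN hH hreg hp]
  exact rpow_pos_integral hΩo hΩne hb hU.adm hU.pos (by linarith)

lemma IsExtSolution.energyInf_eq (hN : 2 ≤ N) (hH : IsFinslerNorm N H) (hreg : FinslerRegular N H)
    (hΩo : IsOpen Ω) (hΩne : Ω.Nonempty) (hb : Bornology.IsBounded Ω)
    (hp : 1 < p) (hU : IsExtSolution N H Ω p U) :
    energyInf N H Ω p = energy N H U ^ (1 - (N : ℝ) / (p + 1)) := by
  have hE := hU.energy_pos hN hH hreg hΩo hΩne hb hp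
  have h := hU.least
  rw [← hU.energy_eq hN hH hreg hp] at h
  rw [rpow_sub hE, rpow_one, eq_div_iff (rpow_pos_of_pos hE _).ne']
  exact h.symm

lemma integral_log_weight_le (hN : 2 ≤ N) {ε ρ : ℝ} (hε : 0 < ε) (hερ : ε ≤ ρ) :
    Integrable (fun z : Euc N => (Icc ε ρ).indicator (fun t => (t ^ N)⁻¹) ‖z‖) ∧
    ∫ z : Euc N, (Icc ε ρ).indicator (fun t => (t ^ N)⁻¹) ‖z‖ =
      N * volume.real (Metric.ball (0 : Euc N) 1) * Real.log (ρ / ε) := by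
  have hne : Nonempty (Fin N) := ⟨⟨0, by omega⟩⟩
  have hm : Measurable fun z : Euc N => (Icc ε ρ).indicator (fun t => (t ^ N)⁻¹) ‖z‖ :=
    ((measurable_id.pow_const N).inv.indicator measurableSet_Icc).comp measurable_norm
  constructor
  · refine integrable_of_bounded (Metric.isBounded_closedBall (x := (0 : Euc N)) (r := ρ)) hm
      (M := (ε ^ N)⁻¹) (fun z => ?_) fun z hz => ?_
    · by_cases h : ‖z‖ ∈ Icc ε ρ
      · rw [indicator_of_mem h, abs_of_nonneg (by positivity)]
        have := h.1
        gcongr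
      · rw [indicator_of_notMem h, abs_zero]
        positivity
    · refine indicator_of_notMem (fun h => hz ?_) _
      simpa using h.2
  · rw [integral_fun_norm_addHaar volume (fun t => (Icc ε ρ).indicator (fun t => (t ^ N)⁻¹) t)]
    have h1 : ∀ y : ℝ, y ^ (Module.finrank ℝ (Euc N) - 1) •
        (Icc ε ρ).indicator (fun t => (t ^ N)⁻¹) y = (Icc ε ρ).indicator (fun t => t⁻¹) y := by
      intro y
      by_cases h : y ∈ Icc ε ρ
      · rw [indicator_of_mem h, indicator_of_mem h, finrank_euclideanSpace_fin, smul_eq_mul]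
        have hy : y ≠ 0 := (hε.trans_le h.1).ne'
        obtain ⟨m, rfl⟩ : ∃ m, N = m + 1 := ⟨N - 1, by omega⟩
        rw [Nat.add_sub_cancel, pow_succ]
        field_simp
      · simp [indicator_of_notMem h]
    simp_rw [h1]
    rw [setIntegral_indicator measurableSet_Icc, inter_eq_self_of_subset_right
      (s := Ioi (0 : ℝ)) (t := Icc ε ρ) (fun t ht => hε.trans_le ht.1), integral_Icc_eq_integral_Ioc,
      ← intervalIntegral.integral_of_le hερ, integral_inv_of_pos hε (hε.trans_le hερ)]
    simp [mul_assoc]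

/-- The capped logarithm `log (ρ / |x - y₀|) / p`, truncated between `0` and `1`. -/
lemma exists_log_test (hN : 2 ≤ N) (hH : IsFinslerNorm N H) {b : ℝ} (hb0 : 0 < b)
    (hbH : ∀ x, H x ≤ b * ‖x‖) (y₀ : Euc N) {ρ : ℝ} (hρ : 0 < ρ) {p : ℝ} (hp : 0 < p) :
    ∃ f : Euc N → ℝ, Adm (Metric.ball y₀ ρ) f ∧
      (∀ x ∈ Metric.ball y₀ (ρ * Real.exp (-p)), f x = 1) ∧
      energy N H f ≤ (b / p) ^ N * (N * volume.real (Metric.ball (0 : Euc N) 1) * p) := by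
  set ε := ρ * Real.exp (-p) with hε
  have hε0 : 0 < ε := by positivity
  have hερ : ε ≤ ρ := by
    have : Real.exp (-p) ≤ 1 := Real.exp_le_one_iff.2 (by linarith)
    nlinarith
  have hlogε : Real.log ε = Real.log ρ - p := by
    rw [hε, Real.log_mul hρ.ne' (Real.exp_pos _).ne', Real.log_exp]
    ring
  set m : Euc N → ℝ := fun x => max (min (dist x y₀) ρ - ε) 0 with hm
  have hm1 : LipschitzWith 1 m := by
    have := ((((LipschitzWith.dist_left y₀).min_const ρ).sub (LipschitzWith.const ε)).max_const 0)
    simpa using this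
  have hm0 : ∀ x, 0 ≤ m x := fun x => le_max_right _ _
  have hmρ : ∀ x, m x ≤ ρ - ε := fun x =>
    max_le (by linarith [min_le_right (dist x y₀) ρ]) (by linarith)
  have hmB : BddLip m := ⟨⟨1, hm1⟩, ρ - ε, fun x => by rw [abs_of_nonneg (hm0 x)]; exact hmρ x⟩
  set G : ℝ → ℝ := fun t => (Real.log ρ - Real.log (ε + t)) / p with hG
  have hGd : ∀ t, 0 ≤ t → HasDerivAt G (-((ε + t)⁻¹ / p)) t := by
    intro t ht
    have h1 : HasDerivAt (fun t => ε + t) 1 t := (hasDerivAt_id t).const_add ε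
    have h2 := ((h1.log (by positivity)).const_sub (Real.log ρ)).div_const p
    refine h2.congr_deriv ?_
    rw [one_div, neg_div]
  have hfB : BddLip fun x => G (m x) := by
    refine hmB.comp hm0 hmρ fun t ht => ?_
    have : ContDiffAt ℝ 1 (fun t => Real.log (ε + t)) t :=
      (contDiffAt_const.add contDiffAt_id).log (by simp only [id]; positivity)
    exact (contDiffAt_const.sub this).div_const p
  refine ⟨fun x => G (m x), ⟨hfB, fun x => ?_, fun x hx => ?_⟩, fun x hx => ?_, ?_⟩
  · refine div_nonneg (sub_nonneg.2 (Real.log_le_log (by linarith [hm0 x]) ?_)) hp.le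
    linarith [hmρ x]
  · have h : ρ ≤ dist x y₀ := not_lt.1 hx
    have : m x = ρ - ε := by simp only [hm, min_eq_right h, max_eq_left (sub_nonneg.2 hερ)]
    simp [hG, this]
  · have h : dist x y₀ < ε := hx
    have : m x = 0 := max_eq_right (by linarith [min_le_left (dist x y₀) ρ])
    simp only [hG, this, add_zero, hlogε]
    field_simp
    ring
  · obtain ⟨hint, hval⟩ := integral_log_weight_le hN hε0 hερ
    have hlog : Real.log (ρ / ε) = p := by
      rw [Real.log_div hρ.ne' hε0.ne', hlogε]
      ring
    rw [hlog] at hval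
    rw [← hval, ← integral_sub_right_eq_self _ y₀, ← integral_const_mul]
    refine integral_mono_of_nonneg (Eventually.of_forall fun x => pow_nonneg (norm_nonneg' hH _) _)
      ((hint.comp_sub_right y₀).const_mul _) ?_
    filter_upwards [hmB.ae_differentiableAt] with x hx
    rw [gradient_comp hx (hGd _ (hm0 x)), norm_smul' hH, abs_neg,
      abs_of_nonneg (div_nonneg (inv_nonneg.2 (add_nonneg hε0.le (hm0 x))) hp.le), mul_pow]
    have hz : ∀ w : ℝ, 0 ≤ (Icc ε ρ).indicator (fun t => (t ^ N)⁻¹) ‖x - y₀‖ := fun _ =>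
      indicator_nonneg (fun t ht => by have := hε0.trans_le ht.1; positivity) _
    have hzero : gradient m x = 0 →
        ((ε + m x)⁻¹ / p) ^ N * H (gradient m x) ^ N ≤
          (b / p) ^ N * (Icc ε ρ).indicator (fun t => (t ^ N)⁻¹) ‖x - y₀‖ := by
      intro h
      rw [h, norm_zero' hH, zero_pow (by omega), mul_zero]
      exact mul_nonneg (by positivity) (hz 0)
    rcases le_or_gt (dist x y₀) ε with h1 | h1
    · refine hzero (gradient_eq_zero_of_nonneg hm0 ?_)
      exact max_eq_right (by linarith [min_le_left (dist x y₀) ρ])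
    rcases le_or_gt ρ (dist x y₀) with h2 | h2
    · refine hzero (gradient_eq_zero_of_le hmρ ?_)
      simp only [hm, min_eq_right h2, max_eq_left (sub_nonneg.2 hερ)]
    have hmx : ε + m x = dist x y₀ := by
      simp only [hm, min_eq_left h2.le, max_eq_left (sub_nonneg.2 h1.le)]
      ring
    rw [indicator_of_mem (by rw [← dist_eq_norm]; exact ⟨h1.le, h2.le⟩), hmx, ← dist_eq_norm]
    have hd : 0 < dist x y₀ := hε0.trans h1
    have hg : H (gradient m x) ≤ b := (hbH _).trans (by
      have := norm_gradient_le hm1 x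
      rw [NNReal.coe_one] at this
      nlinarith)
    have h0 := norm_nonneg' hH (gradient m x)
    calc ((dist x y₀)⁻¹ / p) ^ N * H (gradient m x) ^ N ≤ ((dist x y₀)⁻¹ / p) ^ N * b ^ N := by
          gcongr
      _ = (b / p) ^ N * (dist x y₀ ^ N)⁻¹ := by
          rw [div_pow, div_pow, inv_pow]
          ring

lemma exists_energyInf_mul_pow_le (hN : 2 ≤ N) (hH : IsFinslerNorm N H) (hΩo : IsOpen Ω)
    (hΩne : Ω.Nonempty) (hb : Bornology.IsBounded Ω) :
    ∃ A, 0 < A ∧ ∀ p, 1 < p → energyInf N H Ω p * p ^ (N - 1) ≤ A := by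
  obtain ⟨b, hb0, hbH⟩ := exists_norm_le hH
  obtain ⟨y₀, hy₀⟩ := hΩne
  obtain ⟨ρ, hρ, hball⟩ := Metric.isOpen_iff.1 hΩo y₀ hy₀
  have hne : Nonempty (Fin N) := ⟨⟨0, by omega⟩⟩
  set ω := volume.real (Metric.ball (0 : Euc N) 1) with hω
  have hω0 : 0 < ω := ENNReal.toReal_pos (Metric.measure_ball_pos volume 0 one_pos).ne'
    measure_ball_lt_top.ne
  have hN0 : (0 : ℝ) < N := by exact_mod_cast (by omega : 0 < N)
  set μ := min 1 (ρ ^ N * ω) with hμ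
  have hμ0 : 0 < μ := lt_min one_pos (by positivity)
  refine ⟨b ^ N * (N * ω) / (μ ^ (N : ℝ) * Real.exp (-(N * N))), by positivity, fun p hp => ?_⟩
  have hp0 : 0 < p := by linarith
  obtain ⟨f, hf, hf1, hfE⟩ := exists_log_test hN hH hb0 hbH y₀ hρ hp0
  have hfΩ := hf.mono hball
  have h1 := energyInf_mul_le hN hH hΩo hb hp hfΩ
  have h2 : μ * Real.exp (-(p * N)) ≤ ∫ x, f x ^ (p + 1) := by
    calc μ * Real.exp (-(p * N)) ≤ (ρ ^ N * ω) * Real.exp (-(p * N)) := by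
          gcongr
          exact min_le_right _ _
      _ = volume.real (Metric.ball y₀ (ρ * Real.exp (-p))) := by
          rw [measureReal_def, Measure.addHaar_ball volume y₀ (by positivity), ENNReal.toReal_mul,
            finrank_euclideanSpace_fin, ENNReal.toReal_ofReal (by positivity), mul_pow,
            ← Real.exp_nat_mul, hω, measureReal_def]
          ring_nf
      _ = ∫ x in Metric.ball y₀ (ρ * Real.exp (-p)), f x ^ (p + 1) := by
          rw [setIntegral_congr_fun measurableSet_ball
            (g := fun _ => (1 : ℝ)) fun x hx => by simp only [hf1 x hx, one_rpow]]
          simp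
      _ ≤ ∫ x, f x ^ (p + 1) :=
          setIntegral_le_integral (hf.integrable_rpow Metric.isBounded_ball (by linarith))
            (Eventually.of_forall fun x => rpow_nonneg (hf.nonneg x) _)
  have hexp : (N : ℝ) / (p + 1) ≤ N := div_le_self hN0.le (by linarith)
  have h3 : μ ^ (N : ℝ) * Real.exp (-(N * N)) ≤ (∫ x, f x ^ (p + 1)) ^ ((N : ℝ) / (p + 1)) := by
    refine le_trans ?_ (rpow_le_rpow (by positivity) h2 (by positivity))
    rw [mul_rpow hμ0.le (Real.exp_pos _).le, ← Real.exp_mul]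
    refine mul_le_mul (rpow_le_rpow_of_exponent_ge hμ0 (min_le_left _ _) hexp) ?_
      (Real.exp_pos _).le (by positivity)
    · rw [Real.exp_le_exp, neg_mul, neg_le_neg_iff]
      have : p / (p + 1) ≤ 1 := (div_le_one (by linarith)).2 (by linarith)
      calc p * N * (N / (p + 1)) = N * N * (p / (p + 1)) := by ring
        _ ≤ N * N * 1 := by gcongr
        _ = N * N := mul_one _
  have hC0 := energyInf_nonneg (Ω := Ω) hH p
  rw [le_div_iff₀ (by positivity)]
  have h4 := (mul_le_mul_of_nonneg_left h3 hC0).trans (h1.trans hfE)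
  have h5 := mul_le_mul_of_nonneg_right h4 (show 0 ≤ p ^ (N - 1) by positivity)
  calc _ = energyInf N H Ω p * (μ ^ (N : ℝ) * Real.exp (-(N * N))) * p ^ (N - 1) := by ring
    _ ≤ _ := h5
    _ = b ^ N * (N * ω) := by
      obtain ⟨k, rfl⟩ : ∃ k, N = k + 1 := ⟨N - 1, by omega⟩
      rw [Nat.add_sub_cancel, div_pow, pow_succ p, ← hω]
      field_simp

end Scale

section ScaleBound

variable {N : ℕ} {H : Euc N → ℝ} {Ω : Set (Euc N)} {p : ℝ} {U : Euc N → ℝ}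

lemma IsExtSolution.integral_rpow_le (hN : 2 ≤ N) (hH : IsFinslerNorm N H)
    (hreg : FinslerRegular N H) (hΩo : IsOpen Ω) (hΩne : Ω.Nonempty) (hb : Bornology.IsBounded Ω)
    (hp : 1 < p) (hU : IsExtSolution N H Ω p U) :
    ∫ x, U x ^ p ≤ (1 + volume.real Ω) * energy N H U ^ (p / (p + 1)) := by
  have hE := hU.energy_pos hN hH hreg hΩo hΩne hb hp
  have hEeq := hU.energy_eq hN hH hreg hp
  have hp0 : 0 < p := by linarith
  set l := energy N H U ^ (1 / (p + 1)) with hl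
  have hl0 : 0 < l := rpow_pos_of_pos hE _
  have hlp : l ^ p = energy N H U ^ (p / (p + 1)) := by
    rw [hl, ← rpow_mul hE.le]
    congr 1
    ring
  have hlE : l⁻¹ * energy N H U = energy N H U ^ (p / (p + 1)) := by
    rw [show p / (p + 1) = 1 - 1 / (p + 1) by field_simp; ring, rpow_sub hE, rpow_one, hl]
    field_simp
  have hind : Integrable (Ω.indicator fun _ => l ^ p) := by
    rw [integrable_indicator_iff hΩo.measurableSet]
    exact integrableOn_const hb.measure_lt_top.ne
  have hi : Integrable fun x => U x ^ (p + 1) := hU.adm.integrable_rpow hb (by linarith)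
  calc ∫ x, U x ^ p ≤ ∫ x, (Ω.indicator (fun _ => l ^ p) x + l⁻¹ * U x ^ (p + 1)) := by
        refine integral_mono (hU.adm.integrable_rpow hb hp0) (hind.add (hi.const_mul _)) fun x => ?_
        have hx0 := hU.adm.nonneg x
        by_cases hx : x ∈ Ω
        · rw [indicator_of_mem hx]
          rcases le_total (U x) l with h | h
          · have h1 : U x ^ p ≤ l ^ p := by gcongr
            have h2 : 0 ≤ l⁻¹ * U x ^ (p + 1) := by positivity
            linarith
          · have h1 : U x ^ p ≤ l⁻¹ * U x ^ (p + 1) := by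
              rw [rpow_add_one' hx0 (by linarith), le_inv_mul_iff₀ hl0, mul_comm]
              gcongr
            have h2 : 0 ≤ l ^ p := by positivity
            linarith
        · simp [indicator_of_notMem hx, hU.adm.eq_zero hx, zero_rpow hp0.ne',
            zero_rpow (show p + 1 ≠ 0 by linarith)]
    _ = volume.real Ω * l ^ p + l⁻¹ * energy N H U := by
        rw [integral_add hind (hi.const_mul _), integral_const_mul, ← hEeq,
          integral_indicator hΩo.measurableSet, setIntegral_const, smul_eq_mul]
    _ = _ := by
        rw [hlp, hlE]
        ring

/-- The fundamental scale estimates: `p k^N ≤ A E` for the mass scale `k`, and `E ≤ 1` for large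
exponents. -/
lemma exists_scale_bound (hN : 2 ≤ N) (hH : IsFinslerNorm N H)
    (hreg : FinslerRegular N H) (hΩo : IsOpen Ω) (hΩne : Ω.Nonempty)
    (hb : Bornology.IsBounded Ω) :
    ∃ A, 1 ≤ A ∧ ∀ p U k, A ≤ p → IsExtSolution N H Ω p U → 0 ≤ k →
      k ^ (N - 1) = ∫ x, U x ^ p → p * k ^ N ≤ A * energy N H U ∧ energy N H U ≤ 1 := by
  obtain ⟨A₁, hA₁, hC⟩ := exists_energyInf_mul_pow_le hN hH hΩo hΩne hb
  have hV : 0 ≤ volume.real Ω := measureReal_nonneg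
  set B := (1 + volume.real Ω) ^ N * A₁ with hB
  have hB0 : 0 < B := by positivity
  refine ⟨max (max (N : ℝ) B) (max A₁ 2), by
    have : (2 : ℝ) ≤ max (max (N : ℝ) B) (max A₁ 2) := (le_max_right _ _).trans (le_max_right _ _)
    linarith, fun p U k hp hU hk hkI => ?_⟩
  simp only [max_le_iff] at hp
  obtain ⟨⟨hpN, hpB⟩, hpA, hp2⟩ := hp
  have hp1 : 1 < p := by linarith
  have hE := hU.energy_pos hN hH hreg hΩo hΩne hb hp1
  have hI := hU.integral_rpow_le hN hH hreg hΩo hΩne hb hp1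
  have hCE := hU.energyInf_eq hN hH hreg hΩo hΩne hb hp1
  have hCp := hC p hp1
  rw [hCE] at hCp
  rw [← hkI] at hI
  set E := energy N H U with hEdef
  have hexp : 0 < 1 - (N : ℝ) / (p + 1) := by
    rw [sub_pos, div_lt_one (by linarith)]
    linarith
  refine ⟨?_, ?_⟩
  · have key : (p * k ^ N) ^ (N - 1) ≤ (max 1 B * E) ^ (N - 1) := by
      calc (p * k ^ N) ^ (N - 1) = p ^ (N - 1) * (k ^ (N - 1)) ^ N := by
            rw [mul_pow, ← pow_mul, ← pow_mul, mul_comm N]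
        _ ≤ p ^ (N - 1) * ((1 + volume.real Ω) * E ^ (p / (p + 1))) ^ N := by gcongr
        _ = (1 + volume.real Ω) ^ N * (E ^ (1 - (N : ℝ) / (p + 1)) * p ^ (N - 1)) *
              E ^ (N - 1) := by
            have h1 : (E ^ (p / (p + 1))) ^ N = E ^ (1 - (N : ℝ) / (p + 1)) * E ^ (N - 1) := by
              rw [← rpow_natCast (E ^ (p / (p + 1))), ← rpow_mul hE.le, ← rpow_natCast E (N - 1),
                ← rpow_add hE, Nat.cast_sub (by omega)]
              congr 1
              field_simp
              push_cast
              ring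
            rw [mul_pow, h1]
            ring
        _ ≤ (1 + volume.real Ω) ^ N * A₁ * E ^ (N - 1) := by gcongr
        _ ≤ max 1 B ^ (N - 1) * E ^ (N - 1) := by
            have h1 : max 1 B ≤ max 1 B ^ (N - 1) :=
              le_self_pow₀ (le_max_left _ _) (by omega)
            have h2 : B ≤ max 1 B ^ (N - 1) := (le_max_right _ _).trans h1
            gcongr
        _ = (max 1 B * E) ^ (N - 1) := (mul_pow _ _ _).symm
    have h := le_of_pow_le_pow_left₀ (by omega) (by positivity) key
    refine h.trans (mul_le_mul_of_nonneg_right (max_le ?_ ?_) hE.le)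
    · have : (2 : ℝ) ≤ max (max (N : ℝ) B) (max A₁ 2) := (le_max_right _ _).trans (le_max_right _ _)
      linarith
    · exact (le_max_right _ _).trans (le_max_left _ _)
  · by_contra! hlt
    have h1 : 1 < E ^ (1 - (N : ℝ) / (p + 1)) := one_lt_rpow hlt hexp
    have h2 : p ≤ p ^ (N - 1) := le_self_pow₀ hp1.le (by omega)
    have h3 : A₁ < E ^ (1 - (N : ℝ) / (p + 1)) * p ^ (N - 1) := by nlinarith
    linarith

end ScaleBound

section Estimates

variable {N : ℕ} {H : Euc N → ℝ} {Ω : Set (Euc N)} {p : ℝ} {U : Euc N → ℝ}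

lemma hasDerivAt_one_add_div_rpow {k : ℝ} (hk : 0 < k) (q : ℝ) {t : ℝ} (ht : 0 ≤ t) :
    HasDerivAt (fun t => (1 + t / k) ^ q) (q * (1 + t / k) ^ (q - 1) / k) t := by
  have hpos : 0 < 1 + t / k := by positivity
  have h1 : HasDerivAt (fun t => 1 + t / k) (1 / k) t :=
    ((hasDerivAt_id t).div_const k).const_add 1
  refine (h1.rpow_const (p := q) (Or.inl hpos.ne')).congr_deriv ?_
  ring

lemma contDiffAt_one_add_div_rpow {k : ℝ} (hk : 0 < k) (q : ℝ) {t : ℝ} (ht : 0 ≤ t) :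
    ContDiffAt ℝ 1 (fun t => (1 + t / k) ^ q) t := by
  have hpos : 0 < 1 + t / k := by positivity
  exact (contDiffAt_const.add (contDiffAt_id.div_const k)).rpow_const_of_ne hpos.ne'

/-- A fixed power of `1 + U / k` has bounded energy, where `k` is the mass scale of `U`. -/
lemma IsExtSolution.beta_bound (hN : 2 ≤ N) (hH : IsFinslerNorm N H)
    (hreg : FinslerRegular N H) (hb : Bornology.IsBounded Ω)
    (hp : 1 < p) (hU : IsExtSolution N H Ω p U) {k : ℝ} (hk : 0 < k)
    (hkI : k ^ (N - 1) = ∫ x, U x ^ p) :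
    Adm Ω (fun x => (1 + U x / k) ^ (1 / 4 : ℝ) - 1) ∧
      energy N H (fun x => (1 + U x / k) ^ (1 / 4 : ℝ) - 1) ≤ 2 := by
  have hp0 : 0 < p := by linarith
  have hone : ∀ t, 0 ≤ t → 1 ≤ 1 + t / k := fun t ht => by
    have : 0 ≤ t / k := by positivity
    linarith
  have hβ : Adm Ω (fun x => (1 + U x / k) ^ (1 / 4 : ℝ) - 1) :=
    hU.adm.comp (g := fun t => (1 + t / k) ^ (1 / 4 : ℝ) - 1)
      (fun t ht => (contDiffAt_one_add_div_rpow hk _ ht).sub contDiffAt_const) (by simp)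
      fun t ht => sub_nonneg.2 (one_le_rpow (hone t ht) (by norm_num))
  refine ⟨hβ, ?_⟩
  set φ : Euc N → ℝ := fun x => 1 - (1 + U x / k) ^ (-(1 / 2) : ℝ) with hφdef
  have hφ : Adm Ω φ :=
    hU.adm.comp (g := fun t => 1 - (1 + t / k) ^ (-(1 / 2) : ℝ))
      (fun t ht => contDiffAt_const.sub (contDiffAt_one_add_div_rpow hk _ ht)) (by simp)
      fun t ht => sub_nonneg.2 (rpow_le_one_of_one_le_of_nonpos (hone t ht) (by norm_num))
  have hweak := hU.weak φ hφ
  have hφ1 : ∀ x, φ x ≤ 1 := fun x => by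
    have := rpow_nonneg (zero_le_one.trans (hone _ (hU.adm.nonneg x))) (-(1 / 2))
    simp only [hφdef]
    linarith
  have hrhs : ∫ x, U x ^ p * φ x ≤ k ^ (N - 1) := by
    rw [hkI]
    refine integral_mono (hU.adm.integrable_rpow_mul hb hp0 hφ.continuous.measurable (M := 1)
      fun x => by rw [abs_of_nonneg (hφ.nonneg x)]; exact hφ1 x) (hU.adm.integrable_rpow hb hp0)
      fun x => mul_le_of_le_one_right (rpow_nonneg (hU.adm.nonneg x) _) (hφ1 x)
  have hle : energy N H (fun x => (1 + U x / k) ^ (1 / 4 : ℝ) - 1) ≤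
      2 * (k ^ (N - 1))⁻¹ * ∫ x, flux N H (gradient U x) (gradient φ x) := by
    rw [energy, ← integral_const_mul]
    refine integral_mono_ae (hβ.integrable_energy hN hH hb)
      ((hU.adm.integrable_flux hN hH hreg hb hφ).const_mul _) ?_
    filter_upwards [hU.adm.bddLip.ae_differentiableAt] with x hx
    have hx0 := hU.adm.nonneg x
    rw [gradient_sub_const, gradient_comp hx (hasDerivAt_one_add_div_rpow hk (1 / 4) hx0),
      gradient_comp hx ((hasDerivAt_one_add_div_rpow hk (-(1 / 2)) hx0).const_sub 1),
      norm_smul' hH, flux_smul, flux_self hN hH hreg, mul_pow]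
    have h1 := hone _ hx0
    set y := 1 + U x / k with hy
    have hy0 : 0 < y := by linarith
    rw [abs_of_nonneg (by positivity), ← mul_assoc]
    refine mul_le_mul_of_nonneg_right ?_ (pow_nonneg (norm_nonneg' hH _) _)
    have h2 : (1 / 4 * y ^ (1 / 4 - 1 : ℝ)) ^ N ≤ y ^ (-(1 / 2) - 1 : ℝ) := by
      have hz1 : y ^ (1 / 4 - 1 : ℝ) ≤ 1 :=
        rpow_le_one_of_one_le_of_nonpos h1 (by norm_num)
      have hz0 : 0 ≤ y ^ (1 / 4 - 1 : ℝ) := by positivity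
      calc (1 / 4 * y ^ (1 / 4 - 1 : ℝ)) ^ N ≤ (y ^ (1 / 4 - 1 : ℝ)) ^ N := by
            gcongr
            linarith
        _ ≤ (y ^ (1 / 4 - 1 : ℝ)) ^ 2 := pow_le_pow_of_le_one hz0 hz1 hN
        _ = y ^ (-(1 / 2) - 1 : ℝ) := by
            rw [← rpow_natCast, ← rpow_mul hy0.le]
            norm_num
    have hkN : k ^ N = k ^ (N - 1) * k := by
      rw [← pow_succ, Nat.sub_add_cancel (by omega)]
    calc (1 / 4 * y ^ (1 / 4 - 1 : ℝ) / k) ^ N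
        = (1 / 4 * y ^ (1 / 4 - 1 : ℝ)) ^ N / k ^ N := div_pow _ _ _
      _ ≤ y ^ (-(1 / 2) - 1 : ℝ) / k ^ N := by gcongr
      _ = _ := by
          rw [hkN]
          field_simp
  rw [hweak] at hle
  have hk' : 0 < k ^ (N - 1) := by positivity
  calc _ ≤ _ := hle
    _ ≤ 2 * (k ^ (N - 1))⁻¹ * k ^ (N - 1) := by gcongr
    _ = 2 := by field_simp

lemma young_pow (hN : 2 ≤ N) {s t : ℝ} (hs : 0 ≤ s) (ht : 0 ≤ t) :
    N * s ^ (N - 1) * t ≤ s ^ N / 2 + (2 * N) ^ N / 2 * t ^ N := by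
  obtain ⟨m, rfl⟩ : ∃ m, N = m + 1 := ⟨N - 1, by omega⟩
  rw [Nat.add_sub_cancel]
  set n : ℝ := ((m + 1 : ℕ) : ℝ) with hn
  have hn0 : 0 < n := by positivity
  rcases le_total (2 * n * t) s with h | h
  · have h1 : s ^ m * (2 * n * t) ≤ s ^ m * s := by gcongr
    have h2 : 0 ≤ (2 * n) ^ (m + 1) / 2 * t ^ (m + 1) := by positivity
    rw [pow_succ s]
    linarith
  · have h1 : s ^ m ≤ (2 * n * t) ^ m := by gcongr
    have h2 : 0 ≤ s ^ (m + 1) / 2 := by positivity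
    calc n * s ^ m * t ≤ n * (2 * n * t) ^ m * t := by gcongr
      _ = (2 * n) ^ (m + 1) / 2 * t ^ (m + 1) := by
          rw [mul_pow, pow_succ, pow_succ]
          ring
      _ ≤ _ := by linarith

/-- A logarithmic Caccioppoli inequality: the logarithm of a supersolution is a Hardy weight. -/
lemma IsExtSolution.hardy (hN : 2 ≤ N) (hH : IsFinslerNorm N H)
    (hreg : FinslerRegular N H) (hb : Bornology.IsBounded Ω)
    (hU : IsExtSolution N H Ω p U) {w : Euc N → ℝ} (hw : Adm Ω w) {δ : ℝ} (hδ : 0 < δ) :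
    ∫ x, (w x * (U x + δ)⁻¹) ^ N * H (gradient U x) ^ N ≤ (2 * N) ^ N * energy N H w := by
  have hV : BddLip fun x => (U x + δ)⁻¹ := by
    obtain ⟨M, -, hM⟩ := hU.adm.exists_bound
    refine hU.adm.bddLip.comp (g := fun t => (t + δ)⁻¹) hU.adm.nonneg hM fun t ht => ?_
    exact (contDiffAt_id.add contDiffAt_const).inv (by simp only [id]; positivity)
  have hpos : ∀ x, 0 < U x + δ := fun x => by have := hU.adm.nonneg x; positivity
  have hV0 : ∀ x, 0 ≤ (U x + δ)⁻¹ := fun x => (inv_pos.2 (hpos x)).le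
  have hφ : Adm Ω fun x => w x ^ N * (U x + δ)⁻¹ ^ (N - 1) :=
    (hw.pow (by omega)).mul_of_nonneg (hV.pow (N - 1)) fun x => pow_nonneg (hV0 x) _
  have hweak := hU.weak _ hφ
  have hrhs : 0 ≤ ∫ x, U x ^ p * (w x ^ N * (U x + δ)⁻¹ ^ (N - 1)) :=
    integral_nonneg fun x => mul_nonneg (rpow_nonneg (hU.adm.nonneg x) _) (hφ.nonneg x)
  rw [← hweak] at hrhs
  obtain ⟨M, hM⟩ := ((hw.bddLip.mul hV).pow N).2
  have hi1 : Integrable fun x => (w x * (U x + δ)⁻¹) ^ N * H (gradient U x) ^ N :=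
    hU.adm.integrable_weight_mul hN hH hb ((hw.bddLip.mul hV).pow N).continuous.measurable hM
  have hi2 := hw.integrable_energy hN hH hb
  have hle : ∫ x, flux N H (gradient U x)
      (gradient (fun x => w x ^ N * (U x + δ)⁻¹ ^ (N - 1)) x) ≤
      ∫ x, ((2 * N) ^ N / 2 * H (gradient w x) ^ N -
        1 / 2 * ((w x * (U x + δ)⁻¹) ^ N * H (gradient U x) ^ N)) := by
    refine integral_mono_ae (hU.adm.integrable_flux hN hH hreg hb hφ)
      ((hi2.const_mul _).sub (hi1.const_mul _)) ?_
    filter_upwards [hU.adm.bddLip.ae_differentiableAt, hw.bddLip.ae_differentiableAt,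
      hV.ae_differentiableAt] with x hx hwx hVx
    have hder : HasDerivAt (fun t => (t + δ)⁻¹ ^ (N - 1))
        ((N - 1 : ℕ) * (U x + δ)⁻¹ ^ (N - 1 - 1) * (-1 / (U x + δ) ^ 2)) (U x) :=
      (((hasDerivAt_id (U x)).add_const δ).fun_inv (hpos x).ne').fun_pow (N - 1)
    rw [gradient_mul (hwx.fun_pow N) (hVx.fun_pow (N - 1)), gradient_pow hwx, gradient_comp hx hder,
      smul_smul, smul_smul, flux_add, flux_smul, flux_smul, flux_self hN hH hreg]
    set s := w x * (U x + δ)⁻¹ * H (gradient U x) with hs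
    have hw0 := hw.nonneg x
    have hH0 := norm_nonneg' hH (gradient U x)
    have ht0 := norm_nonneg' hH (gradient w x)
    have hs0 : 0 ≤ s := mul_nonneg (mul_nonneg hw0 (hV0 x)) hH0
    have hy := young_pow hN hs0 ht0
    have hf := (le_abs_self _).trans (abs_flux_le hN hH hreg (gradient U x) (gradient w x))
    have hVx0 := hV0 x
    rw [← mul_pow, ← hs]
    obtain ⟨m, rfl⟩ : ∃ m, N = m + 2 := ⟨N - 2, by omega⟩
    simp only [show m + 2 - 1 = m + 1 by omega, Nat.add_sub_cancel] at *
    have e1 : (U x + δ)⁻¹ ^ (m + 1) * (((m + 2 : ℕ) : ℝ) * w x ^ (m + 1)) *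
        flux (m + 2) H (gradient U x) (gradient w x) ≤
        ((m + 2 : ℕ) : ℝ) * s ^ (m + 1) * H (gradient w x) := by
      calc _ ≤ (U x + δ)⁻¹ ^ (m + 1) * (((m + 2 : ℕ) : ℝ) * w x ^ (m + 1)) *
            (H (gradient U x) ^ (m + 1) * H (gradient w x)) := by gcongr
        _ = _ := by
          rw [hs]
          ring
    have e2 : w x ^ (m + 2) * (((m + 1 : ℕ) : ℝ) * (U x + δ)⁻¹ ^ m * (-1 / (U x + δ) ^ 2)) *
        H (gradient U x) ^ (m + 2) = -(((m + 1 : ℕ) : ℝ) * s ^ (m + 2)) := by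
      rw [hs, mul_pow, mul_pow, pow_add (U x + δ)⁻¹ m 2, inv_pow (U x + δ) 2]
      ring
    have e3 : s ^ (m + 2) ≤ ((m + 1 : ℕ) : ℝ) * s ^ (m + 2) := by
      refine le_mul_of_one_le_left (by positivity) ?_
      exact_mod_cast Nat.succ_le_succ (Nat.zero_le m)
    linarith
  rw [integral_sub (hi2.const_mul _) (hi1.const_mul _), integral_const_mul,
    integral_const_mul] at hle
  rw [energy]
  linarith

end Estimates

section ThinBall

variable {N : ℕ} {H : Euc N → ℝ} {Ω : Set (Euc N)} {p : ℝ} {U : Euc N → ℝ}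

lemma volume_real_ball (x : Euc N) {r : ℝ} (hr : 0 < r) :
    volume.real (Metric.ball x r) = r ^ N * volume.real (Metric.ball (0 : Euc N) 1) := by
  rw [measureReal_def, Measure.addHaar_ball_of_pos volume x hr, ENNReal.toReal_mul,
    finrank_euclideanSpace_fin, ENNReal.toReal_ofReal (by positivity), measureReal_def]

lemma volume_real_unitBall_pos : 0 < volume.real (Metric.ball (0 : Euc N) 1) :=
  ENNReal.toReal_pos (Metric.measure_ball_pos volume 0 one_pos).ne' measure_ball_lt_top.ne

lemma add_pow_le_two_pow_mul {a b : ℝ} (ha : 0 ≤ a) (hb : 0 ≤ b) (n : ℕ) :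
    (a + b) ^ n ≤ 2 ^ n * (a ^ n + b ^ n) := by
  have h := max_le_add_of_nonneg (pow_nonneg ha n) (pow_nonneg hb n)
  calc (a + b) ^ n ≤ (2 * max a b) ^ n := by
        gcongr
        linarith [le_max_left a b, le_max_right a b]
    _ = 2 ^ n * max a b ^ n := mul_pow _ _ _
    _ ≤ 2 ^ n * (a ^ n + b ^ n) := by
        gcongr
        rcases max_choice a b with h | h <;> rw [h]
        · linarith [pow_nonneg hb n]
        · linarith [pow_nonneg ha n]

lemma BddLip.clip {f : Euc N → ℝ} (hf : BddLip f) : BddLip fun x => clip (f x) := by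
  obtain ⟨⟨C, hC⟩, -⟩ := hf
  refine ⟨⟨_, lipschitzWith_clip.comp hC⟩, 1, fun x => ?_⟩
  rw [abs_of_nonneg (clip_nonneg _)]
  exact clip_le_one _

/-- Cutting off an admissible function along level sets of the solution, on a logarithmic scale,
increases its energy by at most a constant factor. -/
lemma IsExtSolution.log_cutoff (hN : 2 ≤ N) (hH : IsFinslerNorm N H)
    (hreg : FinslerRegular N H) (hb : Bornology.IsBounded Ω)
    (hU : IsExtSolution N H Ω p U) {t δ : ℝ} (hδ : 0 < δ) :
    (BddLip fun x => FinslerLaneEmden.clip ((Real.log t - Real.log (U x + δ)) / Real.log 2)) ∧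
      ∀ w, Adm Ω w → energy N H
        (fun x => w x * FinslerLaneEmden.clip ((Real.log t - Real.log (U x + δ)) / Real.log 2)) ≤
          2 ^ N * ((2 * N / Real.log 2) ^ N + 1) * energy N H w := by
  have hlog : 0 < Real.log 2 := Real.log_pos (by norm_num)
  have hpos : ∀ x, 0 < U x + δ := fun x => by have := hU.adm.nonneg x; positivity
  set ψ : Euc N → ℝ := fun x => (Real.log t - Real.log (U x + δ)) / Real.log 2 with hψ
  have hψB : BddLip ψ := by
    obtain ⟨M, -, hM⟩ := hU.adm.exists_bound
    refine hU.adm.bddLip.comp (g := fun u => (Real.log t - Real.log (u + δ)) / Real.log 2)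
      hU.adm.nonneg hM fun u hu => ?_
    have h1 : ContDiffAt ℝ 1 (fun u => Real.log (u + δ)) u :=
      (contDiffAt_id.add contDiffAt_const).log (by simp only [id]; positivity)
    exact (contDiffAt_const.sub h1).div_const _
  have hχB := hψB.clip
  refine ⟨hχB, fun w hw => ?_⟩
  set χ : Euc N → ℝ := fun x => FinslerLaneEmden.clip (ψ x) with hχ
  have hg : Adm Ω fun x => w x * χ x := hw.mul_of_nonneg hχB fun x => clip_nonneg _
  have hV : BddLip fun x => (U x + δ)⁻¹ := by
    obtain ⟨M, -, hM⟩ := hU.adm.exists_bound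
    refine hU.adm.bddLip.comp (g := fun t => (t + δ)⁻¹) hU.adm.nonneg hM fun t ht => ?_
    exact (contDiffAt_id.add contDiffAt_const).inv (by simp only [id]; positivity)
  obtain ⟨M, hM⟩ := ((hw.bddLip.mul hV).pow N).2
  have hi1 : Integrable fun x => (w x * (U x + δ)⁻¹) ^ N * H (gradient U x) ^ N :=
    hU.adm.integrable_weight_mul hN hH hb ((hw.bddLip.mul hV).pow N).continuous.measurable hM
  have hi2 := hw.integrable_energy hN hH hb
  have hhardy := hU.hardy hN hH hreg hb hw hδ
  have hle : energy N H (fun x => w x * χ x) ≤ ∫ x, 2 ^ N * ((Real.log 2)⁻¹ ^ N *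
      ((w x * (U x + δ)⁻¹) ^ N * H (gradient U x) ^ N) + H (gradient w x) ^ N) := by
    refine integral_mono_ae (hg.integrable_energy hN hH hb)
      (((hi1.const_mul _).add hi2).const_mul _) ?_
    filter_upwards [hU.adm.bddLip.ae_differentiableAt, hw.bddLip.ae_differentiableAt,
      hχB.ae_differentiableAt] with x hx hwx hχx
    have hw0 := hw.nonneg x
    have hp0 := hpos x
    have hU0 := norm_nonneg' hH (gradient U x)
    have hder : HasDerivAt (fun u => (Real.log t - Real.log (u + δ)) / Real.log 2)
        (-((U x + δ)⁻¹ / Real.log 2)) (U x) := by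
      have h1 : HasDerivAt (fun u => u + δ) 1 (U x) := (hasDerivAt_id (U x)).add_const δ
      refine (((h1.log hp0.ne').const_sub (Real.log t)).div_const _).congr_deriv ?_
      rw [one_div, neg_div]
    have hχH : H (gradient χ x) ≤ (U x + δ)⁻¹ / Real.log 2 * H (gradient U x) := by
      rw [hχ, gradient_clip hψB.continuous.continuousAt]
      split_ifs
      · rw [gradient_comp hx hder, norm_smul' hH, abs_neg, abs_of_nonneg (by positivity)]
      · rw [norm_zero' hH]
        positivity
    have hgrad : H (gradient (fun x => w x * χ x) x) ≤
        (Real.log 2)⁻¹ * (w x * (U x + δ)⁻¹ * H (gradient U x)) + H (gradient w x) := by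
      rw [gradient_mul hwx hχx]
      refine (norm_add_le' hH _ _).trans ?_
      rw [norm_smul' hH, norm_smul' hH, abs_of_nonneg hw0, abs_of_nonneg (clip_nonneg _)]
      refine add_le_add ?_ (mul_le_of_le_one_left (norm_nonneg' hH _) (clip_le_one _))
      calc w x * H (gradient χ x) ≤ w x * ((U x + δ)⁻¹ / Real.log 2 * H (gradient U x)) := by gcongr
        _ = _ := by ring
    have h0 := norm_nonneg' hH (gradient w x)
    have h1 := norm_nonneg' hH (gradient (fun x => w x * χ x) x)
    refine (pow_le_pow_left₀ h1 hgrad N).trans ?_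
    refine (add_pow_le_two_pow_mul (by positivity) h0 N).trans (le_of_eq ?_)
    rw [mul_pow (Real.log 2)⁻¹, mul_pow (w x * (U x + δ)⁻¹)]
  rw [integral_const_mul, integral_add (hi1.const_mul _) hi2, integral_const_mul] at hle
  refine hle.trans ?_
  rw [mul_assoc]
  gcongr
  rw [add_mul, one_mul, div_pow, div_eq_mul_inv, inv_pow]
  refine add_le_add ?_ le_rfl
  calc _ ≤ (Real.log 2 ^ N)⁻¹ * ((2 * N) ^ N * energy N H w) := by gcongr
    _ = _ := by ring

lemma exists_level_volume_ge {U : Euc N → ℝ} (x₀ : Euc N) (r : ℝ) {c : ℝ}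
    (h : c < volume.real ({x | 0 < U x} ∩ Metric.ball x₀ r)) :
    ∃ t, 0 < t ∧ c ≤ volume.real ({x | t ≤ U x} ∩ Metric.ball x₀ r) := by
  have hun : {x | 0 < U x} ∩ Metric.ball x₀ r =
      ⋃ n : ℕ, {x | 1 / ((n : ℝ) + 1) ≤ U x} ∩ Metric.ball x₀ r := by
    ext x
    simp only [mem_inter_iff, mem_ofPred_eq, mem_iUnion]
    constructor
    · rintro ⟨h1, h2⟩
      obtain ⟨n, hn⟩ := exists_nat_one_div_lt h1
      exact ⟨n, hn.le, h2⟩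
    · rintro ⟨n, h1, h2⟩
      exact ⟨lt_of_lt_of_le (by positivity) h1, h2⟩
  have hmono : Monotone fun n : ℕ => {x | 1 / ((n : ℝ) + 1) ≤ U x} ∩ Metric.ball x₀ r := by
    intro m n hmn x hx
    have h1 : 1 / ((n : ℝ) + 1) ≤ 1 / ((m : ℝ) + 1) := by gcongr
    exact ⟨h1.trans hx.1, hx.2⟩
  have hlim := tendsto_measure_iUnion_atTop (μ := volume) hmono
  rw [← hun] at hlim
  have hfin : volume ({x | 0 < U x} ∩ Metric.ball x₀ r) ≠ ⊤ :=
    measure_ne_top_of_subset inter_subset_right measure_ball_lt_top.ne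
  have hlim' := (ENNReal.tendsto_toReal hfin).comp hlim
  obtain ⟨n, hn⟩ := (hlim'.eventually (Ioi_mem_nhds h)).exists
  exact ⟨1 / ((n : ℝ) + 1), by positivity, le_of_lt hn⟩

/-- Around a zero of the solution there are arbitrarily small scales at which admissible functions
of small energy cannot be equal to one on most of the ball. -/
lemma IsExtSolution.exists_thin_ball (hN : 2 ≤ N) (hH : IsFinslerNorm N H)
    (hreg : FinslerRegular N H) (hb : Bornology.IsBounded Ω)
    (hU : IsExtSolution N H Ω p U) {x₀ : Euc N} (hx₀ : U x₀ = 0) :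
    ∃ ε, 0 < ε ∧ ∀ r₀, 0 < r₀ → ∃ s, 0 < s ∧ s < r₀ ∧ ∀ w, Adm Ω w → (∀ x, w x ≤ 1) →
      energy N H w ≤ ε → volume.real ({x | w x = 1} ∩ Metric.ball x₀ s) ≤
        3 / 4 * volume.real (Metric.ball x₀ s) := by
  obtain ⟨a, ha0, haH⟩ := exists_le_norm hN hH
  obtain ⟨L, hL⟩ := hU.adm.bddLip.1
  set ω := volume.real (Metric.ball (0 : Euc N) 1) with hω
  have hω0 : 0 < ω := volume_real_unitBall_pos
  set C' : ℝ := 2 ^ N * ((2 * N / Real.log 2) ^ N + 1) with hC'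
  have hlog : 0 < Real.log 2 := Real.log_pos (by norm_num)
  have hC'0 : 0 < C' := by positivity
  have hfin : ∀ (A : Set (Euc N)) (r : ℝ), volume (A ∩ Metric.ball x₀ r) ≠ ⊤ := fun A r =>
    measure_ne_top_of_subset inter_subset_right measure_ball_lt_top.ne
  refine ⟨ω * (a / 32) ^ N / (8 * C'), by positivity, fun r₀ hr₀ => ?_⟩
  rcases le_or_gt (volume.real ({x | 0 < U x} ∩ Metric.ball x₀ (r₀ / 2)))
    (1 / 2 * volume.real (Metric.ball x₀ (r₀ / 2))) with hc | hc
  · refine ⟨r₀ / 2, by positivity, by linarith, fun w hw _ _ => ?_⟩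
    have hsub : {x | w x = 1} ∩ Metric.ball x₀ (r₀ / 2) ⊆
        {x | 0 < U x} ∩ Metric.ball x₀ (r₀ / 2) := by
      rintro x ⟨h1, h2⟩
      refine ⟨hU.pos x (by_contra fun h => ?_), h2⟩
      rw [mem_ofPred_eq, hw.eq_zero h] at h1
      exact zero_ne_one h1
    have h1 := measureReal_mono hsub (hfin _ _)
    have h2 : 0 ≤ volume.real (Metric.ball x₀ (r₀ / 2)) := measureReal_nonneg
    linarith
  obtain ⟨t₀, ht₀, hvol₀⟩ := exists_level_volume_ge x₀ (r₀ / 2) hc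
  set P : ℕ → Prop := fun i => 1 / 2 * volume.real (Metric.ball x₀ (r₀ / 2 / 8 ^ i)) ≤
    volume.real ({x | t₀ / 4 ^ i ≤ U x} ∩ Metric.ball x₀ (r₀ / 2 / 8 ^ i)) with hP
  have hP0 : P 0 := by simpa [hP] using hvol₀
  obtain ⟨i, hi, hi'⟩ : ∃ i, P i ∧ ¬ P (i + 1) := by
    by_contra! hall
    have hPall : ∀ i, P i := fun i => Nat.rec hP0 (fun i hi => hall i hi) i
    obtain ⟨i, hi⟩ := pow_unbounded_of_one_lt (L * (r₀ / 2) / t₀) (one_lt_two (α := ℝ))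
    have hempty : {x | t₀ / 4 ^ i ≤ U x} ∩ Metric.ball x₀ (r₀ / 2 / 8 ^ i) = ∅ := by
      refine eq_empty_of_forall_notMem fun x hx => ?_
      have h1 : t₀ / 4 ^ i ≤ U x := hx.1
      have h2 : dist x x₀ < r₀ / 2 / 8 ^ i := hx.2
      have h3 : U x ≤ L * dist x x₀ := by
        have := hL.dist_le_mul x x₀
        rw [hx₀, Real.dist_eq, sub_zero] at this
        exact (le_abs_self _).trans this
      have h4 : t₀ / 4 ^ i ≤ L * (r₀ / 2 / 8 ^ i) := h1.trans (h3.trans (by gcongr))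
      rw [div_lt_iff₀ ht₀] at hi
      have h5 : (8 : ℝ) ^ i = 4 ^ i * 2 ^ i := by rw [← mul_pow]; norm_num
      rw [h5, div_le_iff₀ (by positivity)] at h4
      have h6 : L * (r₀ / 2 / (4 ^ i * 2 ^ i)) * 4 ^ i = L * (r₀ / 2) / 2 ^ i := by field_simp
      rw [h6, le_div_iff₀ (by positivity)] at h4
      linarith
    have h := hPall i
    simp only [hP, hempty, measureReal_empty] at h
    rw [volume_real_ball _ (by positivity)] at h
    have : 0 < (r₀ / 2 / 8 ^ i) ^ N * ω := by positivity
    linarith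
  set r := r₀ / 2 / 8 ^ i with hr
  set t := t₀ / 4 ^ i with ht
  have hr0 : 0 < r := by positivity
  have ht0 : 0 < t := by positivity
  have hrle : r ≤ r₀ / 2 := div_le_self (by positivity) (one_le_pow₀ (by norm_num))
  simp only [hP, pow_succ, ← div_div, not_le] at hi hi'
  rw [← hr, ← ht] at hi hi'
  refine ⟨r / 8, by positivity, by linarith, fun w hw hw1 hwE => ?_⟩
  by_contra! hlt
  set s := r / 8 with hs
  obtain ⟨hχB, hcut⟩ := hU.log_cutoff hN hH hreg hb (t := t) (δ := t / 4) (by positivity)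
  specialize hcut w hw
  set χ : Euc N → ℝ := fun x =>
    FinslerLaneEmden.clip ((Real.log t - Real.log (U x + t / 4)) / Real.log 2) with hχ
  have hg : Adm Ω fun x => w x * χ x := hw.mul_of_nonneg hχB fun x => clip_nonneg _
  set g : Euc N → ℝ := fun x => w x * χ x with hgdef
  have hgZ : ∀ y ∈ {x | t ≤ U x} ∩ Metric.ball x₀ r, g y = 0 := by
    rintro y ⟨hy, -⟩
    have : χ y = 0 := clip_of_nonpos (div_nonpos_of_nonpos_of_nonneg
      (sub_nonpos.2 (Real.log_le_log ht0 (by linarith [mem_ofPred_eq ▸ hy]))) hlog.le)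
    simp only [hgdef, this, mul_zero]
  have hpoin := poincare_of_vanishing hg.bddLip hr0.le inter_subset_right hgZ
  set Y := ({x | w x = 1} ∩ Metric.ball x₀ s) \ ({x | t / 4 ≤ U x} ∩ Metric.ball x₀ s) with hY
  have hYm : MeasurableSet Y :=
    ((measurableSet_eq_fun hw.continuous.measurable measurable_const).inter
      measurableSet_ball).diff ((measurableSet_le measurable_const
        hU.adm.continuous.measurable).inter measurableSet_ball)
  have hYsub : Y ⊆ Metric.ball x₀ r := fun x hx =>
    Metric.ball_subset_ball (by linarith) hx.1.2
  have hYvol : 1 / 4 * volume.real (Metric.ball x₀ s) < volume.real Y := by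
    have := le_measureReal_sdiff (μ := volume) (s₁ := {x | w x = 1} ∩ Metric.ball x₀ s)
      (s₂ := {x | t / 4 ≤ U x} ∩ Metric.ball x₀ s) (hfin _ _)
    linarith
  have hgY : ∀ y ∈ Y, g y = 1 := by
    rintro y ⟨⟨hy1, hy2⟩, hy3⟩
    have hlt' : U y < t / 4 := not_le.1 fun h => hy3 ⟨h, hy2⟩
    have hy0 := hU.adm.nonneg y
    have : χ y = 1 := by
      refine clip_of_one_le ((one_le_div hlog).2 ?_)
      have h1 : Real.log (U y + t / 4) ≤ Real.log (t / 2) :=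
        Real.log_le_log (by positivity) (by linarith)
      rw [Real.log_div ht0.ne' two_ne_zero] at h1
      linarith
    simp only [hgdef, this, mul_one]
    exact hy1
  have hgi : IntegrableOn (fun x => |g x| ^ N) (Metric.ball x₀ r) :=
    ((hg.continuous.abs.pow N).continuousOn.integrableOn_compact
      (isCompact_closedBall x₀ r)).mono_set Metric.ball_subset_closedBall
  have hlow : volume.real Y ≤ ∫ x in Metric.ball x₀ r, |g x| ^ N := by
    calc volume.real Y = ∫ x in Y, |g x| ^ N := by
          rw [setIntegral_congr_fun hYm (g := fun _ => (1 : ℝ)) fun x hx => by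
            simp only [hgY x hx, abs_one, one_pow]]
          simp
      _ ≤ _ := setIntegral_mono_set hgi (Eventually.of_forall fun x => by positivity)
          hYsub.eventuallyLE
  have hup : a ^ N * ∫ x in Metric.ball x₀ r, ‖gradient g x‖ ^ N ≤ energy N H g := by
    rw [← integral_const_mul]
    have hi := hg.integrable_energy hN hH hb
    refine le_trans ?_ (setIntegral_le_integral (s := Metric.ball x₀ r) hi
      (Eventually.of_forall fun x => pow_nonneg (norm_nonneg' hH _) _))
    refine integral_mono_of_nonneg (Eventually.of_forall fun x => by positivity)
      hi.integrableOn (Eventually.of_forall fun x => ?_)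
    beta_reduce
    rw [← mul_pow]
    exact pow_le_pow_left₀ (by positivity) (haH _) N
  set I₁ := ∫ x in Metric.ball x₀ r, |g x| ^ N
  set I₂ := ∫ x in Metric.ball x₀ r, ‖gradient g x‖ ^ N
  have hI₁ : 0 ≤ I₁ := measureReal_nonneg.trans hlow
  rw [volume_real_ball _ hr0] at hpoin hi
  rw [volume_real_ball _ (by positivity : 0 < s)] at hYvol
  have h1 : I₁ ≤ 2 * (4 * r) ^ N * I₂ := by
    have h2 := (mul_le_mul_of_nonneg_right hi hI₁).trans hpoin
    have h3 : 0 < r ^ N * ω := by positivity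
    refine le_of_mul_le_mul_left ?_ h3
    linarith
  have h2 : a ^ N * I₂ ≤ ω * (a / 32) ^ N / 8 := by
    calc a ^ N * I₂ ≤ C' * energy N H w := hup.trans hcut
      _ ≤ C' * (ω * (a / 32) ^ N / (8 * C')) := by gcongr
      _ = _ := by field_simp
  have h3 : 1 / 4 * (s ^ N * ω) * a ^ N < 2 * (4 * r) ^ N * (ω * (a / 32) ^ N / 8) := by
    calc 1 / 4 * (s ^ N * ω) * a ^ N < 2 * (4 * r) ^ N * I₂ * a ^ N :=
          mul_lt_mul_of_pos_right (hYvol.trans_le (hlow.trans h1)) (by positivity)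
      _ = 2 * (4 * r) ^ N * (a ^ N * I₂) := by ring
      _ ≤ _ := by gcongr
  refine h3.ne ?_
  have h4 : s ^ N * a ^ N = (4 * r) ^ N * (a / 32) ^ N := by
    rw [← mul_pow, ← mul_pow, hs]
    congr 1
    ring
  linear_combination (1 / 4 * ω) * h4

end ThinBall

section Cutoff

variable {N : ℕ} {H : Euc N → ℝ} {Ω : Set (Euc N)} {p : ℝ} {U : Euc N → ℝ}

/-- The radial cutoff equal to `1` on `B_{s/2}(x₀)` and to `0` off `B_s(x₀)`. -/
def cutoff (x₀ : Euc N) (s : ℝ) (x : Euc N) : ℝ := clip (2 - 2 / s * dist x x₀)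

lemma cutoff_nonneg (x₀ : Euc N) (s : ℝ) (x : Euc N) : 0 ≤ cutoff x₀ s x := clip_nonneg _

lemma cutoff_le_one (x₀ : Euc N) (s : ℝ) (x : Euc N) : cutoff x₀ s x ≤ 1 := clip_le_one _

lemma cutoff_eq_one {x₀ : Euc N} {s : ℝ} (hs : 0 < s) {x : Euc N} (hx : dist x x₀ ≤ s / 2) :
    cutoff x₀ s x = 1 := by
  refine clip_of_one_le ?_
  have : 2 / s * dist x x₀ ≤ 2 / s * (s / 2) := by gcongr
  rw [show 2 / s * (s / 2) = 1 by field_simp] at this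
  linarith

lemma cutoff_eq_zero {x₀ : Euc N} {s : ℝ} (hs : 0 < s) {x : Euc N} (hx : s ≤ dist x x₀) :
    cutoff x₀ s x = 0 := by
  refine clip_of_nonpos ?_
  have : 2 / s * s ≤ 2 / s * dist x x₀ := by gcongr
  rw [show 2 / s * s = 2 by field_simp] at this
  linarith

lemma lipschitzWith_cutoff (x₀ : Euc N) {s : ℝ} (hs : 0 < s) :
    LipschitzWith (2 / s).toNNReal (cutoff x₀ s) := by
  refine LipschitzWith.of_dist_le_mul fun x y => ?_
  rw [Real.coe_toNNReal _ (by positivity)]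
  refine (lipschitzWith_clip.dist_le_mul _ _).trans ?_
  rw [NNReal.coe_one, one_mul, Real.dist_eq, show 2 - 2 / s * dist x x₀ - (2 - 2 / s * dist y x₀) =
    2 / s * (dist y x₀ - dist x x₀) by ring, abs_mul, abs_of_pos (by positivity : 0 < 2 / s)]
  gcongr
  rw [dist_comm x y]
  exact abs_dist_sub_le y x x₀

lemma bddLip_cutoff (x₀ : Euc N) {s : ℝ} (hs : 0 < s) : BddLip (cutoff x₀ s) :=
  ⟨⟨_, lipschitzWith_cutoff x₀ hs⟩, 1, fun x => by
    rw [abs_of_nonneg (cutoff_nonneg x₀ s x)]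
    exact cutoff_le_one x₀ s x⟩

lemma norm_gradient_cutoff_le (x₀ : Euc N) {s : ℝ} (hs : 0 < s) (x : Euc N) :
    ‖gradient (cutoff x₀ s) x‖ ≤ 2 / s :=
  (norm_gradient_le (lipschitzWith_cutoff x₀ hs) x).trans_eq
    (Real.coe_toNNReal _ (by positivity))

lemma Adm.mul_cutoff {f : Euc N → ℝ} (hf : Adm Ω f) (x₀ : Euc N) {s : ℝ} (hs : 0 < s) :
    Adm Ω (fun x => f x * cutoff x₀ s x) :=
  hf.mul_of_nonneg (bddLip_cutoff x₀ hs) (cutoff_nonneg x₀ s)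

lemma Adm.mul_cutoff_ball {f : Euc N → ℝ} (hf : Adm Ω f) (x₀ : Euc N) {s : ℝ} (hs : 0 < s) :
    Adm (Metric.ball x₀ s) (fun x => f x * cutoff x₀ s x) :=
  ⟨(hf.mul_cutoff x₀ hs).bddLip, (hf.mul_cutoff x₀ hs).nonneg, fun x hx => by
    simp only [cutoff_eq_zero hs (x := x) (by simpa using hx), mul_zero]⟩

lemma integrable_indicator_ball {f : Euc N → ℝ} (hf : Continuous f) (x₀ : Euc N) (s : ℝ) :
    Integrable ((Metric.ball x₀ s).indicator f) := by
  rw [integrable_indicator_iff Metric.isOpen_ball.measurableSet]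
  exact (hf.continuousOn.integrableOn_compact (isCompact_closedBall x₀ s)).mono_set
    Metric.ball_subset_closedBall

lemma Adm.energy_mul_cutoff_le (hN : 2 ≤ N) (hH : IsFinslerNorm N H) (hb : Bornology.IsBounded Ω)
    {f : Euc N → ℝ} (hf : Adm Ω f) {b : ℝ} (hb0 : 0 < b) (hbH : ∀ x, H x ≤ b * ‖x‖)
    (x₀ : Euc N) {s : ℝ} (hs : 0 < s) :
    energy N H (fun x => f x * cutoff x₀ s x) ≤
      2 ^ N * (energy N H f + (2 * b / s) ^ N * ∫ x in Metric.ball x₀ s, f x ^ N) := by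
  have hi1 := hf.integrable_energy hN hH hb
  have hi2 : Integrable ((Metric.ball x₀ s).indicator fun x => f x ^ N) :=
    integrable_indicator_ball (hf.continuous.pow N) x₀ s
  have hle : energy N H (fun x => f x * cutoff x₀ s x) ≤ ∫ x, 2 ^ N * (H (gradient f x) ^ N +
      (2 * b / s) ^ N * (Metric.ball x₀ s).indicator (fun x => f x ^ N) x) := by
    refine integral_mono_ae ((hf.mul_cutoff x₀ hs).integrable_energy hN hH hb)
      ((hi1.add (hi2.const_mul _)).const_mul _) ?_
    filter_upwards [hf.bddLip.ae_differentiableAt, (bddLip_cutoff x₀ hs).ae_differentiableAt]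
      with x hx hcx
    have hf0 := hf.nonneg x
    have hc0 := cutoff_nonneg x₀ s x
    have hc1 := cutoff_le_one x₀ s x
    have hHf := norm_nonneg' hH (gradient f x)
    by_cases hxs : dist x x₀ < s
    · rw [indicator_of_mem (by simpa using hxs), gradient_mul hx hcx, ← mul_pow]
      have h1 : H (f x • gradient (cutoff x₀ s) x + cutoff x₀ s x • gradient f x) ≤
          H (gradient f x) + 2 * b / s * f x := by
        refine (norm_add_le' hH _ _).trans ?_
        rw [norm_smul' hH, norm_smul' hH, abs_of_nonneg hf0, abs_of_nonneg hc0]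
        have h2 : H (gradient (cutoff x₀ s) x) ≤ b * (2 / s) :=
          (hbH _).trans (by gcongr; exact norm_gradient_cutoff_le x₀ hs x)
        have h3 : f x * H (gradient (cutoff x₀ s) x) ≤ f x * (b * (2 / s)) := by gcongr
        have h4 : cutoff x₀ s x * H (gradient f x) ≤ 1 * H (gradient f x) := by gcongr
        calc _ ≤ f x * (b * (2 / s)) + 1 * H (gradient f x) := add_le_add h3 h4
          _ = _ := by ring
      have h0 := norm_nonneg' hH (f x • gradient (cutoff x₀ s) x + cutoff x₀ s x • gradient f x)
      exact (pow_le_pow_left₀ h0 h1 N).trans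
        (add_pow_le_two_pow_mul hHf (by positivity) N)
    · have h0 : (fun x => f x * cutoff x₀ s x) x = 0 := by
        simp [cutoff_eq_zero hs (not_lt.1 hxs)]
      rw [(hf.mul_cutoff x₀ hs).gradient_eq_zero h0, norm_zero' hH,
        indicator_of_notMem (by simpa using hxs), zero_pow (by omega)]
      positivity
  rw [integral_const_mul, integral_add hi1 (hi2.const_mul _), integral_const_mul,
    integral_indicator Metric.isOpen_ball.measurableSet] at hle
  exact hle

/-- Poincaré's inequality on a ball in which every capacitary potential of small energy misses the
value `1` on a quarter of the volume. -/
lemma integral_pow_le_of_thin (hN : 2 ≤ N) (hH : IsFinslerNorm N H) (hb : Bornology.IsBounded Ω)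
    {a : ℝ} (ha : 0 < a) (haH : ∀ x, a * ‖x‖ ≤ H x) {ε : ℝ} (hε : 0 < ε) {x₀ : Euc N} {s : ℝ}
    (hs : 0 < s)
    (hthin : ∀ w, Adm Ω w → (∀ x, w x ≤ 1) → energy N H w ≤ ε →
      volume.real ({x | w x = 1} ∩ Metric.ball x₀ s) ≤ 3 / 4 * volume.real (Metric.ball x₀ s))
    {f : Euc N → ℝ} (hf : Adm Ω f) (hE : energy N H f ≤ 2) :
    ∫ x in Metric.ball x₀ s, f x ^ N ≤ 2 ^ N * (8 * (4 / a) ^ N +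
      (1 + 2 / ε) ^ N * volume.real (Metric.ball (0 : Euc N) 1)) * s ^ N := by
  set c := 1 + 2 / ε with hc
  have hc1 : 1 ≤ c := by 
    have : 0 < 2 / ε := by positivity
    linarith
  have hc0 : 0 < c := by linarith
  set B := Metric.ball x₀ s with hB
  have hBm : MeasurableSet B := Metric.isOpen_ball.measurableSet
  have hBvol : volume.real B = s ^ N * volume.real (Metric.ball (0 : Euc N) 1) :=
    volume_real_ball x₀ hs
  have hBpos : 0 < volume.real B := by
    rw [hBvol]
    have := volume_real_unitBall_pos (N := N)
    positivity
  have hBfin : volume B ≠ ⊤ := Metric.isBounded_ball.measure_lt_top.ne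
  have hcf : BddLip fun x => c⁻¹ * f x := (BddLip.const c⁻¹).mul hf.bddLip
  have hw : Adm Ω fun x => clip (c⁻¹ * f x) :=
    ⟨hcf.clip, fun x => clip_nonneg _, fun x hx => by
      simp only [hf.eq_zero hx, mul_zero]
      exact clip_of_nonpos le_rfl⟩
  have hwE : energy N H (fun x => clip (c⁻¹ * f x)) ≤ ε := by
    have h1 : energy N H (fun x => clip (c⁻¹ * f x)) ≤
        ∫ x, c⁻¹ ^ N * H (gradient f x) ^ N := by
      refine integral_mono_ae (hw.integrable_energy hN hH hb)
        ((hf.integrable_energy hN hH hb).const_mul _) ?_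
      filter_upwards [hf.bddLip.ae_differentiableAt] with x hx
      rw [← mul_pow]
      refine pow_le_pow_left₀ (norm_nonneg' hH _) ?_ N
      rw [gradient_clip hcf.continuous.continuousAt]
      have h0 := norm_nonneg' hH (gradient f x)
      split_ifs
      · rw [gradient_const_mul hx, norm_smul' hH, abs_of_pos (inv_pos.2 hc0)]
      · rw [norm_zero' hH]
        positivity
    rw [integral_const_mul] at h1
    have h2 : c ≤ c ^ N := le_self_pow₀ hc1 (by omega)
    have h3 : 2 / ε ≤ c ^ N := by linarith
    calc _ ≤ c⁻¹ ^ N * energy N H f := h1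
      _ ≤ c⁻¹ ^ N * 2 := by gcongr
      _ = 2 / c ^ N := by rw [inv_pow]; ring
      _ ≤ ε := by
        rw [div_le_iff₀ (by positivity)]
        rwa [div_le_iff₀ hε, mul_comm] at h3
  have hvol := hthin _ hw (fun x => clip_le_one _) hwE
  set W := {x | clip (c⁻¹ * f x) = 1} with hW
  have hWm : MeasurableSet W :=
    (isClosed_eq hcf.clip.continuous continuous_const).measurableSet
  have hZ : 1 / 4 * volume.real B ≤ volume.real (B \ W) := by
    have h := measureReal_inter_add_sdiff (μ := volume) (s := B) hWm hBfin
    rw [inter_comm] at h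
    linarith
  set g : Euc N → ℝ := fun x => max (f x - c) 0 with hg
  have hgB : BddLip g := by
    obtain ⟨⟨L, hL⟩, M, hM⟩ := hf.bddLip
    refine ⟨⟨L, ?_⟩, M, fun x => ?_⟩
    · refine LipschitzWith.of_dist_le_mul fun x y => (?_ : _ ≤ dist (f x) (f y)).trans
        (hL.dist_le_mul x y)
      rw [Real.dist_eq, Real.dist_eq]
      refine (abs_max_sub_max_le_abs _ _ _).trans_eq ?_
      congr 1
      ring
    · have := hf.nonneg x
      have h2 := (abs_le.1 (hM x)).2
      rw [abs_of_nonneg (le_max_right _ _)]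
      exact max_le (by linarith) (by linarith)
  have hpoin := poincare_of_vanishing hgB hs.le (Z := B \ W) sdiff_subset fun y hy => by
    refine max_eq_right ?_
    by_contra! h
    refine hy.2 (clip_of_one_le ?_)
    rw [le_inv_mul_iff₀ hc0]
    linarith
  have hgrad : ∫ x in B, ‖gradient g x‖ ^ N ≤ 2 / a ^ N := by
    have h1 : ∀ x, ‖gradient g x‖ ^ N ≤ (a ^ N)⁻¹ * H (gradient f x) ^ N := fun x => by
      rw [le_inv_mul_iff₀ (by positivity), ← mul_pow]
      refine pow_le_pow_left₀ (by positivity) ?_ N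
      rw [hg, gradient_max_sub hf.continuous]
      split_ifs
      · exact haH _
      · simpa using norm_nonneg' hH _
    have hi := (hf.integrable_energy hN hH hb).const_mul (a ^ N)⁻¹
    calc ∫ x in B, ‖gradient g x‖ ^ N ≤ ∫ x in B, (a ^ N)⁻¹ * H (gradient f x) ^ N :=
          integral_mono_of_nonneg (.of_forall fun x => by positivity) hi.integrableOn
            (.of_forall h1)
      _ ≤ ∫ x, (a ^ N)⁻¹ * H (gradient f x) ^ N :=
          setIntegral_le_integral hi (.of_forall fun x =>
            (pow_nonneg (norm_nonneg _) N).trans (h1 x))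
      _ = (a ^ N)⁻¹ * energy N H f := integral_const_mul _ _
      _ ≤ (a ^ N)⁻¹ * 2 := by gcongr
      _ = _ := by ring
  have hgi : IntegrableOn (fun x => |g x| ^ N) B :=
    ((hgB.continuous.abs.pow N).continuousOn.integrableOn_compact
      (isCompact_closedBall x₀ s)).mono_set Metric.ball_subset_closedBall
  have hfi : IntegrableOn (fun x => f x ^ N) B :=
    ((hf.continuous.pow N).continuousOn.integrableOn_compact
      (isCompact_closedBall x₀ s)).mono_set Metric.ball_subset_closedBall
  have hgint0 : 0 ≤ ∫ x in B, |g x| ^ N := integral_nonneg fun x => by positivity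
  have hgint : ∫ x in B, |g x| ^ N ≤ 8 * (4 / a) ^ N * s ^ N := by
    have h1 : 1 / 4 * volume.real B * ∫ x in B, |g x| ^ N ≤
        (4 * s) ^ N * volume.real B * (2 / a ^ N) :=
      (mul_le_mul_of_nonneg_right hZ hgint0).trans (hpoin.trans (by gcongr))
    have h2 : volume.real B * ∫ x in B, |g x| ^ N ≤
        volume.real B * (8 * (4 / a) ^ N * s ^ N) := by
      rw [div_pow]
      rw [mul_pow] at h1
      calc _ = 4 * (1 / 4 * volume.real B * ∫ x in B, |g x| ^ N) := by ring
        _ ≤ 4 * (4 ^ N * s ^ N * volume.real B * (2 / a ^ N)) := by gcongr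
        _ = _ := by ring
    exact le_of_mul_le_mul_left h2 hBpos
  calc ∫ x in B, f x ^ N ≤ ∫ x in B, 2 ^ N * (|g x| ^ N + c ^ N) := by
        refine setIntegral_mono hfi
          ((hgi.add (integrableOn_const hBfin)).const_mul _) fun x => ?_
        refine le_trans (pow_le_pow_left₀ (hf.nonneg x) ?_ N)
          (add_pow_le_two_pow_mul (abs_nonneg _) hc0.le N)
        have := le_max_left (f x - c) 0
        have := le_abs_self (g x)
        linarith
    _ = 2 ^ N * ((∫ x in B, |g x| ^ N) + c ^ N * volume.real B) := by
        rw [integral_const_mul, integral_add hgi (integrableOn_const hBfin), setIntegral_const,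
          smul_eq_mul, mul_comm (volume.real B)]
    _ ≤ 2 ^ N * (8 * (4 / a) ^ N * s ^ N + c ^ N * volume.real B) := by gcongr
    _ = _ := by
        rw [hBvol]
        ring

end Cutoff

section Local

variable {N : ℕ} {H : Euc N → ℝ} {Ω : Set (Euc N)} {p : ℝ} {U : Euc N → ℝ}

/-- Scale-invariant `L^N` bound for `U / k` on half of a ball that is thin for potentials. -/
lemma exists_local_mass_bound (hN : 2 ≤ N) (hH : IsFinslerNorm N H) (hreg : FinslerRegular N H)
    (hΩo : IsOpen Ω) (hΩne : Ω.Nonempty) (hb : Bornology.IsBounded Ω) {q : ℝ}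
    (hq : 4 * (N : ℝ) ≤ q + 1) (hΛ : 0 < energyInf N H Ω q) {ε : ℝ} (hε : 0 < ε) (x₀ : Euc N) :
    ∃ C, 0 < C ∧ ∀ s, 0 < s →
      (∀ w, Adm Ω w → (∀ x, w x ≤ 1) → energy N H w ≤ ε →
        volume.real ({x | w x = 1} ∩ Metric.ball x₀ s) ≤ 3 / 4 * volume.real (Metric.ball x₀ s)) →
      ∀ p U k, 1 < p → IsExtSolution N H Ω p U → 0 < k → k ^ (N - 1) = ∫ x, U x ^ p →
        ∫ x in Metric.ball x₀ (s / 2), U x ^ N ≤ C * s ^ N * k ^ N := by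
  obtain ⟨a, ha, haH⟩ := exists_le_norm hN hH
  obtain ⟨b, hb0, hbH⟩ := exists_norm_le hH
  obtain ⟨y₀, hy₀⟩ := hΩne
  obtain ⟨ρ, hρ, hball⟩ := Metric.isOpen_iff.1 hΩo y₀ hy₀
  have hN2 : (2 : ℝ) ≤ N := by exact_mod_cast hN
  have hq1 : 1 < q := by linarith
  have hω := volume_real_unitBall_pos (N := N)
  set ω := volume.real (Metric.ball (0 : Euc N) 1) with hωdef
  set C₁ : ℝ := 2 ^ N * (8 * (4 / a) ^ N + (1 + 2 / ε) ^ N * ω) with hC₁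
  have hC₁0 : 0 < C₁ := by positivity
  set C₂ : ℝ := 2 ^ N * (2 + (2 * b) ^ N * C₁) with hC₂
  have hC₂0 : 0 < C₂ := by positivity
  set C₃ : ℝ := (C₂ / energyInf N H Ω q) ^ ((q + 1) / N) / ρ ^ N with hC₃
  have hC₃0 : 0 < C₃ := by positivity
  refine ⟨2 ^ (4 * N) * (2 * ω + C₃), by positivity, fun s hs hthin p U k hp hU hk hkI => ?_⟩
  obtain ⟨hβ, hβE⟩ := hU.beta_bound hN hH hreg hb hp hk hkI
  set β : Euc N → ℝ := fun x => (1 + U x / k) ^ (1 / 4 : ℝ) - 1 with hβdef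
  have h1 := integral_pow_le_of_thin hN hH hb ha haH hε hs hthin hβ hβE
  have h2 := hβ.energy_mul_cutoff_le hN hH hb hb0 hbH x₀ hs
  set ψ : Euc N → ℝ := fun x => β x * cutoff x₀ s x with hψ
  have hψA : Adm (Metric.ball x₀ s) ψ := hβ.mul_cutoff_ball x₀ hs
  have hψE : energy N H ψ ≤ C₂ := by
    refine h2.trans ?_
    rw [hC₂]
    have h3 : (2 * b / s) ^ N * ∫ x in Metric.ball x₀ s, β x ^ N ≤ (2 * b / s) ^ N * (C₁ * s ^ N) := by
      gcongr
    have h4 : (2 * b / s) ^ N * (C₁ * s ^ N) = (2 * b) ^ N * C₁ := by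
      rw [div_pow]
      field_simp
    exact mul_le_mul_of_nonneg_left (add_le_add hβE (h3.trans_eq h4)) (by positivity)
  have hS := (energyInf_mul_le_of_ball hN hH hΩo hb hq1 hρ hball hs hψA).trans hψE
  set J := ∫ x, ψ x ^ (q + 1) with hJ
  have hJ0 : 0 ≤ J := integral_nonneg fun x => rpow_nonneg (hψA.nonneg x) _
  have hJle : J ≤ C₃ * s ^ N := by
    have hq0 : 0 < q + 1 := by linarith
    have h5 : ((ρ / s) ^ N * J) ^ ((N : ℝ) / (q + 1)) ≤ C₂ / energyInf N H Ω q := by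
      rwa [le_div_iff₀ hΛ, mul_comm]
    have h6 : (ρ / s) ^ N * J ≤ (C₂ / energyInf N H Ω q) ^ ((q + 1) / N) := by
      calc (ρ / s) ^ N * J =
          (((ρ / s) ^ N * J) ^ ((N : ℝ) / (q + 1))) ^ ((q + 1) / N) := by
            rw [← rpow_mul (by positivity), show (N : ℝ) / (q + 1) * ((q + 1) / N) = 1 by
              field_simp, rpow_one]
        _ ≤ _ := by gcongr
    rw [hC₃, div_mul_eq_mul_div, le_div_iff₀ (by positivity)]
    calc J * ρ ^ N = (ρ / s) ^ N * J * s ^ N := by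
          rw [div_pow]
          field_simp
      _ ≤ _ := by gcongr
  have hpt : ∀ x ∈ Metric.ball x₀ (s / 2),
      U x ^ N ≤ k ^ N * (2 ^ (4 * N) * (2 + ψ x ^ (q + 1))) := fun x hx => by
    have hx' : ψ x = β x := by
      rw [hψ]
      simp only
      rw [cutoff_eq_one hs (Metric.mem_ball.1 hx).le, mul_one]
    rw [hx']
    have hU0 := hU.adm.nonneg x
    have hβ0 := hβ.nonneg x
    have e1 : (1 + β x) ^ 4 = 1 + U x / k := by
      rw [hβdef]
      simp only [add_sub_cancel]
      rw [← rpow_natCast, ← rpow_mul (by positivity)]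
      norm_num
    have e2 : U x ≤ k * (1 + β x) ^ 4 := by
      rw [e1]
      have : k * (1 + U x / k) = k + U x := by field_simp
      linarith
    have e3 : β x ^ (4 * N) ≤ 1 + β x ^ (q + 1) := by
      rcases le_total (β x) 1 with h | h
      · have : β x ^ (4 * N) ≤ 1 := pow_le_one₀ hβ0 h
        have : 0 ≤ β x ^ (q + 1) := by positivity
        linarith
      · have : β x ^ (4 * N) ≤ β x ^ (q + 1) := by
          rw [← rpow_natCast]
          refine rpow_le_rpow_of_exponent_le h ?_
          push_cast
          exact hq
        linarith
    calc U x ^ N ≤ (k * (1 + β x) ^ 4) ^ N := by gcongr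
      _ = k ^ N * (1 + β x) ^ (4 * N) := by rw [mul_pow, pow_mul]
      _ ≤ k ^ N * (2 ^ (4 * N) * (1 ^ (4 * N) + β x ^ (4 * N))) := by
          gcongr
          exact add_pow_le_two_pow_mul zero_le_one hβ0 _
      _ ≤ _ := by
          rw [one_pow]
          refine mul_le_mul_of_nonneg_left (mul_le_mul_of_nonneg_left ?_ (by positivity))
            (by positivity)
          linarith
  have hψi : Integrable fun x => ψ x ^ (q + 1) :=
    hψA.integrable_rpow Metric.isBounded_ball (by linarith)
  have hBfin : volume (Metric.ball x₀ (s / 2)) ≠ ⊤ := Metric.isBounded_ball.measure_lt_top.ne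
  have hc : IntegrableOn (fun _ => (2 : ℝ)) (Metric.ball x₀ (s / 2)) := integrableOn_const hBfin
  have hUi : IntegrableOn (fun x => U x ^ N) (Metric.ball x₀ (s / 2)) :=
    ((hU.adm.continuous.pow N).continuousOn.integrableOn_compact
      (isCompact_closedBall x₀ (s / 2))).mono_set Metric.ball_subset_closedBall
  calc ∫ x in Metric.ball x₀ (s / 2), U x ^ N
      ≤ ∫ x in Metric.ball x₀ (s / 2), k ^ N * (2 ^ (4 * N) * (2 + ψ x ^ (q + 1))) :=
        setIntegral_mono_on hUi (((hc.add hψi.integrableOn).const_mul _).const_mul _)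
          Metric.isOpen_ball.measurableSet hpt
    _ = k ^ N * (2 ^ (4 * N) * (2 * volume.real (Metric.ball x₀ (s / 2)) +
          ∫ x in Metric.ball x₀ (s / 2), ψ x ^ (q + 1))) := by
        rw [integral_const_mul, integral_const_mul, integral_add hc hψi.integrableOn,
          setIntegral_const, smul_eq_mul, mul_comm (2 : ℝ)]
    _ ≤ k ^ N * (2 ^ (4 * N) * (2 * (s ^ N * ω) + C₃ * s ^ N)) := by
        gcongr
        · rw [volume_real_ball x₀ (by positivity : 0 < s / 2)]
          gcongr
          linarith
        · exact (setIntegral_le_integral hψi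
            (.of_forall fun x => rpow_nonneg (hψA.nonneg x) _)).trans hJle
    _ = _ := by ring

/-- Caccioppoli's inequality with a cutoff supported where `U ≤ 1`. -/
lemma IsExtSolution.caccioppoli (hN : 2 ≤ N) (hH : IsFinslerNorm N H)
    (hreg : FinslerRegular N H) (hb : Bornology.IsBounded Ω) (hp : (N : ℝ) ≤ p)
    (hU : IsExtSolution N H Ω p U) {ζ : Euc N → ℝ} (hζ : BddLip ζ) (hζ0 : ∀ x, 0 ≤ ζ x)
    (hζ1 : ∀ x, ζ x ≤ 1) {B : Set (Euc N)} (hB : MeasurableSet B) (hζB : ∀ x ∉ B, ζ x = 0)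
    (hU1 : ∀ x, ζ x ≠ 0 → U x ≤ 1) {d : ℝ} (hd : ∀ x, H (gradient ζ x) ≤ d)  :
    ∫ x, ζ x ^ N * H (gradient U x) ^ N ≤ (2 + (2 * N * d) ^ N) * ∫ x in B, U x ^ N := by
  have hN2 : (2 : ℝ) ≤ N := by exact_mod_cast hN
  have hd0 : 0 ≤ d := (norm_nonneg' hH _).trans (hd 0)
  have hφ : Adm Ω fun x => U x * ζ x ^ N := hU.adm.mul_of_nonneg (hζ.pow N) fun x => pow_nonneg (hζ0 x) N
  have hweak := hU.weak _ hφ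
  obtain ⟨M, hM⟩ := (hζ.pow N).2
  have hi1 : Integrable fun x => ζ x ^ N * H (gradient U x) ^ N :=
    hU.adm.integrable_weight_mul hN hH hb (hζ.pow N).continuous.measurable hM
  have hUN : Integrable fun x => U x ^ N := by
    simpa using hU.adm.integrable_rpow hb (q := N) (by linarith)
  have hi2 : Integrable (B.indicator fun x => U x ^ N) := hUN.indicator hB
  have hrhs : ∫ x, U x ^ p * (U x * ζ x ^ N) ≤ ∫ x, B.indicator (fun x => U x ^ N) x := by
    obtain ⟨L, hL⟩ := hφ.bddLip.2
    refine integral_mono (hU.adm.integrable_rpow_mul hb (by linarith)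
      hφ.continuous.measurable hL) hi2 fun x => ?_
    have hU0 := hU.adm.nonneg x
    by_cases hx : ζ x = 0
    · simp only [hx, zero_pow (show N ≠ 0 by omega), mul_zero]
      exact indicator_nonneg (fun y _ => pow_nonneg (hU.adm.nonneg y) N) x
    · have hxB : x ∈ B := by
        by_contra h
        exact hx (hζB x h)
      rw [indicator_of_mem hxB]
      have h1 := hU1 x hx
      have h2 : ζ x ^ N ≤ 1 := pow_le_one₀ (hζ0 x) (hζ1 x)
      have h3 : U x ^ p ≤ U x ^ N := by
        rw [← rpow_natCast (U x) N]
        exact rpow_le_rpow_of_exponent_ge' hU0 h1 (by linarith) hp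
      have h4 : U x * ζ x ^ N ≤ 1 := mul_le_one₀ h1 (pow_nonneg (hζ0 x) N) h2
      calc U x ^ p * (U x * ζ x ^ N) ≤ U x ^ p * 1 := by gcongr
        _ ≤ _ := by rwa [mul_one]
  have hlhs : ∫ x, (1 / 2 * (ζ x ^ N * H (gradient U x) ^ N) -
      (2 * N * d) ^ N / 2 * B.indicator (fun x => U x ^ N) x) ≤
      ∫ x, flux N H (gradient U x) (gradient (fun x => U x * ζ x ^ N) x) := by
    refine integral_mono_ae ((hi1.const_mul _).sub (hi2.const_mul _))
      (hU.adm.integrable_flux hN hH hreg hb hφ) ?_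
    filter_upwards [hU.adm.bddLip.ae_differentiableAt, hζ.ae_differentiableAt] with x hx hζx
    have hU0 := hU.adm.nonneg x
    by_cases hxz : ζ x = 0
    · have h0 : (fun x => U x * ζ x ^ N) x = 0 := by
        simp [hxz, show N ≠ 0 by omega]
      rw [hφ.gradient_eq_zero h0, show (0 : Euc N) = (0 : ℝ) • 0 by simp, flux_smul, zero_mul, hxz,
        zero_pow (by omega), zero_mul, mul_zero, zero_sub]
      have := indicator_nonneg (s := B) (fun y _ => pow_nonneg (hU.adm.nonneg y) N) x
      rw [Left.neg_nonpos_iff]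
      positivity
    · have hxB : x ∈ B := by
        by_contra h
        exact hxz (hζB x h)
      rw [indicator_of_mem hxB, gradient_mul hx (hζx.fun_pow N), gradient_pow hζx, smul_smul,
        flux_add, flux_smul, flux_smul, flux_self hN hH hreg]
      have hH0 := norm_nonneg' hH (gradient U x)
      have hz0 := hζ0 x
      have hy := young_pow hN (mul_nonneg hz0 hH0) (mul_nonneg hU0 hd0)
      have hf := (neg_abs_le _).trans' (neg_le_neg
        (abs_flux_le hN hH hreg (gradient U x) (gradient ζ x)))
      have hf2 : -(H (gradient U x) ^ (N - 1) * d) ≤ flux N H (gradient U x) (gradient ζ x) := by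
        refine le_trans (neg_le_neg ?_) hf
        gcongr
        exact hd x
      have hf3 : U x * (N * ζ x ^ (N - 1)) * -(H (gradient U x) ^ (N - 1) * d) ≤
          U x * (N * ζ x ^ (N - 1)) * flux N H (gradient U x) (gradient ζ x) := by gcongr
      have e : U x * (N * ζ x ^ (N - 1)) * -(H (gradient U x) ^ (N - 1) * d) =
          -(N * (ζ x * H (gradient U x)) ^ (N - 1) * (U x * d)) := by
        rw [mul_pow]
        ring
      have e2 : (2 * (N : ℝ)) ^ N / 2 * (U x * d) ^ N = (2 * N * d) ^ N / 2 * U x ^ N := by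
        rw [mul_pow (U x), mul_pow _ d]
        ring
      rw [mul_pow _ _ N] at hy
      linarith
  rw [hweak, integral_sub (hi1.const_mul _) (hi2.const_mul _), integral_const_mul,
    integral_const_mul, integral_indicator hB] at hlhs
  rw [integral_indicator hB] at hrhs
  linarith

/-- Cutting off `U` inside a small ball increases the energy by a controlled amount. -/
lemma IsExtSolution.energy_cutoff_le (hN : 2 ≤ N) (hH : IsFinslerNorm N H)
    (hreg : FinslerRegular N H) (hb : Bornology.IsBounded Ω) (hp : (N : ℝ) ≤ p)
    (hU : IsExtSolution N H Ω p U) {b : ℝ} (hb0 : 0 < b) (hbH : ∀ x, H x ≤ b * ‖x‖) {x₀ : Euc N}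
    {s : ℝ} (hs : 0 < s) (hs1 : s ≤ 1) (hU1 : ∀ x, s / 16 ≤ dist x x₀ → U x ≤ 1) :
    energy N H (fun x => U x * cutoff x₀ (s / 4) x) ≤ energy N H U +
      2 ^ N * (2 + (32 * N * b) ^ N + (8 * b) ^ N) / s ^ N *
        ∫ x in Metric.ball x₀ (s / 2), U x ^ N := by
  set B := Metric.ball x₀ (s / 2) with hBdef
  have hB : MeasurableSet B := Metric.isOpen_ball.measurableSet
  set η := cutoff x₀ (s / 4) with hη
  have hs4 : 0 < s / 4 := by positivity
  have hs2 : 0 < s / 2 := by positivity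
  have hs8 : 0 < s / 8 := by positivity
  set ζ : Euc N → ℝ := fun x => min (cutoff x₀ (s / 2) x) (1 - cutoff x₀ (s / 8) x) with hζdef
  have hζ0 : ∀ x, 0 ≤ ζ x := fun x =>
    le_min (cutoff_nonneg _ _ _) (sub_nonneg.2 (cutoff_le_one _ _ _))
  have hζ1 : ∀ x, ζ x ≤ 1 := fun x => (min_le_left _ _).trans (cutoff_le_one _ _ _)
  have hζL : LipschitzWith (16 / s).toNNReal ζ := by
    refine ((lipschitzWith_cutoff x₀ hs2).min
      ((LipschitzWith.const 1).sub (lipschitzWith_cutoff x₀ hs8))).weaken ?_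
    rw [zero_add]
    refine max_le (Real.toNNReal_mono ?_) (Real.toNNReal_mono ?_)
    · rw [show 2 / (s / 2) = 4 / s by field_simp; norm_num]
      gcongr
      norm_num
    · rw [show 2 / (s / 8) = 16 / s by field_simp; norm_num]
  have hζ : BddLip ζ := ⟨⟨_, hζL⟩, 1, fun x => by
    rw [abs_of_nonneg (hζ0 x)]
    exact hζ1 x⟩
  have hd : ∀ x, H (gradient ζ x) ≤ b * (16 / s) := fun x =>
    (hbH _).trans (by
      gcongr
      exact (norm_gradient_le hζL x).trans_eq (Real.coe_toNNReal _ (by positivity)))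
  have hζB : ∀ x ∉ B, ζ x = 0 := fun x hx =>
    le_antisymm ((min_le_left _ _).trans_eq (cutoff_eq_zero hs2 (by simpa [hBdef] using hx))) (hζ0 x)
  have hζU : ∀ x, ζ x ≠ 0 → U x ≤ 1 := fun x hx => by
    refine hU1 x ?_
    by_contra! h
    refine hx (le_antisymm ((min_le_right _ _).trans_eq ?_) (hζ0 x))
    rw [cutoff_eq_one hs8 (by linarith), sub_self]
  have hcacc := hU.caccioppoli hN hH hreg hb hp hζ hζ0 hζ1 hB hζB hζU hd
  set M := ∫ x in B, U x ^ N with hM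
  have hM0 : 0 ≤ M := integral_nonneg fun x => pow_nonneg (hU.adm.nonneg x) N
  obtain ⟨L, hL⟩ := (hζ.pow N).2
  have hi1 := hU.adm.integrable_energy hN hH hb
  have hi2 : Integrable fun x => ζ x ^ N * H (gradient U x) ^ N :=
    hU.adm.integrable_weight_mul hN hH hb (hζ.pow N).continuous.measurable hL
  have hi3 : Integrable (B.indicator fun x => U x ^ N) :=
    integrable_indicator_ball (hU.adm.continuous.pow N) x₀ _
  have hi4 : Integrable fun x => 2 ^ N * (ζ x ^ N * H (gradient U x) ^ N + (8 * b / s) ^ N *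
      B.indicator (fun x => U x ^ N) x) := (hi2.add (hi3.const_mul _)).const_mul _
  have hφ := hU.adm.mul_cutoff x₀ hs4
  have hle : energy N H (fun x => U x * η x) ≤ ∫ x, (H (gradient U x) ^ N +
      2 ^ N * (ζ x ^ N * H (gradient U x) ^ N + (8 * b / s) ^ N *
        B.indicator (fun x => U x ^ N) x)) := by
    refine integral_mono_ae (hφ.integrable_energy hN hH hb)
      (hi1.add hi4) ?_
    filter_upwards [hU.adm.bddLip.ae_differentiableAt,
      (bddLip_cutoff x₀ hs4).ae_differentiableAt] with x hx hηx
    have hU0 := hU.adm.nonneg x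
    have hH0 := norm_nonneg' hH (gradient U x)
    have hz0 := hζ0 x
    have hI0 := indicator_nonneg (s := B) (fun y _ => pow_nonneg (hU.adm.nonneg y) N) x
    rcases le_or_gt (dist x x₀) (s / 8) with h | h
    · have hη1 : η x = 1 := cutoff_eq_one hs4 (by linarith)
      rw [gradient_mul hx hηx, gradient_eq_zero_of_le (cutoff_le_one x₀ _) hη1, smul_zero,
        zero_add, show cutoff x₀ (s / 4) x = 1 from hη1, one_smul]
      exact le_add_of_nonneg_right (by positivity)
    rcases le_or_gt (s / 4) (dist x x₀) with h' | h'
    · have h0 : (fun x => U x * η x) x = 0 := by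
        simp [hη, cutoff_eq_zero hs4 h']
      rw [hφ.gradient_eq_zero h0, norm_zero' hH, zero_pow (by omega)]
      positivity
    · have hz : ζ x = 1 := by
        rw [hζdef]
        simp only
        rw [cutoff_eq_one hs2 (by linarith), cutoff_eq_zero hs8 h.le]
        norm_num
      have hxB : x ∈ B := by
        rw [hBdef, Metric.mem_ball]
        linarith
      rw [hz, indicator_of_mem hxB, one_pow, one_mul, ← mul_pow, gradient_mul hx hηx]
      have h1 : H (U x • gradient η x + η x • gradient U x) ≤
          H (gradient U x) + 8 * b / s * U x := by
        refine (norm_add_le' hH _ _).trans ?_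
        have hη0 := cutoff_nonneg x₀ (s / 4) x
        rw [norm_smul' hH, norm_smul' hH, abs_of_nonneg hU0, abs_of_nonneg hη0]
        have h2 : H (gradient η x) ≤ b * (2 / (s / 4)) :=
          (hbH _).trans (by gcongr; exact norm_gradient_cutoff_le x₀ hs4 x)
        have h3 : U x * H (gradient η x) ≤ U x * (b * (2 / (s / 4))) := by gcongr
        have h4 : η x * H (gradient U x) ≤ 1 * H (gradient U x) := by
          gcongr
          exact cutoff_le_one _ _ _
        calc _ ≤ U x * (b * (2 / (s / 4))) + 1 * H (gradient U x) := add_le_add h3 h4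
          _ = _ := by
            field_simp
            ring
      have h5 := (pow_le_pow_left₀ (norm_nonneg' hH _) h1 N).trans
        (add_pow_le_two_pow_mul hH0 (by positivity) N)
      have h6 : 0 ≤ H (gradient U x) ^ N := by positivity
      linarith
  rw [integral_add hi1 hi4, integral_const_mul,
    integral_add hi2 (hi3.const_mul _), integral_const_mul, integral_indicator hB] at hle
  have hsN : s ^ N ≤ 1 := pow_le_one₀ hs.le hs1
  have e1 : 2 + (2 * N * (b * (16 / s))) ^ N + (8 * b / s) ^ N ≤
      (2 + (32 * N * b) ^ N + (8 * b) ^ N) / s ^ N := by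
    rw [add_div, add_div, ← div_pow, ← div_pow, show 2 * N * (b * (16 / s)) = 32 * N * b / s by ring]
    gcongr
    rw [le_div_iff₀ (by positivity)]
    linarith
  calc energy N H (fun x => U x * η x)
      ≤ energy N H U + 2 ^ N * ((2 + (2 * N * (b * (16 / s))) ^ N) * M + (8 * b / s) ^ N * M) :=
        hle.trans (by rw [energy]; gcongr)
    _ = energy N H U + 2 ^ N * ((2 + (2 * N * (b * (16 / s))) ^ N + (8 * b / s) ^ N) * M) := by ring
    _ ≤ energy N H U + 2 ^ N * ((2 + (32 * N * b) ^ N + (8 * b) ^ N) / s ^ N * M) := by gcongr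
    _ = _ := by ring

end Local

section BlowUp

variable {N : ℕ} {H : Euc N → ℝ} {Ω : Set (Euc N)} {p : ℝ} {U : Euc N → ℝ}

/-- Away from a unique blow-up point the sequence is eventually bounded. -/
lemma exists_eventually_bound (hb : Bornology.IsBounded Ω) {v : ℕ → Euc N → ℝ} {x₀ : Euc N}
    (hS : BlowUpSet Ω v = {x₀}) {r : ℝ} (hr : 0 < r) :
    ∃ K : ℝ, ∀ᶠ n in atTop, ∀ x ∈ Ω, r ≤ dist x x₀ → v n x ≤ K := by
  by_contra! hcon
  have hfreq : ∀ j m : ℕ, ∃ n, m < n ∧ ∃ x ∈ Ω, r ≤ dist x x₀ ∧ (j : ℝ) < v n x := fun j m => by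
    obtain ⟨n, hn, hx⟩ := frequently_atTop.1 (hcon j) (m + 1)
    exact ⟨n, hn, hx⟩
  choose F hF using hfreq
  let σ : ℕ → ℕ := fun j => Nat.rec (F 0 0) (fun i m => F (i + 1) m) j
  have hσ : StrictMono σ := strictMono_nat_of_lt_succ fun i => (hF (i + 1) (σ i)).1
  have hσx : ∀ j : ℕ, ∃ x ∈ Ω, r ≤ dist x x₀ ∧ (j : ℝ) < v (σ j) x := fun j => by
    cases j with
    | zero => exact (hF 0 0).2
    | succ i => exact (hF (i + 1) (σ i)).2
  choose xs hxΩ hxr hxv using hσx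
  obtain ⟨x, hx, τ, hτ, hlim⟩ := hb.isCompact_closure.tendsto_subseq
    fun j => subset_closure (hxΩ j)
  have hmem : x ∈ BlowUpSet Ω v := by
    refine ⟨hx, σ ∘ τ, hσ.comp hτ, xs ∘ τ, fun n => hxΩ _, hlim, ?_⟩
    refine tendsto_atTop_mono (fun n => (hxv (τ n)).le) ?_
    exact tendsto_natCast_atTop_atTop.comp hτ.tendsto_atTop
  rw [hS, mem_singleton_iff] at hmem
  have hle : r ≤ dist x x₀ :=
    ge_of_tendsto (hlim.dist tendsto_const_nhds) (.of_forall fun n => hxr (τ n))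
  rw [hmem, dist_self] at hle
  linarith

/-- If the mass concentrates in `B_{s/16}(x₀)`, then comparing with a cutoff solution transplanted
into an inner ball of radius `ρ` bounds `ρ / s`. -/
lemma IsExtSolution.ratio_pow_le (hN : 2 ≤ N) (hH : IsFinslerNorm N H)
    (hreg : FinslerRegular N H) (hΩo : IsOpen Ω) (hΩne : Ω.Nonempty) (hb : Bornology.IsBounded Ω)
    (hp : (N : ℝ) ≤ p) (hU : IsExtSolution N H Ω p U) {y₀ : Euc N} {ρ : ℝ} (hρ : 0 < ρ)
    (hball : Metric.ball y₀ ρ ⊆ Ω) {k : ℝ} (hk : 0 < k) (hkI : k ^ (N - 1) = ∫ x, U x ^ p)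
    {A : ℝ} (hA : p * k ^ N ≤ A * energy N H U) {b : ℝ} (hb0 : 0 < b) (hbH : ∀ x, H x ≤ b * ‖x‖)
    {x₀ : Euc N} {s : ℝ} (hs : 0 < s) (hs1 : s ≤ 1) {C : ℝ} (hC : 0 < C)
    (hmass : ∫ x in Metric.ball x₀ (s / 2), U x ^ N ≤ C * s ^ N * k ^ N) {K : ℝ} (hK : 0 ≤ K)
    (hUK : ∀ x, s / 16 ≤ dist x x₀ → U x ≤ K * k) (hKk : K * k ≤ 1) (hKp : 2 * K * A ≤ p) :
    (4 * ρ / s) ^ N ≤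
      2 * Real.exp (2 ^ N * (2 + (32 * N * b) ^ N + (8 * b) ^ N) * C * A) := by
  have hN2 : (2 : ℝ) ≤ N := by exact_mod_cast hN
  have hp1 : 1 < p := by linarith
  have hp0 : 0 < p := by linarith
  have hs4 : 0 < s / 4 := by positivity
  set E := energy N H U with hE
  have hE0 : 0 < E := hU.energy_pos hN hH hreg hΩo hΩne hb hp1
  have hA0 : 0 < A := by
    have h1 : 0 < A * E := lt_of_lt_of_le (by positivity) hA
    exact pos_of_mul_pos_left h1 hE0.le
  have hkN : k ^ N ≤ A * E / p := by
    rw [le_div_iff₀ hp0]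
    linarith
  set c : ℝ := 2 ^ N * (2 + (32 * N * b) ^ N + (8 * b) ^ N) with hc
  have hc0 : 0 < c := by positivity
  set D := c * C * A with hD
  have hD0 : 0 < D := by positivity
  have hφE := hU.energy_cutoff_le hN hH hreg hb hp hb0 hbH hs hs1
    fun x hx => (hUK x hx).trans hKk
  rw [← hc] at hφE
  set φ : Euc N → ℝ := fun x => U x * cutoff x₀ (s / 4) x with hφ
  have hφA : Adm (Metric.ball x₀ (s / 4)) φ := hU.adm.mul_cutoff_ball x₀ hs4
  have hφE' : energy N H φ ≤ E * (1 + D / p) := by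
    calc energy N H φ ≤ E + c / s ^ N * (C * s ^ N * k ^ N) := hφE.trans (by gcongr)
      _ = E + c * C * k ^ N := by field_simp
      _ ≤ E + c * C * (A * E / p) := by gcongr
      _ = _ := by rw [hD]; ring
  have hφI := hφA.integrable_rpow Metric.isBounded_ball (by linarith : 0 < p + 1)
  set J := ∫ x, φ x ^ (p + 1) with hJ
  have hJ0 : 0 ≤ J := integral_nonneg fun x => rpow_nonneg (hφA.nonneg x) _
  have hJE : E / 2 ≤ J := by
    have hUp := hU.adm.integrable_rpow hb hp0
    have h1 : E ≤ J + K * k * k ^ (N - 1) := by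
      rw [hE, hU.energy_eq hN hH hreg hp1, hkI, ← integral_const_mul,
        ← integral_add hφI (hUp.const_mul _)]
      refine integral_mono (hU.adm.integrable_rpow hb (by linarith))
        (hφI.add (hUp.const_mul _)) fun x => ?_
      have hU0 := hU.adm.nonneg x
      have hφ0 := hφA.nonneg x
      rcases le_or_gt (dist x x₀) (s / 8) with h | h
      · have hx : φ x = U x := by
          rw [hφ]
          simp only
          rw [cutoff_eq_one hs4 (by linarith), mul_one]
        rw [hx]
        exact le_add_of_nonneg_right (by positivity)
      · rw [rpow_add_one' hU0 (by linarith), mul_comm]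
        have h2 : U x * U x ^ p ≤ K * k * U x ^ p := by
          gcongr
          exact hUK x (by linarith)
        exact h2.trans (le_add_of_nonneg_left (by positivity))
    have h2 : K * k * k ^ (N - 1) = K * k ^ N := by
      rw [mul_assoc, ← pow_succ', Nat.sub_add_cancel (by omega)]
    have h3 : K * k ^ N ≤ E / 2 := by
      calc K * k ^ N ≤ K * (A * E / p) := by gcongr
        _ = 2 * K * A / p * (E / 2) := by ring
        _ ≤ 1 * (E / 2) := by
          gcongr
          exact (div_le_one hp0).2 hKp
        _ = _ := one_mul _
    linarith
  have hS := (energyInf_mul_le_of_ball hN hH hΩo hb hp1 hρ hball hs4 hφA).trans hφE'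
  rw [hU.energyInf_eq hN hH hreg hΩo hΩne hb hp1, ← hE, rpow_sub hE0, rpow_one,
    show ρ / (s / 4) = 4 * ρ / s by field_simp, ← hJ] at hS
  set X := (4 * ρ / s) ^ N * J with hX
  have hX0 : 0 ≤ X := by positivity
  set t := (N : ℝ) / (p + 1) with ht
  have ht0 : 0 < t := by positivity
  have hEt : 0 < E ^ t := rpow_pos_of_pos hE0 t
  have hX1 : X ^ t ≤ E ^ t * (1 + D / p) := by
    have h1 : E * X ^ t ≤ E * (E ^ t * (1 + D / p)) := by
      rw [div_mul_eq_mul_div, div_le_iff₀ hEt] at hS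
      linarith
    exact le_of_mul_le_mul_left h1 hE0
  have hX2 : X ^ t ≤ (E * Real.exp D) ^ t := by
    refine hX1.trans ?_
    rw [mul_rpow hE0.le (Real.exp_pos _).le, ← Real.exp_mul]
    gcongr
    refine le_trans ?_ (Real.add_one_le_exp _)
    rw [add_comm]
    gcongr
    rw [div_eq_mul_inv]
    gcongr
    rw [ht, inv_le_comm₀ hp0 (by positivity), inv_div, div_le_iff₀ (by positivity)]
    nlinarith
  have hX3 : X ≤ E * Real.exp D := (rpow_le_rpow_iff hX0 (by positivity) ht0).1 hX2
  have h4 : (4 * ρ / s) ^ N * (E / 2) ≤ 2 * Real.exp D * (E / 2) := by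
    calc _ ≤ X := by rw [hX]; gcongr
      _ ≤ _ := hX3
      _ = _ := by ring
  exact le_of_mul_le_mul_right h4 (by positivity)

theorem mem_of_blowUpSet_eq_singleton (hN : 2 ≤ N) (hH : IsFinslerNorm N H)
    (hreg : FinslerRegular N H) (hΩo : IsOpen Ω) (hb : Bornology.IsBounded Ω) (hΩne : Ω.Nonempty)
    {p : ℕ → ℝ} (hp : ∀ n, 1 < p n) (hptop : Tendsto p atTop atTop)
    {u : ℕ → Euc N → ℝ} (hu : ∀ n, IsLeastEnergySolution N H Ω (p n) (u n))
    {v : ℕ → Euc N → ℝ}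
    (hv : ∀ n x, v n x = u n x / (∫ y in Ω, u n y ^ p n) ^ (1 / ((N : ℝ) - 1)))
    {x₀ : Euc N} (hS : BlowUpSet Ω v = {x₀}) : x₀ ∈ Ω := by
  by_contra hx₀
  have hN2 : (2 : ℝ) ≤ N := by exact_mod_cast hN
  have hU : ∀ n, IsExtSolution N H Ω (p n) (Ω.indicator (u n)) := fun n =>
    isExtSolution_of_leastEnergy hN hH hreg hΩo hb (hp n) (hu n)
  have hI : ∀ n, ∫ x, Ω.indicator (u n) x ^ p n = ∫ x in Ω, u n x ^ p n := fun n =>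
    integral_indicator_rpow hΩo (by linarith [hp n]) (u n)
  set k : ℕ → ℝ := fun n => (∫ y in Ω, u n y ^ p n) ^ (1 / ((N : ℝ) - 1)) with hk
  have hI0 : ∀ n, 0 < ∫ x in Ω, u n x ^ p n := fun n => by
    rw [← hI]
    exact rpow_pos_integral hΩo hΩne hb (hU n).adm (hU n).pos (by linarith [hp n])
  have hk0 : ∀ n, 0 < k n := fun n => rpow_pos_of_pos (hI0 n) _
  have hkI : ∀ n, k n ^ (N - 1) = ∫ x, Ω.indicator (u n) x ^ p n := fun n => by
    rw [hI, hk]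
    simp only
    rw [← rpow_natCast, ← rpow_mul (hI0 n).le, Nat.cast_sub (by omega), Nat.cast_one,
      one_div_mul_cancel (by linarith), rpow_one]
  obtain ⟨A, hA1, hA⟩ := exists_scale_bound hN hH hreg hΩo hΩne hb
  obtain ⟨b, hb0, hbH⟩ := exists_norm_le hH
  obtain ⟨y₀, hy₀⟩ := id hΩne
  obtain ⟨ρ, hρ, hball⟩ := Metric.isOpen_iff.1 hΩo y₀ hy₀
  obtain ⟨m, hm⟩ := (hptop.eventually_ge_atTop (4 * (N : ℝ))).exists
  have hΛ : 0 < energyInf N H Ω (p m) := by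
    rw [(hU m).energyInf_eq hN hH hreg hΩo hΩne hb (hp m)]
    exact rpow_pos_of_pos ((hU m).energy_pos hN hH hreg hΩo hΩne hb (hp m)) _
  obtain ⟨ε, hε, hthin⟩ := (hU m).exists_thin_ball hN hH hreg hb (indicator_of_notMem hx₀ _)
  obtain ⟨C, hC, hmass⟩ := exists_local_mass_bound hN hH hreg hΩo hΩne hb (by linarith) hΛ hε x₀
  set D : ℝ := 2 ^ N * (2 + (32 * N * b) ^ N + (8 * b) ^ N) * C * A with hD
  have hD0 : 0 ≤ D := by positivity
  obtain ⟨s, hs, hsr, hths⟩ := hthin (min 1 (4 * ρ / (2 * Real.exp D))) (by positivity)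
  have hs1 : s ≤ 1 := (hsr.trans_le (min_le_left _ _)).le
  have hratio : 2 * Real.exp D < (4 * ρ / s) ^ N := by
    have h1 : s < 4 * ρ / (2 * Real.exp D) := hsr.trans_le (min_le_right _ _)
    have h2 : 2 * Real.exp D < 4 * ρ / s := by
      rw [lt_div_iff₀ (by positivity)] at h1
      rw [lt_div_iff₀ hs]
      linarith
    have h3 : 1 ≤ Real.exp D := Real.one_le_exp hD0
    exact h2.trans_le (le_self_pow₀ (by linarith) (by omega))
  obtain ⟨K₀, hK₀⟩ := exists_eventually_bound hb hS (by positivity : 0 < s / 16)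
  set K := max K₀ 1 with hK
  have hK1 : 1 ≤ K := le_max_right _ _
  obtain ⟨n, hnK, hnA, hnN, hnKA, hnKN⟩ := (hK₀.and ((hptop.eventually_ge_atTop A).and
    ((hptop.eventually_ge_atTop (N : ℝ)).and ((hptop.eventually_ge_atTop (2 * K * A)).and
      (hptop.eventually_ge_atTop (K ^ N * A)))))).exists
  obtain ⟨hkE, hE1⟩ := hA (p n) _ (k n) hnA (hU n) (hk0 n).le (hkI n)
  have hp0 : 0 < p n := by linarith [hp n]
  have hk0n := hk0 n
  have hKk : K * k n ≤ 1 := by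
    refine (pow_le_one_iff_of_nonneg (by positivity) (by omega : N ≠ 0)).1 ?_
    have h1 : p n * (K * k n) ^ N ≤ p n * 1 := by
      calc p n * (K * k n) ^ N = K ^ N * (p n * k n ^ N) := by ring
        _ ≤ K ^ N * (A * energy N H (Ω.indicator (u n))) := by gcongr
        _ ≤ K ^ N * (A * 1) := by gcongr
        _ ≤ _ := by linarith
    exact le_of_mul_le_mul_left h1 hp0
  refine hratio.not_ge ((hU n).ratio_pow_le hN hH hreg hΩo hΩne hb hnN hρ hball hk0n (hkI n) hkE
    hb0 hbH hs hs1 hC (hmass s hs hths (p n) _ (k n) (hp n) (hU n) hk0n (hkI n)) (by positivity)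
    (fun x hx => ?_) hKk hnKA)
  by_cases hxΩ : x ∈ Ω
  · have h := (hnK x hxΩ hx).trans (le_max_left K₀ 1)
    rw [hv, div_le_iff₀ (hk0 n)] at h
    rwa [indicator_of_mem hxΩ]
  · rw [indicator_of_notMem hxΩ]
    positivity

end BlowUp

end FinslerLaneEmden

/-- If the blow-up set is a single point, it is an interior point (Theorem 1.4). -/
theorem one_point_blowup_interior (N : ℕ) (hN : 2 ≤ N) (H : Euc N → ℝ)
    (hnorm : IsFinslerNorm N H) (hreg : FinslerRegular N H)
    (Ω : Set (Euc N)) (hΩo : IsOpen Ω) (hΩb : Bornology.IsBounded Ω) (hΩne : Ω.Nonempty)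
    (p : ℕ → ℝ) (hp : ∀ n, 1 < p n) (hptop : Tendsto p atTop atTop)
    (u : ℕ → Euc N → ℝ) (hu : ∀ n, IsLeastEnergySolution N H Ω (p n) (u n))
    (v : ℕ → Euc N → ℝ)
    (hv : ∀ n x, v n x = u n x / (∫ y in Ω, u n y ^ p n) ^ (1 / ((N : ℝ) - 1)))
    (x₀ : Euc N) (hx₀ : x₀ ∈ closure Ω) (hS : BlowUpSet Ω v = {x₀}) :
    x₀ ∈ Ω := by
  exact FinslerLaneEmden.mem_of_blowUpSet_eq_singleton hN hnorm hreg hΩo hΩb hΩne hp hptop hu hv hS
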